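/- For every A > 0 there exist x₀ = x₀(A) and a constant C = C(A) such that for all real x > x₀ and all real Q with 1 ≤ Q ≤ x, one has |V(x,Q) − Q x log x| ≤ C (Q x log(2x/Q) + x² (log x)^{−A}). -/

import Mathlib

open Finset

/-- `ψ(x;q,a) = Σ_{n ≤ x, n ≡ a (mod q)} Λ(n)`. -/
noncomputable def psi (x : ℝ) (q a : ℕ) : ℝ :=
  ∑ n ∈ (Finset.Icc 1 ⌊x⌋₊).filter (fun n => n % q = a % q),
    ArithmeticFunction.vonMangoldt n

/-- `V(x,Q) = Σ_{q ≤ Q} Σ_{1 ≤ a ≤ q, gcd(a,q)=1} |ψ(x;q,a) − x/φ(q)|²`. -/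
noncomputable def V (x Q : ℝ) : ℝ :=
  ∑ q ∈ Finset.Icc 1 ⌊Q⌋₊,
    ∑ a ∈ (Finset.Icc 1 q).filter (fun a => Nat.gcd a q = 1),
      (psi x q a - x / (Nat.totient q : ℝ)) ^ 2

namespace MontgomeryHooley

open Complex MeasureTheory Filter Topology

/-- The remainder `∑_{n ≤ u} f n - κ u` of the summatory function of `f`. -/
noncomputable def remainder (f : ℕ → ℂ) (κ : ℂ) (u : ℝ) : ℂ :=
  (∑ k ∈ Icc 1 ⌊u⌋₊, f k) - κ * u

/-- The integral `∫_N^∞ (∑_{n ≤ u} f n - κ u) u^{-s-1} du`. -/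
noncomputable def tail (f : ℕ → ℂ) (κ : ℂ) (N : ℕ) (s : ℂ) : ℂ :=
  ∫ u in Set.Ioi (N : ℝ), remainder f κ u * (u : ℂ) ^ (-(s + 1))

lemma measurable_remainder (f : ℕ → ℂ) (κ : ℂ) : Measurable (remainder f κ) := by
  have h : Measurable fun u : ℝ => ∑ k ∈ Icc 1 ⌊u⌋₊, f k :=
    (measurable_from_nat (f := fun n : ℕ => ∑ k ∈ Icc 1 n, f k)).comp Nat.measurable_floor
  exact h.sub (measurable_const.mul Complex.measurable_ofReal)

variable {f : ℕ → ℂ} {κ : ℂ} {M : ℝ}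

lemma norm_tail_integrand_le (hE : ∀ u : ℝ, 1 ≤ u → ‖remainder f κ u‖ ≤ M) {N : ℕ} (hN : 1 ≤ N)
    (s : ℂ) {u : ℝ} (hu : u ∈ Set.Ioi (N : ℝ)) :
    ‖remainder f κ u * (u : ℂ) ^ (-(s + 1))‖ ≤ M * u ^ (-(s.re + 1)) := by
  have hu1 : (1 : ℝ) < u := lt_of_le_of_lt (by exact_mod_cast hN) hu
  rw [norm_mul, Complex.norm_cpow_eq_rpow_re_of_pos (by linarith)]
  simp only [neg_re, add_re, one_re]
  exact mul_le_mul_of_nonneg_right (hE u hu1.le) (by positivity)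

lemma integrableOn_tail (hE : ∀ u : ℝ, 1 ≤ u → ‖remainder f κ u‖ ≤ M) {N : ℕ} (hN : 1 ≤ N)
    {s : ℂ} (hs : 0 < s.re) :
    IntegrableOn (fun u : ℝ => remainder f κ u * (u : ℂ) ^ (-(s + 1))) (Set.Ioi (N : ℝ)) := by
  have hN0 : (0 : ℝ) < N := by exact_mod_cast hN
  refine Integrable.mono' (g := fun u : ℝ => M * u ^ (-(s.re + 1))) ?_ ?_ ?_
  · exact (integrableOn_Ioi_rpow_of_lt (by linarith) hN0).const_mul M
  · refine (measurable_remainder f κ).aestronglyMeasurable.mul ?_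
    refine Measurable.aestronglyMeasurable ?_
    fun_prop
  · filter_upwards [ae_restrict_mem measurableSet_Ioi] with u hu
      using norm_tail_integrand_le hE hN s hu

lemma norm_tail_le (hE : ∀ u : ℝ, 1 ≤ u → ‖remainder f κ u‖ ≤ M) {N : ℕ} (hN : 1 ≤ N)
    {s : ℂ} (hs : 0 < s.re) :
    ‖tail f κ N s‖ ≤ M * (N : ℝ) ^ (-s.re) / s.re := by
  have hN0 : (0 : ℝ) < N := by exact_mod_cast hN
  have h1 : ‖tail f κ N s‖ ≤ ∫ u in Set.Ioi (N : ℝ), M * u ^ (-(s.re + 1)) := by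
    refine norm_integral_le_of_norm_le
      ((integrableOn_Ioi_rpow_of_lt (by linarith) hN0).const_mul M) ?_
    filter_upwards [ae_restrict_mem measurableSet_Ioi] with u hu
      using norm_tail_integrand_le hE hN s hu
  refine h1.trans (le_of_eq ?_)
  rw [integral_const_mul, integral_Ioi_rpow_of_lt (by linarith) hN0]
  rw [show -(s.re + 1) + 1 = -s.re by ring]
  field_simp

lemma differentiableAt_tail (hE : ∀ u : ℝ, 1 ≤ u → ‖remainder f κ u‖ ≤ M) {N : ℕ} (hN : 1 ≤ N)
    {s : ℂ} (hs : 0 < s.re) : DifferentiableAt ℂ (tail f κ N) s := by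
  have hN0 : (0 : ℝ) < N := by exact_mod_cast hN
  have hN1 : (1 : ℝ) ≤ N := by exact_mod_cast hN
  set g : ℝ → ℂ := Set.indicator (Set.Ioi (N : ℝ)) (remainder f κ) with hg
  have hM : 0 ≤ M := (norm_nonneg _).trans (hE 1 le_rfl)
  have hgb : ∀ u, ‖g u‖ ≤ M := by
    intro u
    by_cases hu : u ∈ Set.Ioi (N : ℝ)
    · rw [hg, Set.indicator_of_mem hu]
      exact hE u (hN1.trans (le_of_lt hu))
    · rw [hg, Set.indicator_of_notMem hu]
      simpa using hM
  have heq : tail f κ N = fun z => mellin g (-z) := by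
    funext z
    rw [tail, mellin, ← integral_indicator measurableSet_Ioi, ← integral_indicator measurableSet_Ioi]
    congr 1
    funext u
    by_cases hu : u ∈ Set.Ioi (N : ℝ)
    · have hu0 : u ∈ Set.Ioi (0 : ℝ) := hN0.trans hu
      rw [Set.indicator_of_mem hu, Set.indicator_of_mem hu0, hg, Set.indicator_of_mem hu,
        smul_eq_mul, mul_comm]
      congr 2
      ring
    · rw [Set.indicator_of_notMem hu, hg]
      by_cases hu0 : u ∈ Set.Ioi (0 : ℝ)
      · rw [Set.indicator_of_mem hu0, Set.indicator_of_notMem hu, smul_zero]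
      · rw [Set.indicator_of_notMem hu0]
  rw [heq]
  have hmeas : Measurable g := (measurable_remainder f κ).indicator measurableSet_Ioi
  have hd : DifferentiableAt ℂ (mellin g) (-s) := by
    refine mellin_differentiableAt_of_isBigO_rpow (a := 0) (b := (-s).re - 1) ?_ ?_ ?_ ?_ ?_
    · refine LocallyIntegrable.locallyIntegrableOn ?_ _
      refine (locallyIntegrable_const M).mono hmeas.aestronglyMeasurable ?_
      filter_upwards with u
      rw [Real.norm_of_nonneg hM]
      exact hgb u
    · refine Asymptotics.IsBigO.of_bound M ?_
      filter_upwards with u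
      simpa using hgb u
    · simpa using hs
    · refine Asymptotics.IsBigO.of_bound 1 ?_
      have : Set.Iio (N : ℝ) ∈ 𝓝[>] (0 : ℝ) :=
        mem_nhdsWithin_of_mem_nhds (Iio_mem_nhds hN0)
      filter_upwards [this] with u hu
      rw [hg, Set.indicator_of_notMem (by simpa using (le_of_lt hu))]
      simp
    · simp
  exact hd.comp s differentiableAt_id.neg

end MontgomeryHooley

namespace MontgomeryHooley

open Complex MeasureTheory Filter Topology

/-- Truncated Dirichlet series of `f` at `N` completed by the correction terms which continue it
to the half plane `0 < Re s`. -/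
noncomputable def approxSeries (f : ℕ → ℂ) (κ : ℂ) (N : ℕ) (s : ℂ) : ℂ :=
  (∑ n ∈ Icc 1 N, f n * (n : ℂ) ^ (-s)) + κ * (N : ℂ) ^ (1 - s) / (s - 1)
    - remainder f κ N * (N : ℂ) ^ (-s) + s * tail f κ N s

variable {f : ℕ → ℂ} {κ : ℂ} {M : ℝ}

lemma isBigO_sum_norm (hf : ∀ n, ‖f n‖ ≤ 1) :
    (fun n ↦ ∑ k ∈ Icc 1 n, ‖f k‖) =O[atTop] fun n : ℕ ↦ (n : ℝ) ^ (1 : ℝ) := by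
  refine Asymptotics.IsBigO.of_bound 1 ?_
  filter_upwards with n
  rw [Real.norm_of_nonneg (Finset.sum_nonneg fun _ _ => norm_nonneg _), Real.rpow_one,
    Real.norm_of_nonneg (Nat.cast_nonneg n), one_mul]
  calc ∑ k ∈ Icc 1 n, ‖f k‖ ≤ ∑ k ∈ Icc 1 n, (1 : ℝ) := Finset.sum_le_sum fun k _ => hf k
    _ = n := by simp

lemma LSeries_eq_approxSeries (hf : ∀ n, ‖f n‖ ≤ 1)
    (hE : ∀ u : ℝ, 1 ≤ u → ‖remainder f κ u‖ ≤ M) {N : ℕ} (hN : 1 ≤ N)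
    {s : ℂ} (hs : 1 < s.re) : LSeries f s = approxSeries f κ N s := by
  have hN0 : (0 : ℝ) < N := by exact_mod_cast hN
  have hN1 : (1 : ℝ) ≤ N := by exact_mod_cast hN
  have hs0 : s ≠ 0 := by rintro rfl; simp at hs; linarith
  have hs1 : s - 1 ≠ 0 := by
    intro h; have := congrArg Complex.re h; simp at this; linarith
  set g : ℕ → ℂ := fun n => if n ≤ N then 0 else f n with hg
  set f₀ : ℕ → ℂ := fun n => if n ≤ N then f n else 0 with hf₀
  have hgb : ∀ n, ‖g n‖ ≤ 1 := by
    intro n; simp only [hg]; split_ifs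
    · simp
    · exact hf n
  have hf₀b : ∀ n, ‖f₀ n‖ ≤ 1 := by
    intro n; simp only [hf₀]; split_ifs
    · exact hf n
    · simp
  have hfg : f = f₀ + g := by
    funext n; simp only [hf₀, hg, Pi.add_apply]; split_ifs <;> simp
  have hgs : LSeriesSummable g s :=
    LSeriesSummable_of_sum_norm_bigO (isBigO_sum_norm hgb) zero_le_one hs
  have hf₀s : LSeriesSummable f₀ s :=
    LSeriesSummable_of_sum_norm_bigO (isBigO_sum_norm hf₀b) zero_le_one hs
  have h1 : LSeries f₀ s = ∑ n ∈ Icc 1 N, f n * (n : ℂ) ^ (-s) := by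
    rw [LSeries, tsum_eq_sum (s := Icc 1 N)]
    · refine Finset.sum_congr rfl fun n hn => ?_
      rw [Finset.mem_Icc] at hn
      rw [LSeries.term_of_ne_zero (by omega), hf₀]
      simp only [hn.2, if_true]
      rw [cpow_neg, div_eq_mul_inv]
    · intro n hn
      rw [Finset.mem_Icc, not_and_or] at hn
      rcases Nat.eq_zero_or_pos n with h | h
      · simp [h]
      · rw [LSeries.term_of_ne_zero (by omega), hf₀]
        have : ¬ n ≤ N := by omega
        simp [this]
  have hsum : ∀ u : ℝ, (N : ℝ) < u → ∑ k ∈ Icc 1 ⌊u⌋₊, g k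
      = (∑ k ∈ Icc 1 ⌊u⌋₊, f k) - ∑ k ∈ Icc 1 N, f k := by
    intro u hu
    have hNu : N ≤ ⌊u⌋₊ := Nat.le_floor hu.le
    rw [eq_sub_iff_add_eq]
    have : ∑ k ∈ Icc 1 N, f k = ∑ k ∈ Icc 1 ⌊u⌋₊, f₀ k := by
      rw [hf₀, ← Finset.sum_filter]
      refine Finset.sum_congr ?_ fun _ _ => rfl
      ext k; simp only [Finset.mem_Icc, Finset.mem_filter]; omega
    rw [this, ← Finset.sum_add_distrib]
    refine Finset.sum_congr rfl fun k _ => ?_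
    rw [hfg]; simp [add_comm]
  have h_int1 := integrableOn_tail hE hN (s := s) (by linarith)
  have h_int2 : IntegrableOn (fun u : ℝ => (u : ℂ) ^ (-s)) (Set.Ioi (N : ℝ)) :=
    integrableOn_Ioi_cpow_of_lt (by simpa using hs) hN0
  have h_int3 : IntegrableOn (fun u : ℝ => (u : ℂ) ^ (-(s + 1))) (Set.Ioi (N : ℝ)) :=
    integrableOn_Ioi_cpow_of_lt (by simp; linarith) hN0
  have h2 : LSeries g s = s * (κ * ∫ u in Set.Ioi (N : ℝ), (u : ℂ) ^ (-s)) + s * tail f κ N s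
      - s * ((∑ k ∈ Icc 1 N, f k) * ∫ u in Set.Ioi (N : ℝ), (u : ℂ) ^ (-(s + 1))) := by
    rw [LSeries_eq_mul_integral' g zero_le_one hs (isBigO_sum_norm hgb), ← mul_add, ← mul_sub]
    congr 1
    rw [tail, ← integral_const_mul, ← integral_const_mul,
      ← integral_add (h_int2.const_mul κ) h_int1,
      ← integral_sub (f := fun u : ℝ => κ * (u : ℂ) ^ (-s) + remainder f κ u * (u : ℂ) ^ (-(s + 1)))
        ((h_int2.const_mul κ).add h_int1) (h_int3.const_mul _)]
    rw [← integral_indicator measurableSet_Ioi, ← integral_indicator measurableSet_Ioi]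
    congr 1
    funext u
    by_cases hu : u ∈ Set.Ioi (N : ℝ)
    · have hu1 : u ∈ Set.Ioi (1 : ℝ) := lt_of_le_of_lt hN1 hu
      have hu0 : (u : ℂ) ≠ 0 := by
        have : (0 : ℝ) < u := hN0.trans hu
        exact_mod_cast this.ne'
      rw [Set.indicator_of_mem hu, Set.indicator_of_mem hu1, hsum u hu, remainder]
      have : (u : ℂ) ^ (-s) = u * (u : ℂ) ^ (-(s + 1)) := by
        rw [neg_add, ← sub_eq_add_neg, cpow_sub _ _ hu0, cpow_one]
        field_simp
      rw [this]; ring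
    · rw [Set.indicator_of_notMem hu]
      by_cases hu1 : u ∈ Set.Ioi (1 : ℝ)
      · rw [Set.indicator_of_mem hu1]
        have hu' : u ≤ N := by simpa using hu
        have : ∑ k ∈ Icc 1 ⌊u⌋₊, g k = 0 := by
          refine Finset.sum_eq_zero fun k hk => ?_
          have hk' : k ≤ N := (Finset.mem_Icc.mp hk).2.trans (Nat.floor_le_of_le hu')
          simp [hg, hk']
        rw [this, zero_mul]
      · rw [Set.indicator_of_notMem hu1]
  have hS : ∑ k ∈ Icc 1 N, f k = remainder f κ N + κ * N := by
    rw [remainder]; simp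
  have hNc : (N : ℂ) ≠ 0 := by exact_mod_cast hN0.ne'
  rw [hfg, LSeries_add hf₀s hgs, ← hfg, h1, h2, hS,
    integral_Ioi_cpow_of_lt (by simpa using hs) hN0,
    integral_Ioi_cpow_of_lt (by simp; linarith) hN0, approxSeries]
  have e1 : (-s + 1) = 1 - s := by ring
  have e2 : (-(s + 1) + 1) = -s := by ring
  have e3 : (N : ℂ) ^ (1 - s) = N * (N : ℂ) ^ (-s) := by
    rw [sub_eq_add_neg, cpow_add _ _ hNc, cpow_one]
  rw [e1, e2, Complex.ofReal_natCast, e3]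
  have hs1' : (1 : ℂ) - s ≠ 0 := by
    intro h; exact hs1 (by linear_combination -h)
  have e4 : κ * -(N * (N : ℂ) ^ (-s) / (1 - s)) = κ * (N * (N : ℂ) ^ (-s)) / (s - 1) := by
    rw [show (1 : ℂ) - s = -(s - 1) by ring]
    field_simp
  field_simp
  ring

lemma differentiableAt_approxSeries (hE : ∀ u : ℝ, 1 ≤ u → ‖remainder f κ u‖ ≤ M) {N : ℕ}
    (hN : 1 ≤ N) {s : ℂ} (hs : 0 < s.re) :
    DifferentiableAt ℂ (fun z => (z - 1) * ((∑ n ∈ Icc 1 N, f n * (n : ℂ) ^ (-z))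
      - remainder f κ N * (N : ℂ) ^ (-z) + z * tail f κ N z) + κ * (N : ℂ) ^ (1 - z)) s := by
  have ht := differentiableAt_tail hE hN hs
  have hNc : (N : ℂ) ≠ 0 := by exact_mod_cast (by omega : N ≠ 0)
  have hc : ∀ n ∈ Icc 1 N, DifferentiableAt ℂ (fun z => f n * (n : ℂ) ^ (-z)) s := by
    intro n hn
    have : (n : ℂ) ≠ 0 := by
      have := (Finset.mem_Icc.mp hn).1
      exact_mod_cast (by omega : n ≠ 0)
    exact (differentiableAt_id.neg.const_cpow (Or.inl this)).const_mul _
  have hsum : DifferentiableAt ℂ (fun z => ∑ n ∈ Icc 1 N, f n * (n : ℂ) ^ (-z)) s :=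
    DifferentiableAt.fun_sum hc
  have hcN : DifferentiableAt ℂ (fun z => (N : ℂ) ^ (-z)) s :=
    differentiableAt_id.neg.const_cpow (Or.inl hNc)
  have hcN' : DifferentiableAt ℂ (fun z => (N : ℂ) ^ (1 - z)) s :=
    (differentiableAt_id.const_sub 1).const_cpow (Or.inl hNc)
  exact ((differentiableAt_id.sub_const 1).mul ((hsum.sub (hcN.const_mul _)).add
    (differentiableAt_id.mul ht))).add (hcN'.const_mul κ)

end MontgomeryHooley

namespace MontgomeryHooley

open Complex MeasureTheory Filter Topology DirichletCharacter

variable {q : ℕ} [NeZero q]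

open Classical in
/-- The mean value of a Dirichlet character. -/
noncomputable def density (χ : DirichletCharacter ℂ q) : ℂ :=
  if χ = 1 then (Nat.totient q : ℂ) / q else 0

lemma density_of_ne_one {χ : DirichletCharacter ℂ q} (h : χ ≠ 1) : density χ = 0 := by
  simp [density, h]

lemma density_one : density (1 : DirichletCharacter ℂ q) = (Nat.totient q : ℂ) / q := by
  simp [density]

lemma norm_density_le (χ : DirichletCharacter ℂ q) : ‖density χ‖ ≤ 1 := by
  rw [density]
  split_ifs
  · have hq : (0 : ℝ) < q := by exact_mod_cast NeZero.pos q
    rw [norm_div, Complex.norm_natCast, Complex.norm_natCast, div_le_one hq]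
    exact_mod_cast Nat.totient_le q
  · simp

lemma sum_range_add_eq_sum_univ {E : Type*} [AddCommMonoid E] (g : ZMod q → E) (c : ℕ) :
    ∑ k ∈ range q, g ((k + c : ℕ) : ZMod q) = ∑ a : ZMod q, g a := by
  have h : ∑ k ∈ range q, g ((k + c : ℕ) : ZMod q) = ∑ a : ZMod q, g (a + c) := by
    refine Finset.sum_bij' (fun k _ => (k : ZMod q)) (fun a _ => a.val) ?_ ?_ ?_ ?_ ?_
    · simp
    · intro a _; simpa using ZMod.val_lt a
    · intro k hk; simpa using ZMod.val_cast_of_lt (by simpa using hk)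
    · intro a _; simp
    · intro k _; simp
  rw [h]
  exact Equiv.sum_comp (Equiv.addRight (c : ZMod q)) g

lemma sum_univ_eq_density (χ : DirichletCharacter ℂ q) :
    ∑ a : ZMod q, χ a = density χ * q := by
  have hq : (q : ℂ) ≠ 0 := by exact_mod_cast NeZero.ne q
  by_cases h : χ = 1
  · subst h
    rw [density_one, MulChar.sum_one_eq_card_units, ZMod.card_units_eq_totient]
    field_simp
  · rw [density_of_ne_one h, MulChar.sum_eq_zero_of_ne_one h, zero_mul]

lemma sum_range_eq (χ : DirichletCharacter ℂ q) (m r : ℕ) :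
    ∑ k ∈ range (q * m + r), χ ((k + 1 : ℕ) : ZMod q)
      = m * (density χ * q) + ∑ k ∈ range r, χ ((k + 1 : ℕ) : ZMod q) := by
  induction m with
  | zero => simp
  | succ m ih =>
    rw [show q * (m + 1) + r = (q * m + r) + q by ring, Finset.sum_range_add, ih,
      ← sum_univ_eq_density, ← sum_range_add_eq_sum_univ (fun a => χ a) (q * m + r + 1)]
    have : ∀ k, ((k + (q * m + r + 1) : ℕ) : ZMod q) = ((q * m + r + k + 1 : ℕ) : ZMod q) := by
      intro k; congr 1; ring
    simp_rw [this]
    push_cast; ring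

lemma norm_remainder_le (χ : DirichletCharacter ℂ q) (u : ℝ) (hu : 1 ≤ u) :
    ‖remainder (fun n => χ n) (density χ) u‖ ≤ 2 * q := by
  have hq : 0 < q := NeZero.pos q
  set n := ⌊u⌋₊ with hn
  have h1 : ∑ k ∈ Icc 1 n, χ (k : ZMod q) = ∑ k ∈ range n, χ ((k + 1 : ℕ) : ZMod q) := by
    rw [Finset.range_eq_Ico, Finset.sum_Ico_add' (fun k : ℕ => χ (k : ZMod q)) 0 n 1]
    rfl
  have h2 := sum_range_eq χ (n / q) (n % q)
  rw [Nat.div_add_mod] at h2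
  have hnu : (n : ℝ) ≤ u := Nat.floor_le (by linarith)
  have hnu' : u < n + 1 := Nat.lt_floor_add_one u
  have hdm : (q : ℝ) * (n / q : ℕ) + (n % q : ℕ) = n := by exact_mod_cast Nat.div_add_mod n q
  have hmod : ((n % q : ℕ) : ℝ) + 1 ≤ q := by exact_mod_cast Nat.mod_lt n hq
  have h3 : remainder (fun n => χ n) (density χ) u
      = (∑ k ∈ range (n % q), χ ((k + 1 : ℕ) : ZMod q))
        - density χ * ((u - q * (n / q : ℕ) : ℝ) : ℂ) := by
    rw [remainder, ← hn, h1, h2]; push_cast; ring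
  rw [h3]
  refine (norm_sub_le _ _).trans ?_
  have h4 : ‖∑ k ∈ range (n % q), χ ((k + 1 : ℕ) : ZMod q)‖ ≤ (n % q : ℕ) := by
    refine (norm_sum_le _ _).trans ?_
    refine (Finset.sum_le_sum fun k _ => χ.norm_le_one _).trans ?_
    simp
  have h5 : ‖density χ * ((u - q * (n / q : ℕ) : ℝ) : ℂ)‖ ≤ 1 * (u - q * (n / q : ℕ)) := by
    rw [norm_mul, Complex.norm_real, Real.norm_of_nonneg (by linarith [Nat.cast_nonneg (α := ℝ) (n % q)])]
    exact mul_le_mul_of_nonneg_right (norm_density_le χ)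
      (by linarith [Nat.cast_nonneg (α := ℝ) (n % q)])
  linarith

lemma eq_of_eq_of_one_lt_re {F G : ℂ → ℂ} (hF : ∀ s : ℂ, 0 < s.re → DifferentiableAt ℂ F s)
    (hG : ∀ s : ℂ, 0 < s.re → DifferentiableAt ℂ G s) (h : ∀ s : ℂ, 1 < s.re → F s = G s)
    {s : ℂ} (hs : 0 < s.re) : F s = G s := by
  have ho : IsOpen {s : ℂ | 0 < s.re} := isOpen_lt continuous_const continuous_re
  have hc : IsPreconnected {s : ℂ | 0 < s.re} := (convex_halfSpace_re_gt 0).isPreconnected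
  have hF' : AnalyticOnNhd ℂ F {s : ℂ | 0 < s.re} :=
    DifferentiableOn.analyticOnNhd (fun z hz => (hF z hz).differentiableWithinAt) ho
  have hG' : AnalyticOnNhd ℂ G {s : ℂ | 0 < s.re} :=
    DifferentiableOn.analyticOnNhd (fun z hz => (hG z hz).differentiableWithinAt) ho
  have h2 : F =ᶠ[𝓝 (2 : ℂ)] G := by
    have : {s : ℂ | 1 < s.re} ∈ 𝓝 (2 : ℂ) :=
      (isOpen_lt continuous_const continuous_re).mem_nhds (by simp)
    filter_upwards [this] with z hz using h z hz
  exact hF'.eqOn_of_preconnected_of_eventuallyEq hG' hc (by simp) h2 hs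

lemma LFunction_eq_approxSeries (χ : DirichletCharacter ℂ q) {N : ℕ} (hN : 1 ≤ N) {s : ℂ}
    (hs : 0 < s.re) (h : s ≠ 1 ∨ χ ≠ 1) :
    LFunction χ s = approxSeries (fun n => χ n) (density χ) N s := by
  have hE := norm_remainder_le χ
  have hb : ∀ n : ℕ, ‖χ n‖ ≤ 1 := fun n => χ.norm_le_one _
  have key : ∀ z : ℂ, 1 < z.re → LFunction χ z = approxSeries (fun n => χ n) (density χ) N z := by
    intro z hz
    rw [LFunction_eq_LSeries χ hz]
    exact LSeries_eq_approxSeries hb hE hN hz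
  have hne : ∀ z : ℂ, 1 < z.re → z - 1 ≠ 0 := by
    intro z hz h; have := congrArg Complex.re h; simp at this; linarith
  by_cases hχ : χ = 1
  · have hs1 : s ≠ 1 := by tauto
    have := eq_of_eq_of_one_lt_re (F := LFunctionTrivChar₁ q) (G := _)
      (fun z _ => differentiable_LFunctionTrivChar₁ q z)
      (fun z hz => differentiableAt_approxSeries hE hN hz) ?_ hs
    · rw [LFunctionTrivChar₁, Function.update_of_ne hs1, LFunctionTrivChar, ← hχ] at this
      have hs1' : s - 1 ≠ 0 := sub_ne_zero.mpr hs1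
      apply mul_left_cancel₀ hs1'
      rw [this, approxSeries]
      field_simp
      ring
    · intro z hz
      have hz1 := hne z hz
      rw [LFunctionTrivChar₁, Function.update_of_ne (sub_ne_zero.mp hz1), LFunctionTrivChar, ← hχ,
        key z hz, approxSeries]
      field_simp
      ring
  · have hd := density_of_ne_one hχ
    have hG : ∀ z : ℂ, 0 < z.re → DifferentiableAt ℂ
        (fun z => approxSeries (fun n => χ n) (density χ) N z) z := by
      intro z hz
      have hNc : (N : ℂ) ≠ 0 := by exact_mod_cast (by omega : N ≠ 0)
      have hsum : DifferentiableAt ℂ (fun z => ∑ n ∈ Icc 1 N, χ n * (n : ℂ) ^ (-z)) z := by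
        refine DifferentiableAt.fun_sum fun n hn => ?_
        have : (n : ℂ) ≠ 0 := by
          have := (Finset.mem_Icc.mp hn).1
          exact_mod_cast (by omega : n ≠ 0)
        exact (differentiableAt_id.neg.const_cpow (Or.inl this)).const_mul _
      have hcN : DifferentiableAt ℂ (fun z => (N : ℂ) ^ (-z)) z :=
        differentiableAt_id.neg.const_cpow (Or.inl hNc)
      have := (hsum.sub (hcN.const_mul (remainder (fun n => χ n) (density χ) N))).add
        (differentiableAt_id.mul (differentiableAt_tail hE hN hz))
      convert! this using 1
      funext w
      simp [approxSeries, hd]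
    exact eq_of_eq_of_one_lt_re (fun z _ => differentiable_LFunction hχ z) hG key hs

end MontgomeryHooley

namespace MontgomeryHooley

open Complex MeasureTheory Filter Topology DirichletCharacter

/-- The quantity `q (|Im s| + 2)` measuring the size of `L(s, χ)` for `χ` modulo `q`. -/
noncomputable def analyticSize (q : ℕ) (s : ℂ) : ℝ := q * (|s.im| + 2)

variable {q : ℕ}

lemma two_le_analyticSize (hq : 1 ≤ q) (s : ℂ) : 2 ≤ analyticSize q s := by
  have : (1 : ℝ) ≤ q := by exact_mod_cast hq
  rw [analyticSize]
  nlinarith [abs_nonneg s.im]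

lemma analyticSize_le_two_mul {s z : ℂ} (h : ‖z - s‖ ≤ 1) :
    analyticSize q z ≤ 2 * analyticSize q s := by
  have h1 : |z.im - s.im| ≤ 1 := by
    have := Complex.abs_im_le_norm (z - s); simp at this; linarith
  have h2 : |z.im| ≤ |s.im| + 1 := by
    have := abs_sub_abs_le_abs_sub z.im s.im; linarith
  rw [analyticSize, analyticSize, ← mul_assoc, mul_comm 2 (q : ℝ), mul_assoc]
  refine mul_le_mul_of_nonneg_left ?_ (Nat.cast_nonneg q)
  linarith [abs_nonneg s.im]

lemma analyticSize_rpow_le (hq : 1 ≤ q) {s z : ℂ} (h : ‖z - s‖ ≤ 1) {η : ℝ} (hη : 0 ≤ η)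
    (hη1 : η ≤ 1) : analyticSize q z ^ η ≤ 2 * analyticSize q s ^ η := by
  have h1 := two_le_analyticSize hq z
  have h2 := two_le_analyticSize hq s
  calc analyticSize q z ^ η ≤ (2 * analyticSize q s) ^ η :=
        Real.rpow_le_rpow (by linarith) (analyticSize_le_two_mul h) hη
    _ = 2 ^ η * analyticSize q s ^ η := Real.mul_rpow (by norm_num) (by linarith)
    _ ≤ 2 * analyticSize q s ^ η := by
        refine mul_le_mul_of_nonneg_right ?_ (by positivity)
        calc (2 : ℝ) ^ η ≤ 2 ^ (1 : ℝ) := Real.rpow_le_rpow_of_exponent_le (by norm_num) hη1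
          _ = 2 := Real.rpow_one 2

variable [NeZero q]

lemma sum_rpow_le {η : ℝ} (hη : 0 < η) {N : ℕ} {σ : ℝ} (hσ : 1 - η / 2 ≤ σ) :
    ∑ n ∈ Icc 1 N, (n : ℝ) ^ (-σ) ≤ (N : ℝ) ^ η * ∑' n : ℕ, (n : ℝ) ^ (-(1 + η / 2)) := by
  have hs : Summable fun n : ℕ => (n : ℝ) ^ (-(1 + η / 2)) :=
    Real.summable_nat_rpow.mpr (by linarith)
  calc ∑ n ∈ Icc 1 N, (n : ℝ) ^ (-σ)
      ≤ ∑ n ∈ Icc 1 N, (N : ℝ) ^ η * (n : ℝ) ^ (-(1 + η / 2)) := by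
        refine Finset.sum_le_sum fun n hn => ?_
        rw [Finset.mem_Icc] at hn
        have hn1 : (1 : ℝ) ≤ n := by exact_mod_cast hn.1
        have hnN : (n : ℝ) ≤ N := by exact_mod_cast hn.2
        calc (n : ℝ) ^ (-σ) ≤ (n : ℝ) ^ (η + -(1 + η / 2)) :=
              Real.rpow_le_rpow_of_exponent_le hn1 (by linarith)
          _ = (n : ℝ) ^ η * (n : ℝ) ^ (-(1 + η / 2)) := Real.rpow_add (by linarith) _ _
          _ ≤ _ := mul_le_mul_of_nonneg_right
              (Real.rpow_le_rpow (by linarith) hnN hη.le) (by positivity)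
    _ = (N : ℝ) ^ η * ∑ n ∈ Icc 1 N, (n : ℝ) ^ (-(1 + η / 2)) := by rw [Finset.mul_sum]
    _ ≤ _ := by
        refine mul_le_mul_of_nonneg_left ?_ (by positivity)
        exact hs.sum_le_tsum _ fun n _ => by positivity

theorem norm_LFunction_le {η : ℝ} (hη : 0 < η) (hη1 : η ≤ 1 / 2) :
    ∃ C : ℝ, 1 ≤ C ∧ ∀ (q : ℕ) [NeZero q] (χ : DirichletCharacter ℂ q) (s : ℂ),
      1 - η / 2 ≤ s.re → s.re ≤ 4 → (s ≠ 1 ∨ χ ≠ 1) →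
      ‖LFunction χ s‖ ≤ C * analyticSize q s ^ η * (1 + ‖density χ‖ / ‖s - 1‖) := by
  set Z : ℝ := ∑' n : ℕ, (n : ℝ) ^ (-(1 + η / 2)) with hZ
  have hZ0 : 0 ≤ Z := tsum_nonneg fun n => by positivity
  refine ⟨2 * (Z + 12), by linarith, ?_⟩
  intro q _ χ s hs1 hs4 h
  have hq : 1 ≤ q := NeZero.pos q
  have hq1 : (1 : ℝ) ≤ q := by exact_mod_cast hq
  set X := analyticSize q s with hX
  have hX2 : 2 ≤ X := two_le_analyticSize hq s
  set N := ⌈X⌉₊ with hNdef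
  have hXN : X ≤ N := Nat.le_ceil X
  have hNX : (N : ℝ) ≤ 2 * X := by
    have := Nat.ceil_lt_add_one (by linarith : 0 ≤ X); linarith
  have hN1 : (1 : ℝ) ≤ N := by linarith
  have hN : 1 ≤ N := by exact_mod_cast hN1
  have hN0 : (0 : ℝ) < N := by linarith
  have hre : 3 / 4 ≤ s.re := by linarith
  have hns : ∀ n : ℕ, 1 ≤ n → ‖(n : ℂ) ^ (-s)‖ = (n : ℝ) ^ (-s.re) := by
    intro n hn
    rw [Complex.norm_natCast_cpow_of_pos hn, neg_re]
  have hpow : (N : ℝ) ^ (-s.re) ≤ (N : ℝ) ^ η / N := by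
    rw [← Real.rpow_sub_one hN0.ne']
    exact Real.rpow_le_rpow_of_exponent_le hN1 (by linarith)
  have hpow0 : 0 ≤ (N : ℝ) ^ η := by positivity
  have hsn : ‖s‖ ≤ 2 * (|s.im| + 2) := by
    have := Complex.norm_le_abs_re_add_abs_im s
    rw [abs_of_nonneg (by linarith : 0 ≤ s.re)] at this
    linarith [abs_nonneg s.im]
  have b1 : ‖∑ n ∈ Icc 1 N, χ n * (n : ℂ) ^ (-s)‖ ≤ (N : ℝ) ^ η * Z := by
    refine le_trans ?_ (sum_rpow_le hη hs1)
    refine (norm_sum_le _ _).trans (Finset.sum_le_sum fun n hn => ?_)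
    rw [norm_mul, hns n (Finset.mem_Icc.mp hn).1]
    exact mul_le_of_le_one_left (by positivity) (χ.norm_le_one _)
  have b2 : ‖density χ * (N : ℂ) ^ (1 - s) / (s - 1)‖
      ≤ (N : ℝ) ^ η * (‖density χ‖ / ‖s - 1‖) := by
    rw [norm_div, norm_mul, Complex.norm_natCast_cpow_of_pos hN, sub_re, one_re]
    have : (N : ℝ) ^ (1 - s.re) ≤ (N : ℝ) ^ η :=
      Real.rpow_le_rpow_of_exponent_le hN1 (by linarith)
    rw [mul_comm (‖density χ‖), mul_div_assoc]
    exact mul_le_mul_of_nonneg_right this (by positivity)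
  have hqX : (q : ℝ) ≤ X := by
    rw [hX, analyticSize]; nlinarith [abs_nonneg s.im]
  have b3 : ‖remainder (fun n => χ n) (density χ) N * (N : ℂ) ^ (-s)‖ ≤ 2 * (N : ℝ) ^ η := by
    rw [norm_mul, hns N hN]
    calc _ ≤ (2 * q) * ((N : ℝ) ^ η / N) :=
          mul_le_mul (norm_remainder_le χ N hN1) hpow (by positivity) (by positivity)
      _ = 2 * (N : ℝ) ^ η * (q / N) := by ring
      _ ≤ 2 * (N : ℝ) ^ η * 1 := by
          refine mul_le_mul_of_nonneg_left ?_ (by positivity)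
          rw [div_le_one hN0]; linarith
      _ = _ := by ring
  have b4 : ‖s * tail (fun n => χ n) (density χ) N s‖ ≤ 8 * (N : ℝ) ^ η := by
    rw [norm_mul]
    have hre0 : 0 < s.re := by linarith
    calc ‖s‖ * ‖tail (fun n => χ n) (density χ) N s‖
        ≤ (2 * (|s.im| + 2)) * (2 * q * (N : ℝ) ^ (-s.re) / s.re) :=
          mul_le_mul hsn (norm_tail_le (norm_remainder_le χ) hN hre0) (norm_nonneg _)
            (by positivity)
      _ = 4 * X * (N : ℝ) ^ (-s.re) / s.re := by rw [hX, analyticSize]; ring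
      _ ≤ 4 * N * ((N : ℝ) ^ η / N) / (1 / 2) := by
          refine div_le_div₀ (by positivity) ?_ (by norm_num) (by linarith)
          exact mul_le_mul (by linarith) hpow (by positivity) (by positivity)
      _ = 8 * (N : ℝ) ^ η := by field_simp; norm_num
  have hNη : (N : ℝ) ^ η ≤ 2 * X ^ η := by
    calc (N : ℝ) ^ η ≤ (2 * X) ^ η := Real.rpow_le_rpow hN0.le hNX hη.le
      _ = 2 ^ η * X ^ η := Real.mul_rpow (by norm_num) (by linarith)
      _ ≤ 2 * X ^ η := by
        refine mul_le_mul_of_nonneg_right ?_ (by positivity)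
        calc (2 : ℝ) ^ η ≤ 2 ^ (1 : ℝ) :=
              Real.rpow_le_rpow_of_exponent_le (by norm_num) (by linarith)
          _ = 2 := Real.rpow_one 2
  rw [LFunction_eq_approxSeries χ hN (by linarith) h, approxSeries]
  set w := ‖density χ‖ / ‖s - 1‖ with hw
  have hw0 : 0 ≤ w := by positivity
  calc _ ≤ (N : ℝ) ^ η * Z + (N : ℝ) ^ η * w + 2 * (N : ℝ) ^ η + 8 * (N : ℝ) ^ η :=
        (norm_add_le _ _).trans (add_le_add ((norm_sub_le _ _).trans
          (add_le_add ((norm_add_le _ _).trans (add_le_add b1 b2)) b3)) b4)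
    _ ≤ (N : ℝ) ^ η * ((Z + 12) * (1 + w)) := by
        nlinarith [mul_nonneg hpow0 hw0, mul_nonneg (mul_nonneg hpow0 hZ0) hw0]
    _ ≤ (2 * X ^ η) * ((Z + 12) * (1 + w)) := by gcongr
    _ = _ := by ring

/-- Bounds for `L(s, χ)` and its derivative for nontrivial `χ`, just to the left of `Re s = 1`. -/
theorem norm_LFunction_le_of_ne_one {η : ℝ} (hη : 0 < η) (hη1 : η ≤ 1 / 2) :
    ∃ C : ℝ, 1 ≤ C ∧ ∀ (q : ℕ) [NeZero q] (χ : DirichletCharacter ℂ q) (s : ℂ),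
      1 - η / 4 ≤ s.re → s.re ≤ 3 → χ ≠ 1 →
      ‖LFunction χ s‖ ≤ C * analyticSize q s ^ η ∧
        ‖deriv (LFunction χ) s‖ ≤ C * analyticSize q s ^ η := by
  obtain ⟨C, hC, h⟩ := norm_LFunction_le hη hη1
  have hCη : C ≤ C * (2 / (η / 4)) := by
    refine le_mul_of_one_le_right (by linarith) ?_
    rw [le_div_iff₀ (by positivity)]; linarith
  refine ⟨C * (2 / (η / 4)), by linarith, ?_⟩
  intro q _ χ s hs1 hs3 hχ
  have hq : 1 ≤ q := NeZero.pos q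
  have hX2 := two_le_analyticSize hq s
  have hd : ‖density χ‖ = 0 := by rw [density_of_ne_one hχ, norm_zero]
  constructor
  · have := h q χ s (by linarith) (by linarith) (Or.inr hχ)
    rw [hd, zero_div, add_zero, mul_one] at this
    exact this.trans (mul_le_mul_of_nonneg_right hCη (by positivity))
  · have := Complex.norm_deriv_le_of_forall_mem_sphere_norm_le (c := s) (R := η / 4)
      (C := C * (2 * analyticSize q s ^ η)) (f := LFunction χ) (by positivity)
      ((differentiable_LFunction hχ).diffContOnCl) ?_
    · refine this.trans (le_of_eq ?_)
      ring
    · intro z hz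
      have hz' : ‖z - s‖ = η / 4 := by simpa [dist_eq_norm] using hz
      have hzre : |z.re - s.re| ≤ η / 4 := by
        have := Complex.abs_re_le_norm (z - s); rw [hz'] at this; simpa using this
      rw [abs_le] at hzre
      have := h q χ z (by linarith) (by linarith) (Or.inr hχ)
      rw [hd, zero_div, add_zero, mul_one] at this
      refine this.trans (mul_le_mul_of_nonneg_left ?_ (by linarith))
      exact analyticSize_rpow_le hq (by rw [hz']; linarith) hη.le (by linarith)

end MontgomeryHooley

namespace MontgomeryHooley

open Complex MeasureTheory Filter Topology DirichletCharacter
open scoped ComplexOrder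

lemma iteratedDeriv_inv_sub_one_two (m : ℕ) :
    iteratedDeriv m (fun s : ℂ => (s - 1)⁻¹) 2 = (-1) ^ m * m.factorial := by
  have h := congrFun (iteratedDeriv_comp_sub_const m (fun s : ℂ => s⁻¹) 1) 2
  have h2 := iter_deriv_inv m ((2 : ℂ) - 1)
  rw [h, iteratedDeriv_eq_iterate]
  rw [show (fun s : ℂ => s⁻¹) = Inv.inv from rfl, h2]
  norm_num

lemma geom_lower_bound {b : ℕ → ℝ} {lam δ K L : ℝ} (hδ : 0 < δ) (hδ1 : δ ≤ 1 / 8)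
    (hb : ∀ m, 0 ≤ b m) (hK : ∀ m, |b m - lam| ≤ K * (2 / 3) ^ m)
    (hL : HasSum (fun m => (b m - lam) * (1 + δ) ^ m) L) (hle : L ≤ lam / δ) (N : ℕ)
    (hN : 1 ≤ N) :
    b 0 ≤ lam * (1 + δ) ^ N / δ + 4 * K * (3 / 4) ^ N := by
  have hK0 : 0 ≤ K := by have := (abs_nonneg _).trans (hK 0); simpa using this
  have hsplit := hL.summable.sum_add_tsum_nat_add N
  rw [hL.tsum_eq] at hsplit
  have hs : Summable fun m => (b m - lam) * (1 + δ) ^ m := hL.summable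
  have hgeo : HasSum (fun m : ℕ => K * (3 / 4) ^ N * (3 / 4 : ℝ) ^ m) (K * (3 / 4) ^ N * 4) := by
    have := (hasSum_geometric_of_lt_one (r := (3 / 4 : ℝ)) (by norm_num) (by norm_num)).mul_left
      (K * (3 / 4) ^ N)
    norm_num at this ⊢
    exact this
  have htail : -(K * (3 / 4) ^ N * 4) ≤ ∑' m, (b (m + N) - lam) * (1 + δ) ^ (m + N) := by
    rw [← hgeo.tsum_eq, ← tsum_neg]
    refine hgeo.summable.neg.tsum_le_tsum (fun m => ?_) ((summable_nat_add_iff N).mpr hs)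
    have h1 : -(K * (2 / 3) ^ (m + N)) ≤ b (m + N) - lam := (abs_le.mp (hK (m + N))).1
    have h2 : (1 + δ) ^ (m + N) ≤ (9 / 8 : ℝ) ^ (m + N) :=
      pow_le_pow_left₀ (by linarith) (by linarith) _
    have h3 : (2 / 3 : ℝ) ^ (m + N) * (9 / 8) ^ (m + N) = (3 / 4) ^ N * (3 / 4) ^ m := by
      rw [← mul_pow, ← pow_add, add_comm]; norm_num
    have h4 : 0 < (1 + δ) ^ (m + N) := by positivity
    calc -(K * (3 / 4) ^ N * (3 / 4) ^ m) = -(K * (2 / 3) ^ (m + N)) * (9 / 8) ^ (m + N) := by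
          rw [mul_assoc, ← h3]; ring
      _ ≤ -(K * (2 / 3) ^ (m + N)) * (1 + δ) ^ (m + N) := by
          refine mul_le_mul_of_nonpos_left h2 ?_
          simp only [Left.neg_nonpos_iff]; positivity
      _ ≤ _ := mul_le_mul_of_nonneg_right h1 h4.le
  have hhead : b 0 - lam * (((1 + δ) ^ N - 1) / δ) ≤
      ∑ m ∈ range N, (b m - lam) * (1 + δ) ^ m := by
    simp_rw [sub_mul, Finset.sum_sub_distrib, ← Finset.mul_sum]
    rw [geom_sum_eq (by linarith)]
    have : b 0 * (1 + δ) ^ 0 ≤ ∑ m ∈ range N, b m * (1 + δ) ^ m :=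
      Finset.single_le_sum (f := fun m => b m * (1 + δ) ^ m)
        (fun m _ => mul_nonneg (hb m) (by positivity)) (Finset.mem_range.mpr hN)
    simp only [add_sub_cancel_left] at this ⊢
    linarith
  have : lam * (1 + δ) ^ N / δ = lam * (((1 + δ) ^ N - 1) / δ) + lam / δ := by ring
  linarith

/-- Estermann's lemma: a lower bound for the residue at `1` of a function with completely
monotone behaviour near `2`. -/
lemma residue_lower_bound {H : ℂ → ℂ} (hH : Differentiable ℂ H) {lam δ K : ℝ}
    (hlam : H 1 = lam) (hδ : 0 < δ) (hδ1 : δ ≤ 1 / 8)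
    (hder : ∀ m, 0 ≤ (-1) ^ m * iteratedDeriv m (fun s => H s / (s - 1)) 2)
    (hK : ∀ z, ‖z - 2‖ = 3 / 2 → ‖dslope H 1 z‖ ≤ K) (hneg : 0 ≤ (H (1 - δ)).re)
    (N : ℕ) (hN : 1 ≤ N) :
    (H 2).re ≤ lam * (1 + δ) ^ N / δ + 4 * K * (3 / 4) ^ N := by
  set R := dslope H 1 with hR
  have hRd : Differentiable ℂ R := by
    rw [← differentiableOn_univ]
    exact (Complex.differentiableOn_dslope Filter.univ_mem).mpr hH.differentiableOn
  have hRne : ∀ z, z ≠ 1 → R z = H z / (z - 1) - lam / (z - 1) := by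
    intro z hz
    rw [hR, dslope_of_ne _ hz, slope_def_field, hlam, sub_div]
  set c : ℕ → ℂ := fun m => iteratedDeriv m R 2 with hc
  set b : ℕ → ℝ := fun m =>
    ((-1) ^ m * iteratedDeriv m (fun s => H s / (s - 1)) 2).re / m.factorial with hbdef
  have hb : ∀ m, 0 ≤ b m := fun m => div_nonneg (Complex.le_def.mp (hder m)).1 (by positivity)
  have hcb : ∀ m : ℕ, (m.factorial : ℂ)⁻¹ * c m = (-1) ^ m * ((b m - lam : ℝ) : ℂ) := by
    intro m
    have hfac : (m.factorial : ℂ) ≠ 0 := by exact_mod_cast m.factorial_ne_zero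
    have hev : (fun s => H s / (s - 1)) =ᶠ[𝓝 2] (R + fun s => (lam : ℂ) * (s - 1)⁻¹) := by
      filter_upwards [isOpen_ne.mem_nhds (by norm_num : (2 : ℂ) ≠ 1)] with z hz
      rw [Pi.add_apply, hRne z hz]; ring
    have hinv : ContDiffAt ℂ m (fun s : ℂ => (lam : ℂ) * (s - 1)⁻¹) 2 :=
      contDiffAt_const.mul ((contDiffAt_id.sub contDiffAt_const).inv (by norm_num))
    have h1 := hev.iteratedDeriv_eq m
    rw [iteratedDeriv_add (hRd.contDiff.contDiffAt) hinv, iteratedDeriv_const_mul_field,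
      iteratedDeriv_inv_sub_one_two] at h1
    have hreal : (((-1) ^ m * iteratedDeriv m (fun s => H s / (s - 1)) 2).re : ℂ)
        = (-1) ^ m * iteratedDeriv m (fun s => H s / (s - 1)) 2 := by
      have := (Complex.le_def.mp (hder m)).2
      apply Complex.ext <;> simp [← this]
    have hb' : ((b m : ℝ) : ℂ) = (-1) ^ m * iteratedDeriv m (fun s => H s / (s - 1)) 2
        / m.factorial := by
      rw [← hreal, hbdef]; push_cast; rfl
    have hsq : ((-1 : ℂ) ^ m) * (-1) ^ m = 1 := by rw [← mul_pow]; norm_num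
    push_cast
    rw [hb', h1]
    field_simp
    linear_combination (-c m - (lam : ℂ) * (-1) ^ m * m.factorial) * hsq
  have hRbound : ∀ m, |b m - lam| ≤ K * (2 / 3) ^ m := by
    intro m
    have h := Complex.norm_iteratedDeriv_le_of_forall_mem_sphere_norm_le (c := 2) (R := 3 / 2)
      (C := K) m (by norm_num) hRd.diffContOnCl
      (fun z hz => hK z (by simpa [dist_eq_norm] using hz))
    have h2 : ‖(m.factorial : ℂ)⁻¹ * c m‖ = |b m - lam| := by
      rw [hcb, norm_mul, norm_pow, norm_neg, norm_one, one_pow, one_mul, Complex.norm_real,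
        Real.norm_eq_abs]
    rw [← h2, norm_mul, norm_inv, Complex.norm_natCast]
    have hf : (0 : ℝ) < m.factorial := by positivity
    calc (m.factorial : ℝ)⁻¹ * ‖c m‖ ≤ (m.factorial : ℝ)⁻¹ * (m.factorial * K / (3 / 2) ^ m) := by
          gcongr
      _ = K * (2 / 3) ^ m := by
          rw [show (2 / 3 : ℝ) = (3 / 2)⁻¹ by norm_num, inv_pow]; field_simp
  have hts := Complex.hasSum_taylorSeries_on_ball (c := 2) (r := 3 / 2) (f := R)
    (z := ((1 - δ : ℝ) : ℂ)) hRd.differentiableOn (by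
      rw [Metric.mem_ball, dist_eq_norm]
      rw [show ((1 - δ : ℝ) : ℂ) - 2 = ((-1 - δ : ℝ) : ℂ) by push_cast; ring, Complex.norm_real,
        Real.norm_eq_abs, abs_lt]
      constructor <;> linarith)
  have hL : HasSum (fun m => (b m - lam) * (1 + δ) ^ m) (R ((1 - δ : ℝ) : ℂ)).re := by
    have := Complex.hasSum_re hts
    convert this using 2 with m
    have : (m.factorial : ℂ)⁻¹ • (((1 - δ : ℝ) : ℂ) - 2) ^ m • iteratedDeriv m R 2
        = (((b m - lam) * (1 + δ) ^ m : ℝ) : ℂ) := by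
      simp only [smul_eq_mul]
      have h1 := hcb m
      rw [hc] at h1
      have h3 : (((1 - δ : ℝ) : ℂ) - 2) ^ m = (-1) ^ m * (1 + δ) ^ m := by
        rw [← mul_pow]; congr 1; push_cast; ring
      have hsq : ((-1 : ℂ) ^ m) * (-1) ^ m = 1 := by rw [← mul_pow]; norm_num
      rw [h3]
      push_cast at h1 ⊢
      linear_combination ((-1) ^ m * (1 + δ : ℂ) ^ m) * h1 +
        ((b m : ℂ) - lam) * (1 + δ : ℂ) ^ m * hsq
    rw [this, Complex.ofReal_re]
  have hle : (R ((1 - δ : ℝ) : ℂ)).re ≤ lam / δ := by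
    rw [hRne _ (by
      intro h; rw [← Complex.ofReal_one, Complex.ofReal_inj] at h; linarith)]
    have : H ((1 - δ : ℝ) : ℂ) / (((1 - δ : ℝ) : ℂ) - 1) - lam / (((1 - δ : ℝ) : ℂ) - 1)
        = ((lam / δ : ℝ) : ℂ) - ((δ⁻¹ : ℝ) : ℂ) * H (1 - δ) := by
      have : (δ : ℂ) ≠ 0 := by exact_mod_cast hδ.ne'
      push_cast
      rw [show (1 - (δ : ℂ) - 1) = -δ by ring]
      field_simp
      ring
    rw [this, sub_re, Complex.ofReal_re, Complex.re_ofReal_mul]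
    have := mul_nonneg (inv_nonneg.mpr hδ.le) hneg
    linarith
  have hfin := geom_lower_bound hδ hδ1 hb hRbound hL hle N hN
  have hb0 : b 0 = (H 2).re := by
    rw [hbdef]; simp only [pow_zero, iteratedDeriv_zero, Nat.factorial_zero, one_mul]
    norm_num
  rw [← hb0]
  exact hfin

end MontgomeryHooley

namespace MontgomeryHooley

open Complex MeasureTheory Filter Topology DirichletCharacter
open scoped ComplexOrder

/-- The coefficients of `-F'/F` for `F = ∏ χ ∈ s, L(·, χ)`. -/
noncomputable def logDerivCoeff {q : ℕ} (s : Finset (DirichletCharacter ℂ q)) (n : ℕ) : ℂ :=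
  ∑ χ ∈ s, ((fun n : ℕ => χ n) * fun n => (ArithmeticFunction.vonMangoldt n : ℂ)) n

variable {q : ℕ}

lemma LSeriesSummable_logDerivCoeff (s : Finset (DirichletCharacter ℂ q)) {z : ℂ}
    (hz : 1 < z.re) : LSeriesSummable (logDerivCoeff s) z := by
  have : logDerivCoeff s = ∑ χ ∈ s, ((fun n : ℕ => χ n) *
      fun n => (ArithmeticFunction.vonMangoldt n : ℂ)) := by
    ext n; simp [logDerivCoeff]
  rw [this]
  exact LSeriesSummable.sum fun χ _ => DirichletCharacter.LSeriesSummable_twist_vonMangoldt χ hz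

lemma abscissaOfAbsConv_logDerivCoeff_le (s : Finset (DirichletCharacter ℂ q)) :
    LSeries.abscissaOfAbsConv (logDerivCoeff s) ≤ 1 :=
  LSeries.abscissaOfAbsConv_le_of_forall_lt_LSeriesSummable fun y hy =>
    LSeriesSummable_logDerivCoeff s (by simpa using hy)

variable [NeZero q]

lemma differentiableAt_LFunction_of_one_lt (χ : DirichletCharacter ℂ q) {z : ℂ} (hz : 1 < z.re) :
    DifferentiableAt ℂ (LFunction χ) z :=
  differentiableAt_LFunction χ z (Or.inl (by rintro rfl; simp at hz))

lemma LFunction_ne_zero_of_one_lt (χ : DirichletCharacter ℂ q) {z : ℂ} (hz : 1 < z.re) :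
    LFunction χ z ≠ 0 :=
  LFunction_ne_zero_of_one_le_re χ (Or.inr (by rintro rfl; simp at hz)) hz.le

lemma logDeriv_LFunction_eq (χ : DirichletCharacter ℂ q) {z : ℂ} (hz : 1 < z.re) :
    logDeriv (LFunction χ) z = - LSeries ((fun n : ℕ => χ n) *
      fun n => (ArithmeticFunction.vonMangoldt n : ℂ)) z := by
  rw [DirichletCharacter.LSeries_twist_vonMangoldt_eq χ hz, logDeriv_apply,
    deriv_LFunction_eq_deriv_LSeries χ hz, LFunction_eq_LSeries χ hz]
  ring

lemma deriv_prod_LFunction (s : Finset (DirichletCharacter ℂ q)) {z : ℂ} (hz : 1 < z.re) :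
    deriv (fun z => ∏ χ ∈ s, LFunction χ z) z =
      -(LSeries (logDerivCoeff s) z * ∏ χ ∈ s, LFunction χ z) := by
  have h := logDeriv_prod (s := s) (f := fun χ => LFunction χ) (x := z)
    (fun χ _ => LFunction_ne_zero_of_one_lt χ hz)
    (fun χ _ => differentiableAt_LFunction_of_one_lt χ hz)
  have hne : ∏ χ ∈ s, LFunction χ z ≠ 0 :=
    Finset.prod_ne_zero_iff.mpr fun χ _ => LFunction_ne_zero_of_one_lt χ hz
  have h2 : LSeries (logDerivCoeff s) z = -∑ χ ∈ s, logDeriv (LFunction χ) z := by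
    have : logDerivCoeff s = ∑ χ ∈ s, ((fun n : ℕ => χ n) *
        fun n => (ArithmeticFunction.vonMangoldt n : ℂ)) := by
      ext n; simp [logDerivCoeff]
    rw [this, LSeries_sum fun χ _ => DirichletCharacter.LSeriesSummable_twist_vonMangoldt χ hz,
      ← Finset.sum_neg_distrib]
    refine Finset.sum_congr rfl fun χ _ => ?_
    rw [logDeriv_LFunction_eq χ hz, neg_neg]
  rw [h2, ← h, logDeriv_apply]
  field_simp

lemma contDiffAt_prod_LFunction (s : Finset (DirichletCharacter ℂ q)) {z : ℂ} (hz : 1 < z.re)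
    (m : ℕ) : ContDiffAt ℂ m (fun z => ∏ χ ∈ s, LFunction χ z) z := by
  have ho : IsOpen {z : ℂ | 1 < z.re} := isOpen_lt continuous_const continuous_re
  have : DifferentiableOn ℂ (fun z => ∏ χ ∈ s, LFunction χ z) {z : ℂ | 1 < z.re} := by
    refine DifferentiableOn.fun_finsetProd fun χ _ z hz => ?_
    exact (differentiableAt_LFunction_of_one_lt χ hz).differentiableWithinAt
  exact (this.contDiffOn ho).contDiffAt (ho.mem_nhds hz)

lemma iteratedDeriv_prod_LFunction_alternating (s : Finset (DirichletCharacter ℂ q))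
    (hs : ∀ a : ZMod q, 0 ≤ ∑ χ ∈ s, χ a) (h2 : 0 ≤ ∏ χ ∈ s, LFunction χ 2) (m : ℕ) :
    0 ≤ (-1) ^ m * iteratedDeriv m (fun z => ∏ χ ∈ s, LFunction χ z) 2 := by
  have h2re : (1 : ℝ) < (2 : ℂ).re := by norm_num
  have ho : IsOpen {z : ℂ | 1 < z.re} := isOpen_lt continuous_const continuous_re
  have hP : ∀ i, 0 ≤ (-1) ^ i * iteratedDeriv i (LSeries (logDerivCoeff s)) 2 := by
    intro i
    have := LSeries.iteratedDeriv_alternating (a := logDerivCoeff s) (x := 2) (fun n => ?_)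
      ((abscissaOfAbsConv_logDerivCoeff_le s).trans_lt (by norm_cast)) i
    · simpa using this
    · simp only [logDerivCoeff, Pi.mul_apply, Pi.zero_apply, ← Finset.sum_mul]
      refine mul_nonneg (hs _) ?_
      exact_mod_cast ArithmeticFunction.vonMangoldt_nonneg
  have hPc : ∀ m : ℕ, ContDiffAt ℂ m (LSeries (logDerivCoeff s)) 2 := by
    intro m
    have : DifferentiableOn ℂ (LSeries (logDerivCoeff s)) {z : ℂ | 1 < z.re} :=
      (LSeries_differentiableOn _).mono fun z hz =>
        (abscissaOfAbsConv_logDerivCoeff_le s).trans_lt (by exact_mod_cast hz)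
    exact (this.contDiffOn ho).contDiffAt (ho.mem_nhds h2re)
  induction m using Nat.strong_induction_on with
  | _ m ih =>
    rcases m with _ | m
    · simpa using h2
    · have hev : deriv (fun z => ∏ χ ∈ s, LFunction χ z) =ᶠ[𝓝 2]
          fun z => (-1) * (LSeries (logDerivCoeff s) z * ∏ χ ∈ s, LFunction χ z) := by
        filter_upwards [ho.mem_nhds h2re] with z hz
        rw [deriv_prod_LFunction s hz]; ring
      rw [iteratedDeriv_succ', hev.iteratedDeriv_eq, iteratedDeriv_const_mul_field,
        iteratedDeriv_fun_mul (hPc m) (contDiffAt_prod_LFunction s h2re m), ← mul_assoc, pow_succ,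
        mul_assoc ((-1 : ℂ) ^ m), neg_mul_neg, one_mul, mul_one, Finset.mul_sum]
      refine Finset.sum_nonneg fun i hi => ?_
      have him : i ≤ m := Nat.lt_succ_iff.mp (Finset.mem_range.mp hi)
      have h := mul_nonneg (mul_nonneg (Nat.cast_nonneg (α := ℂ) (m.choose i)) (hP i))
        (ih (m - i) (by omega))
      have hpow : (-1 : ℂ) ^ m = (-1) ^ i * (-1) ^ (m - i) := by
        rw [← pow_add]; congr 1; omega
      rw [hpow]
      convert h using 1
      ring

end MontgomeryHooley

namespace MontgomeryHooley

open Complex MeasureTheory Filter Topology DirichletCharacter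
open scoped ComplexOrder ComplexConjugate

variable {q : ℕ}

lemma eq_zero_or_one_or_neg_one {χ : DirichletCharacter ℂ q} (h : χ ^ 2 = 1) (a : ZMod q) :
    χ a = 0 ∨ χ a = 1 ∨ χ a = -1 := by
  by_cases ha : IsUnit a
  · right
    have : (χ ^ 2) a = 1 := by rw [h, MulChar.one_apply ha]
    rw [MulChar.pow_apply' _ (by norm_num)] at this
    exact sq_eq_sq_iff_eq_or_eq_neg.mp (by rw [this, one_pow])
  · left; exact χ.map_nonunit ha

lemma conj_apply_of_sq_eq_one {χ : DirichletCharacter ℂ q} (h : χ ^ 2 = 1) (a : ZMod q) :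
    conj (χ a) = χ a := by
  rcases eq_zero_or_one_or_neg_one h a with h | h | h <;> simp [h]

variable [NeZero q]

lemma conj_LFunction {χ : DirichletCharacter ℂ q} (h : χ ^ 2 = 1) {s : ℂ} (hs : 1 < s.re) :
    LFunction χ (conj s) = conj (LFunction χ s) := by
  rw [LFunction_eq_LSeries χ hs, LFunction_eq_LSeries χ (by simpa using hs), LSeries, LSeries,
    Complex.conj_tsum]
  refine tsum_congr fun n => ?_
  rcases eq_or_ne n 0 with rfl | hn
  · simp
  · rw [LSeries.term_of_ne_zero hn, LSeries.term_of_ne_zero hn, map_div₀,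
      conj_apply_of_sq_eq_one h, Complex.cpow_conj, Complex.conj_natCast]
    simp [Complex.natCast_arg, Real.pi_ne_zero.symm]

lemma im_eq_zero_of_conj {G : ℂ → ℂ} (hG : Differentiable ℂ G)
    (h : ∀ s : ℂ, 1 < s.re → G (conj s) = conj (G s)) {σ : ℝ} (hσ : 0 < σ) : (G σ).im = 0 := by
  have := eq_of_eq_of_one_lt_re (F := G) (G := conj ∘ G ∘ conj) (fun s _ => hG s)
    (fun s _ => by
      have := (hG (conj s)).conj_conj
      rwa [Complex.conj_conj] at this)
    (fun s hs => by simp [h s hs]) (s := σ) (by simpa using hσ)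
  simp only [Function.comp_apply, Complex.conj_ofReal] at this
  exact Complex.conj_eq_iff_im.mp this.symm

/-- The entire function `(z - 1) ζ_q(z) ∏ χ ∈ s, L(z, χ)`. -/
noncomputable def zetaProd (s : Finset (DirichletCharacter ℂ q)) (z : ℂ) : ℂ :=
  LFunctionTrivChar₁ q z * ∏ χ ∈ s, LFunction χ z

lemma differentiable_zetaProd {s : Finset (DirichletCharacter ℂ q)} (hs : ∀ χ ∈ s, χ ≠ 1) :
    Differentiable ℂ (zetaProd s) :=
  (differentiable_LFunctionTrivChar₁ q).mul
    (Differentiable.fun_finsetProd fun χ hχ => differentiable_LFunction (hs χ hχ))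

lemma zetaProd_of_ne_one {s : Finset (DirichletCharacter ℂ q)} [DecidableEq (DirichletCharacter ℂ q)]
    (hs : ∀ χ ∈ s, χ ≠ 1) {z : ℂ}
    (hz : z ≠ 1) : zetaProd s z = (z - 1) * ∏ χ ∈ insert 1 s, LFunction χ z := by
  rw [Finset.prod_insert (fun h => hs 1 h rfl), zetaProd, LFunctionTrivChar₁,
    Function.update_of_ne hz, mul_assoc]

lemma zetaProd_im {s : Finset (DirichletCharacter ℂ q)} (hs : ∀ χ ∈ s, χ ≠ 1)
    (hr : ∀ χ ∈ s, χ ^ 2 = 1) {σ : ℝ} (hσ : 0 < σ) : (zetaProd s σ).im = 0 := by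
  classical
  refine im_eq_zero_of_conj (differentiable_zetaProd hs) (fun z hz => ?_) hσ
  have h1 : z ≠ 1 := by rintro rfl; simp at hz
  have h2 : conj z ≠ 1 := by
    intro h; rw [← Complex.conj_conj z, h] at h1; simp at h1
  rw [zetaProd_of_ne_one hs h1, zetaProd_of_ne_one hs h2, map_mul, map_prod, map_sub, map_one]
  congr 1
  refine Finset.prod_congr rfl fun χ hχ => conj_LFunction ?_ hz
  rcases Finset.mem_insert.mp hχ with rfl | hχ
  · exact one_pow 2
  · exact hr χ hχ

lemma norm_LFunction_two_sub_one_le (χ : DirichletCharacter ℂ q) :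
    ‖LFunction χ 2 - 1‖ ≤ 13 / 20 := by
  have h2 : (1 : ℝ) < (2 : ℂ).re := by norm_num
  rw [LFunction_eq_LSeries χ h2]
  have hs := DirichletCharacter.LSeriesSummable_of_one_lt_re χ h2
  have hz := hasSum_zeta_two
  have hz2 : HasSum (fun n : ℕ => 1 / ((n + 2 : ℕ) : ℝ) ^ 2) (Real.pi ^ 2 / 6 - 1) := by
    have := (hasSum_nat_add_iff' 2).mpr hz
    simpa [Finset.sum_range_succ] using this
  have hL : LSeries (fun n => χ n) 2 - 1 = ∑' n, LSeries.term (fun n => χ n) 2 (n + 2) := by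
    rw [LSeries, ← hs.sum_add_tsum_nat_add 2]
    simp [Finset.sum_range_succ, LSeries.term]
  rw [hL]
  refine (tsum_of_norm_bounded hz2 fun n => ?_).trans ?_
  · rw [LSeries.term_of_ne_zero (by omega), norm_div]
    rw [show ((n + 2 : ℕ) : ℂ) ^ (2 : ℂ) = ((n + 2 : ℕ) : ℂ) ^ 2 from by
      rw [← Complex.cpow_natCast, Nat.cast_ofNat]]
    rw [norm_pow, Complex.norm_natCast]
    gcongr
    exact χ.norm_le_one _
  · have := Real.pi_lt_d4; have := Real.pi_pos
    nlinarith

lemma LFunction_two_ge {χ : DirichletCharacter ℂ q} (h : χ ^ 2 = 1) :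
    (7 / 20 : ℂ) ≤ LFunction χ 2 := by
  have h1 := conj_LFunction h (s := 2) (by norm_num)
  rw [map_ofNat] at h1
  have him := Complex.conj_eq_iff_im.mp h1.symm
  have hre := (Complex.abs_re_le_norm _).trans (norm_LFunction_two_sub_one_le χ)
  rw [abs_le] at hre
  rw [Complex.le_def]
  norm_num at hre ⊢
  exact ⟨by linarith, him.symm⟩

lemma norm_sub_one_mul_LFunction_le (χ : DirichletCharacter ℂ q) {z : ℂ} (hz : z ≠ 1 ∨ χ ≠ 1)
    (hre : 1 / 2 ≤ z.re) (hn : ‖z‖ ≤ 7 / 2) :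
    ‖LFunction χ z‖ ≤ 17 * q + ‖density χ‖ / ‖z - 1‖ := by
  have hq : (1 : ℝ) ≤ q := by exact_mod_cast NeZero.pos q
  rw [LFunction_eq_approxSeries χ le_rfl (by linarith) hz, approxSeries]
  have h1 : ‖tail (fun n => χ n) (density χ) 1 z‖ ≤ 4 * q := by
    refine (norm_tail_le (norm_remainder_le χ) le_rfl (by linarith)).trans ?_
    rw [Nat.cast_one, Real.one_rpow, div_le_iff₀ (by linarith)]
    nlinarith
  have h2 : ‖z * tail (fun n => χ n) (density χ) 1 z‖ ≤ 14 * q := by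
    rw [norm_mul]
    calc _ ≤ 7 / 2 * (4 * q : ℝ) := mul_le_mul hn h1 (norm_nonneg _) (by norm_num)
      _ = _ := by ring
  have h3 : ‖remainder (fun n => χ n) (density χ) ((1 : ℕ) : ℝ) * ((1 : ℕ) : ℂ) ^ (-z)‖ ≤ 2 * q := by
    rw [Nat.cast_one (R := ℂ), Complex.one_cpow, mul_one]
    exact norm_remainder_le χ _ (by norm_num)
  have h4 : ∑ n ∈ Icc (1 : ℕ) 1, χ n * (n : ℂ) ^ (-z) = 1 := by simp
  have h5 : ‖density χ * ((1 : ℕ) : ℂ) ^ (1 - z) / (z - 1)‖ = ‖density χ‖ / ‖z - 1‖ := by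
    simp
  have := (norm_add_le (1 + density χ * ((1 : ℕ) : ℂ) ^ (1 - z) / (z - 1) -
    remainder (fun n => χ n) (density χ) ((1 : ℕ) : ℝ) * ((1 : ℕ) : ℂ) ^ (-z))
    (z * tail (fun n => χ n) (density χ) 1 z)).trans (add_le_add ((norm_sub_le _ _).trans
      (add_le_add ((norm_add_le _ _).trans le_rfl) h3)) h2)
  rw [h5, norm_one] at this
  rw [h4]
  refine this.trans ?_
  linarith

end MontgomeryHooley

namespace MontgomeryHooley

open Complex MeasureTheory Filter Topology DirichletCharacter
open scoped ComplexOrder ComplexConjugate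

lemma ge_of_forall_le_pow {lam δ K b : ℝ} (hδ : 0 < δ) (hδ1 : δ ≤ 1) (hK : 1 ≤ K)
    (hb : 1 / 100 ≤ b)
    (h : ∀ N : ℕ, 1 ≤ N → b ≤ lam * (1 + δ) ^ N / δ + 4 * K * (3 / 4) ^ N) :
    δ / 200 * Real.exp (-1) * (800 * K) ^ (-(4 * δ)) ≤ lam := by
  have hK0 : 0 < 800 * K := by linarith
  have hlog : 0 < Real.log (800 * K) := Real.log_pos (by linarith)
  set N := ⌈4 * Real.log (800 * K)⌉₊ with hN
  have hN0 : 4 * Real.log (800 * K) ≤ N := Nat.le_ceil _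
  have hN2 : (N : ℝ) ≤ 4 * Real.log (800 * K) + 1 := (Nat.ceil_lt_add_one (by positivity)).le
  have hN1 : 1 ≤ N := Nat.one_le_iff_ne_zero.mpr (by
    intro h0; rw [h0] at hN0; norm_num at hN0; linarith)
  have h34 : (3 / 4 : ℝ) ^ N ≤ (800 * K)⁻¹ := by
    have h1 : (3 / 4 : ℝ) ≤ Real.exp (-(1 / 4)) := by
      have := Real.add_one_le_exp (-(1 / 4) : ℝ); linarith
    calc (3 / 4 : ℝ) ^ N ≤ Real.exp (-(1 / 4)) ^ N := pow_le_pow_left₀ (by norm_num) h1 _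
      _ = Real.exp (-(N / 4)) := by rw [← Real.exp_nat_mul]; congr 1; ring
      _ ≤ Real.exp (-Real.log (800 * K)) := Real.exp_le_exp.mpr (by linarith)
      _ = _ := by rw [Real.exp_neg, Real.exp_log hK0]
  have h4K : 4 * K * (3 / 4) ^ N ≤ 1 / 200 := by
    calc 4 * K * (3 / 4) ^ N ≤ 4 * K * (800 * K)⁻¹ := by gcongr
      _ = 1 / 200 := by field_simp; norm_num
  have hpow : (1 + δ) ^ N ≤ Real.exp 1 * (800 * K) ^ (4 * δ) := by
    calc (1 + δ) ^ N ≤ Real.exp δ ^ N :=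
          pow_le_pow_left₀ (by linarith) (by linarith [Real.add_one_le_exp δ]) _
      _ = Real.exp (N * δ) := by rw [← Real.exp_nat_mul]
      _ ≤ Real.exp (1 + Real.log (800 * K) * (4 * δ)) := by
          refine Real.exp_le_exp.mpr ?_
          nlinarith
      _ = _ := by rw [Real.exp_add, Real.rpow_def_of_pos hK0]
  have h1 : δ / 200 ≤ lam * (1 + δ) ^ N := by
    have h2 := h N hN1
    have h3 : 1 / 200 ≤ lam * (1 + δ) ^ N / δ := by linarith
    rw [le_div_iff₀ hδ] at h3
    linarith
  have hlam : 0 < lam := by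
    by_contra hneg
    have : lam * (1 + δ) ^ N ≤ 0 := mul_nonpos_of_nonpos_of_nonneg (not_lt.mp hneg) (by positivity)
    linarith
  have h5 : δ / 200 ≤ lam * (Real.exp 1 * (800 * K) ^ (4 * δ)) :=
    h1.trans (mul_le_mul_of_nonneg_left hpow hlam.le)
  rw [Real.rpow_neg hK0.le, Real.exp_neg, mul_assoc, ← mul_inv, ← div_eq_mul_inv,
    div_le_iff₀ (by positivity)]
  exact h5

lemma prod_norm_le_pow_card {ι : Type*} (s : Finset ι) (f : ι → ℂ) (B : ℝ)
    (h : ∀ i ∈ s, ‖f i‖ ≤ B) : ∏ i ∈ s, ‖f i‖ ≤ B ^ s.card := by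
  rw [← Finset.prod_const]
  exact Finset.prod_le_prod (fun _ _ => norm_nonneg _) h

variable {q : ℕ} [NeZero q]

lemma LFunctionTrivChar₁_one_mem :
    ∃ r : ℝ, 0 < r ∧ r ≤ 1 ∧ LFunctionTrivChar₁ q 1 = r := by
  refine ⟨∏ p ∈ q.primeFactors, (1 - (p : ℝ)⁻¹), Finset.prod_pos fun p hp => ?_,
    Finset.prod_le_one (fun p hp => ?_) (fun p hp => ?_), ?_⟩
  · have := (Nat.prime_of_mem_primeFactors hp).one_lt
    have : (p : ℝ)⁻¹ < 1 := inv_lt_one_of_one_lt₀ (by exact_mod_cast this)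
    linarith
  · have := (Nat.prime_of_mem_primeFactors hp).one_lt
    have : (p : ℝ)⁻¹ < 1 := inv_lt_one_of_one_lt₀ (by exact_mod_cast this)
    linarith
  · have : (0 : ℝ) ≤ (p : ℝ)⁻¹ := by positivity
    linarith
  · rw [LFunctionTrivChar₁, Function.update_self]
    push_cast
    rfl

lemma LFunction_one_im {χ : DirichletCharacter ℂ q} (h1 : χ ≠ 1) (h : χ ^ 2 = 1) {σ : ℝ}
    (hσ : 0 < σ) : (LFunction χ σ).im = 0 :=
  im_eq_zero_of_conj (differentiable_LFunction h1) (fun _ hs => conj_LFunction h hs) hσ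

theorem exists_prod_LFunction_one_ge {δ : ℝ} (hδ : 0 < δ) (hδ1 : δ ≤ 1 / 8) :
    ∃ c : ℝ, 0 < c ∧ ∀ (q : ℕ) [NeZero q] (s : Finset (DirichletCharacter ℂ q)), s.card ≤ 3 →
      (∀ χ ∈ s, χ ≠ 1) → (∀ χ ∈ s, χ ^ 2 = 1) →
      (∀ a : ZMod q, 0 ≤ (1 : DirichletCharacter ℂ q) a + ∑ χ ∈ s, χ a) →
      0 ≤ (zetaProd s (1 - δ)).re →
      c * (q : ℝ) ^ (-(16 * δ)) ≤ ∏ χ ∈ s, (LFunction χ 1).re := by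
  refine ⟨δ / 200 * Real.exp (-1) * (2400 * 19 ^ 4) ^ (-(4 * δ)), by positivity, ?_⟩
  intro q _ s hcard hs hreal hpos hneg
  classical
  have hq : (1 : ℝ) ≤ q := by exact_mod_cast NeZero.pos q
  have hn1 : (1 : DirichletCharacter ℂ q) ∉ s := fun h => hs 1 h rfl
  obtain ⟨r, hr0, hr1, hr⟩ := LFunctionTrivChar₁_one_mem (q := q)
  set P := ∏ χ ∈ s, (LFunction χ 1).re with hP
  have hLre : ∀ χ ∈ s, LFunction χ 1 = ((LFunction χ 1).re : ℂ) := by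
    intro χ hχ
    have := LFunction_one_im (hs χ hχ) (hreal χ hχ) one_pos
    rw [Complex.ofReal_one] at this
    apply Complex.ext <;> simp [this]
  have hprod1 : ∏ χ ∈ s, LFunction χ 1 = (P : ℂ) := by
    rw [hP]; push_cast; exact Finset.prod_congr rfl hLre
  have hlam : zetaProd s 1 = ((r * P : ℝ) : ℂ) := by
    rw [zetaProd, hr, hprod1]; push_cast; rfl
  set B : ℝ := 19 * q with hB
  have hB1 : 1 ≤ B := by linarith
  have hpowB : ∀ k ≤ 4, B ^ k ≤ B ^ 4 := fun k hk => pow_le_pow_right₀ hB1 hk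
  have hP3 : |P| ≤ B ^ 4 := by
    rw [← Real.norm_eq_abs, ← Complex.norm_real, ← hprod1, norm_prod]
    refine (prod_norm_le_pow_card _ _ B fun χ hχ => ?_).trans (hpowB _ (by omega))
    refine (norm_sub_one_mul_LFunction_le χ (Or.inr (hs χ hχ)) (by norm_num)
      (by norm_num)).trans ?_
    rw [density_of_ne_one (hs χ hχ)]; simp; linarith
  have hlamB : |r * P| ≤ B ^ 4 := by
    rw [abs_mul, abs_of_pos hr0]
    calc r * |P| ≤ 1 * |P| := by gcongr
      _ ≤ _ := by rw [one_mul]; exact hP3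
  have hK : ∀ z, ‖z - 2‖ = 3 / 2 → ‖dslope (zetaProd s) 1 z‖ ≤ 3 * B ^ 4 := by
    intro z hz
    have hz1 : 1 / 2 ≤ ‖z - 1‖ := by
      have := norm_sub_norm_le (z - 2) (z - 2 - (z - 1))
      rw [hz, show z - 2 - (z - 1) = -1 by ring, norm_neg, norm_one,
        show z - 2 - -1 = z - 1 by ring] at this
      linarith
    have hzne : z ≠ 1 := by rintro rfl; norm_num at hz1
    have hzre : 1 / 2 ≤ z.re := by
      have := (abs_le.mp ((Complex.abs_re_le_norm (z - 2)).trans hz.le)).1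
      simp at this; linarith
    have hzn : ‖z‖ ≤ 7 / 2 := by
      have := norm_add_le (z - 2) 2
      rw [hz] at this; norm_num at this; linarith
    rw [dslope_of_ne _ hzne, slope_def_field, zetaProd_of_ne_one hs hzne, sub_div,
      mul_div_cancel_left₀ _ (sub_ne_zero.mpr hzne), hlam]
    have h1 : ‖∏ χ ∈ insert 1 s, LFunction χ z‖ ≤ B ^ 4 := by
      rw [norm_prod]
      refine (prod_norm_le_pow_card _ _ B fun χ hχ => ?_).trans
        (hpowB _ ((Finset.card_insert_le _ _).trans (by omega)))
      refine (norm_sub_one_mul_LFunction_le χ (Or.inl hzne) hzre hzn).trans ?_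
      have : ‖density χ‖ / ‖z - 1‖ ≤ 1 / (1 / 2) := by
        gcongr; exact norm_density_le χ
      linarith
    have h2 : ‖((r * P : ℝ) : ℂ) / (z - 1)‖ ≤ 2 * B ^ 4 := by
      rw [norm_div, Complex.norm_real, Real.norm_eq_abs, div_le_iff₀ (by linarith)]
      have : 0 ≤ B ^ 4 := by positivity
      nlinarith
    exact (norm_sub_le _ _).trans (by linarith)
  have hF2 : (((7 / 20) ^ 4 : ℝ) : ℂ) ≤ ∏ χ ∈ insert 1 s, LFunction χ 2 := by
    have h1 : ∀ χ ∈ insert 1 s, (7 / 20 : ℂ) ≤ LFunction χ 2 := by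
      intro χ hχ
      refine LFunction_two_ge ?_
      rcases Finset.mem_insert.mp hχ with rfl | hχ
      · exact one_pow 2
      · exact hreal χ hχ
    have h2 : ∏ χ ∈ insert 1 s, LFunction χ 2 =
        ((∏ χ ∈ insert 1 s, (LFunction χ 2).re : ℝ) : ℂ) := by
      push_cast
      refine Finset.prod_congr rfl fun χ hχ => ?_
      have := (Complex.le_def.mp (h1 χ hχ)).2
      norm_num at this
      apply Complex.ext <;> simp [← this]
    rw [h2]
    have h3 : ((7 / 20) ^ 4 : ℝ) ≤ ∏ χ ∈ insert 1 s, (LFunction χ 2).re := by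
      calc ((7 / 20) ^ 4 : ℝ) ≤ (7 / 20) ^ (insert 1 s).card :=
            pow_le_pow_of_le_one (by norm_num) (by norm_num)
              ((Finset.card_insert_le _ _).trans (by omega))
        _ ≤ _ := by
            rw [← Finset.prod_const]
            refine Finset.prod_le_prod (fun _ _ => by norm_num) fun χ hχ => ?_
            have := (Complex.le_def.mp (h1 χ hχ)).1
            norm_num at this ⊢
            exact this
    exact_mod_cast h3
  have hH2 : zetaProd s 2 = ∏ χ ∈ insert 1 s, LFunction χ 2 := by
    rw [zetaProd_of_ne_one hs (by norm_num)]; norm_num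
  have hder : ∀ m, 0 ≤ (-1) ^ m * iteratedDeriv m (fun z => zetaProd s z / (z - 1)) 2 := by
    intro m
    have hev : (fun z => zetaProd s z / (z - 1)) =ᶠ[𝓝 2]
        fun z => ∏ χ ∈ insert 1 s, LFunction χ z := by
      filter_upwards [isOpen_ne.mem_nhds (by norm_num : (2 : ℂ) ≠ 1)] with z hz
      rw [zetaProd_of_ne_one hs hz, mul_div_cancel_left₀ _ (sub_ne_zero.mpr hz)]
    rw [hev.iteratedDeriv_eq]
    refine iteratedDeriv_prod_LFunction_alternating _ (fun a => ?_) ?_ m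
    · rw [Finset.sum_insert hn1]; exact hpos a
    · refine le_trans ?_ hF2
      exact_mod_cast (by norm_num : (0 : ℝ) ≤ (7 / 20) ^ 4)
  have hmain := ge_of_forall_le_pow (lam := r * P) (K := 3 * B ^ 4) (b := (zetaProd s 2).re) hδ
    (by linarith) (by have := one_le_pow₀ (n := 4) hB1; linarith) (by
      have := (Complex.le_def.mp hF2).1
      rw [Complex.ofReal_re] at this
      rw [hH2]
      norm_num at this ⊢
      linarith) (fun N hN =>
      residue_lower_bound (differentiable_zetaProd hs) hlam hδ hδ1 hder hK hneg N hN)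
  have hEq : (800 * (3 * B ^ 4)) ^ (-(4 * δ)) =
      (2400 * 19 ^ 4) ^ (-(4 * δ)) * (q : ℝ) ^ (-(16 * δ)) := by
    rw [show 800 * (3 * B ^ 4) = (2400 * 19 ^ 4) * (q : ℝ) ^ (4 : ℕ) by rw [hB]; ring,
      Real.mul_rpow (by norm_num) (by positivity), ← Real.rpow_natCast_mul (by linarith)]
    congr 2; push_cast; ring
  rw [hEq, ← mul_assoc] at hmain
  have hPpos : 0 < r * P := lt_of_lt_of_le (by positivity) hmain
  have hP0 : 0 < P := pos_of_mul_pos_right hPpos hr0.le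
  refine hmain.trans ?_
  nlinarith

end MontgomeryHooley

namespace MontgomeryHooley

open Complex MeasureTheory Filter Topology DirichletCharacter
open scoped ComplexOrder ComplexConjugate

lemma zetaProd_eq_zero_of_changeLevel {q n : ℕ} [NeZero q] [NeZero n] (hqn : q ∣ n)
    {χ : DirichletCharacter ℂ q} (hχ : χ ≠ 1) {z : ℂ} (hz : z ≠ 1) (h0 : zetaProd {χ} z = 0)
    {s : Finset (DirichletCharacter ℂ n)} (hs : ∀ ψ ∈ s, ψ ≠ 1) (hmem : changeLevel hqn χ ∈ s) :
    zetaProd s z = 0 := by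
  classical
  rw [zetaProd_of_ne_one (by simpa using hχ) hz, Finset.prod_pair hχ.symm] at h0
  rw [zetaProd_of_ne_one hs hz]
  rcases mul_eq_zero.mp ((mul_eq_zero.mp h0).resolve_left (sub_ne_zero.mpr hz)) with h | h
  · refine mul_eq_zero_of_right _ (Finset.prod_eq_zero (Finset.mem_insert_self 1 s) ?_)
    have := LFunction_changeLevel hqn (1 : DirichletCharacter ℂ q) (Or.inr hz)
    rw [h, zero_mul, changeLevel_one] at this
    exact this
  · refine mul_eq_zero_of_right _ (Finset.prod_eq_zero (Finset.mem_insert_of_mem hmem) ?_)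
    rw [LFunction_changeLevel hqn χ (Or.inr hz), h, zero_mul]

lemma norm_LFunction_changeLevel_one_le {q r : ℕ} [NeZero q] [NeZero r] [NeZero (r * q)]
    {χ : DirichletCharacter ℂ q} (hχ : χ ≠ 1) :
    ‖LFunction (changeLevel (Dvd.intro_left r rfl : q ∣ r * q) χ) 1‖ ≤
      2 ^ r.primeFactors.card * ‖LFunction χ 1‖ := by
  rw [LFunction_changeLevel _ χ (Or.inl hχ), norm_mul, norm_prod, mul_comm]
  refine mul_le_mul_of_nonneg_right ?_ (norm_nonneg _)
  rw [Nat.primeFactors_mul (NeZero.ne r) (NeZero.ne q)]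
  have h1 : ∏ p ∈ r.primeFactors ∪ q.primeFactors, ‖1 - χ p * (p : ℂ) ^ (-1 : ℂ)‖ =
      ∏ p ∈ r.primeFactors \ q.primeFactors, ‖1 - χ p * (p : ℂ) ^ (-1 : ℂ)‖ := by
    symm
    refine Finset.prod_subset (Finset.sdiff_subset.trans Finset.subset_union_left) ?_
    intro p hp hnp
    have hpq : p ∈ q.primeFactors := by
      rw [Finset.mem_sdiff] at hnp; rw [Finset.mem_union] at hp; tauto
    have : χ p = 0 := by
      refine χ.map_nonunit ?_
      rw [ZMod.isUnit_iff_coprime]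
      intro hc
      have := Nat.prime_of_mem_primeFactors hpq
      exact this.one_lt.ne' (Nat.Coprime.eq_one_of_dvd hc (Nat.dvd_of_mem_primeFactors hpq))
    simp [this]
  rw [h1]
  calc _ ≤ (2 : ℝ) ^ (r.primeFactors \ q.primeFactors).card := by
        refine prod_norm_le_pow_card _ _ _ fun p hp => ?_
        have hp := Nat.prime_of_mem_primeFactors (Finset.mem_sdiff.mp hp).1
        refine (norm_sub_le _ _).trans ?_
        have h2 : ‖χ p * (p : ℂ) ^ (-1 : ℂ)‖ ≤ 1 := by
          rw [norm_mul, Complex.norm_natCast_cpow_of_pos hp.pos]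
          refine mul_le_one₀ (χ.norm_le_one _) (by positivity) ?_
          refine Real.rpow_le_one_of_one_le_of_nonpos ?_ (by simp)
          exact_mod_cast hp.one_lt.le
        rw [norm_one]; linarith
    _ ≤ _ := pow_le_pow_right₀ (by norm_num) (Finset.card_le_card Finset.sdiff_subset)

lemma exists_zetaProd_eq_zero {q : ℕ} [NeZero q] {χ : DirichletCharacter ℂ q} (hχ : χ ≠ 1)
    (hr : χ ^ 2 = 1) {δ : ℝ} (hδ : 0 < δ) (hδ1 : δ < 1) (h : (zetaProd {χ} (1 - δ)).re < 0) :
    ∃ δ' : ℝ, 0 < δ' ∧ δ' ≤ δ ∧ zetaProd {χ} (1 - δ') = 0 := by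
  classical
  have hs : ∀ ψ ∈ ({χ} : Finset (DirichletCharacter ℂ q)), ψ ≠ 1 := by simpa using hχ
  have hrs : ∀ ψ ∈ ({χ} : Finset (DirichletCharacter ℂ q)), ψ ^ 2 = 1 := by simpa using hr
  have hcont : Continuous fun t : ℝ => (zetaProd {χ} (1 - t)).re :=
    Complex.continuous_re.comp ((differentiable_zetaProd hs).continuous.comp
      (continuous_const.sub Complex.continuous_ofReal))
  have h2 : 0 ≤ (zetaProd {χ} (1 - ((-1 : ℝ) : ℂ))).re := by
    have h20 : (1 - ((-1 : ℝ) : ℂ)) = 2 := by push_cast; norm_num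
    rw [h20, zetaProd_of_ne_one hs (by norm_num), Finset.prod_pair hχ.symm]
    have := mul_nonneg (le_trans (by norm_num [Complex.le_def]) (LFunction_two_ge (q := q)
      (one_pow 2))) (le_trans (by norm_num [Complex.le_def]) (LFunction_two_ge hr))
    have h3 := (Complex.le_def.mp this).1
    norm_num at h3 ⊢
    exact h3
  obtain ⟨t, ht, ht0⟩ := intermediate_value_Icc' (by linarith : (-1 : ℝ) ≤ δ) hcont.continuousOn
    ⟨h.le, h2⟩
  have him := zetaProd_im hs hrs (σ := 1 - t) (by linarith [ht.2])
  have hz : zetaProd {χ} (1 - t) = 0 := by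
    apply Complex.ext
    · exact ht0
    · push_cast at him; exact him
  refine ⟨t, ?_, ht.2, hz⟩
  by_contra hneg
  push Not at hneg
  rcases eq_or_lt_of_le hneg with h0 | h0
  · subst h0
    obtain ⟨r, hr0, -, hr⟩ := LFunctionTrivChar₁_one_mem (q := q)
    rw [zetaProd, Finset.prod_singleton] at hz
    rw [Complex.ofReal_zero, sub_zero] at hz
    exact mul_ne_zero (LFunctionTrivChar₁_apply_one_ne_zero q)
      (LFunction_apply_one_ne_zero hχ) hz
  · have hne : (1 - (t : ℂ)) ≠ 1 := by
      intro h; apply h0.ne; simpa using h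
    have hre : 1 ≤ (1 - (t : ℂ)).re := by simp; linarith
    rw [zetaProd_of_ne_one hs hne] at hz
    rcases mul_eq_zero.mp hz with h | h
    · exact sub_ne_zero.mpr hne h
    · exact Finset.prod_ne_zero_iff.mpr
        (fun ψ _ => LFunction_ne_zero_of_one_le_re ψ (Or.inr hne) hre) h

/-- Siegel's theorem. -/
theorem siegel {ε : ℝ} (hε : 0 < ε) (hε1 : ε ≤ 1) :
    ∃ c : ℝ, 0 < c ∧ ∀ (q : ℕ) [NeZero q] (χ : DirichletCharacter ℂ q), χ ≠ 1 → χ ^ 2 = 1 →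
      c * (q : ℝ) ^ (-ε) ≤ ‖LFunction χ 1‖ := by
  classical
  have hδ : 0 < ε / 32 := by positivity
  by_cases hcase : ∀ (q : ℕ) [NeZero q] (χ : DirichletCharacter ℂ q), χ ≠ 1 → χ ^ 2 = 1 →
      0 ≤ (zetaProd {χ} (1 - ((ε / 32 : ℝ) : ℂ))).re
  · obtain ⟨c, hc, h⟩ := exists_prod_LFunction_one_ge hδ (by linarith)
    refine ⟨c, hc, fun q _ χ hχ hr => ?_⟩
    have hq : (1 : ℝ) ≤ q := by exact_mod_cast NeZero.pos q
    have := h q {χ} (by simp) (by simpa using hχ) (by simpa using hr) (fun a => ?_)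
      (hcase q χ hχ hr)
    · rw [Finset.prod_singleton] at this
      refine le_trans ?_ (this.trans ((le_abs_self _).trans (Complex.abs_re_le_norm _)))
      refine mul_le_mul_of_nonneg_left ?_ hc.le
      exact Real.rpow_le_rpow_of_exponent_le hq (by linarith)
    · rw [Finset.sum_singleton]
      by_cases ha : IsUnit a
      · rw [MulChar.one_apply ha]
        rcases eq_zero_or_one_or_neg_one hr a with h | h | h <;> rw [h] <;>
          norm_num [Complex.le_def]
      · rw [MulChar.map_nonunit _ ha, MulChar.map_nonunit _ ha]; simp
  · push Not at hcase
    obtain ⟨q₁, _, χ₁, hχ₁, hr₁, hneg⟩ := hcase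
    obtain ⟨δ, hδ0, hδ1, hzero⟩ := exists_zetaProd_eq_zero hχ₁ hr₁ hδ (by linarith) hneg
    obtain ⟨c, hc, h⟩ := exists_prod_LFunction_one_ge hδ0 (by linarith)
    obtain ⟨C, hC, hbound⟩ := norm_LFunction_le_of_ne_one (η := ε / 4) (by positivity) (by linarith)
    set k := q₁.primeFactors.card
    have hq₁ : (1 : ℝ) ≤ q₁ := by exact_mod_cast NeZero.pos q₁
    refine ⟨c * (q₁ : ℝ) ^ (-ε) / (C ^ 2 * 2 ^ (ε / 2) * 2 ^ k), by positivity, ?_⟩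
    intro q _ χ hχ hr
    have : NeZero (q₁ * q) := ⟨Nat.mul_ne_zero (NeZero.ne _) (NeZero.ne _)⟩
    have hq : (1 : ℝ) ≤ q := by exact_mod_cast NeZero.pos q
    set n := q₁ * q with hn
    have hnr : (n : ℝ) = q₁ * q := by rw [hn]; push_cast; rfl
    have hn1 : (1 : ℝ) ≤ n := by rw [hnr]; nlinarith
    set ψ₁ := changeLevel (Dvd.intro q rfl : q₁ ∣ n) χ₁ with hψ₁
    set ψ := changeLevel (Dvd.intro_left q₁ rfl : q ∣ n) χ with hψ
    have hψ₁1 : ψ₁ ≠ 1 := fun h => hχ₁ ((changeLevel_eq_one_iff _).mp h)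
    have hψ1 : ψ ≠ 1 := fun h => hχ ((changeLevel_eq_one_iff _).mp h)
    have hψ₁2 : ψ₁ ^ 2 = 1 := by rw [hψ₁, ← map_pow, hr₁, changeLevel_one]
    have hψ2 : ψ ^ 2 = 1 := by rw [hψ, ← map_pow, hr, changeLevel_one]
    have hzne : (1 - (δ : ℂ)) ≠ 1 := by
      intro h; apply hδ0.ne'; simpa using h
    have hb : ∀ φ : DirichletCharacter ℂ n, φ ≠ 1 →
        ‖LFunction φ 1‖ ≤ C * (2 * n : ℝ) ^ (ε / 4) := by
      intro φ hφ
      have := (hbound n φ 1 (by simp; linarith) (by norm_num) hφ).1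
      simpa [analyticSize, mul_comm] using this
    have hkey : c * (n : ℝ) ^ (-(16 * δ)) ≤
        (C * (2 * n : ℝ) ^ (ε / 4)) ^ 2 * ‖LFunction ψ 1‖ := by
      have hM : 1 ≤ C * (2 * n : ℝ) ^ (ε / 4) := by
        have := Real.one_le_rpow (by linarith : (1 : ℝ) ≤ 2 * n) (by positivity : 0 ≤ ε / 4)
        nlinarith
      set M := C * (2 * n : ℝ) ^ (ε / 4)
      by_cases heq : ψ₁ = ψ
      · have hmem : ψ₁ ∈ ({ψ} : Finset (DirichletCharacter ℂ n)) := by simp [heq]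
        have hs : ∀ φ ∈ ({ψ} : Finset (DirichletCharacter ℂ n)), φ ≠ 1 := by simpa using hψ1
        have h0 := zetaProd_eq_zero_of_changeLevel _ hχ₁ hzne hzero hs hmem
        have := h n {ψ} (by simp) hs (by simpa using hψ2) (fun a => ?_) (by rw [h0]; simp)
        · rw [Finset.prod_singleton] at this
          refine this.trans (((le_abs_self _).trans (Complex.abs_re_le_norm _)).trans ?_)
          refine le_mul_of_one_le_left (norm_nonneg _) (one_le_pow₀ hM)
        · rw [Finset.sum_singleton]
          by_cases ha : IsUnit a
          · rw [MulChar.one_apply ha]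
            rcases eq_zero_or_one_or_neg_one hψ2 a with h | h | h <;> rw [h] <;>
              norm_num [Complex.le_def]
          · rw [MulChar.map_nonunit _ ha, MulChar.map_nonunit _ ha]; simp
      · have hprod1 : ψ₁ * ψ ≠ 1 := by
          intro hp
          apply heq
          calc ψ₁ = ψ₁ * ψ ^ 2 := by rw [hψ2, mul_one]
            _ = (ψ₁ * ψ) * ψ := by rw [pow_two, mul_assoc]
            _ = ψ := by rw [hp, one_mul]
        have hd1 : ψ₁ ≠ ψ₁ * ψ := fun hp => hψ1 (by simpa using hp.symm)
        have hd2 : ψ ≠ ψ₁ * ψ := fun hp => hψ₁1 (by simpa using hp.symm)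
        have hn1 : ψ₁ ∉ ({ψ, ψ₁ * ψ} : Finset (DirichletCharacter ℂ n)) := by
          rw [Finset.mem_insert, Finset.mem_singleton, not_or]; exact ⟨heq, hd1⟩
        have hn2 : ψ ∉ ({ψ₁ * ψ} : Finset (DirichletCharacter ℂ n)) := by
          rw [Finset.mem_singleton]; exact hd2
        have hs : ∀ φ ∈ ({ψ₁, ψ, ψ₁ * ψ} : Finset (DirichletCharacter ℂ n)), φ ≠ 1 := by
          intro φ hφ
          simp only [Finset.mem_insert, Finset.mem_singleton] at hφ
          rcases hφ with rfl | rfl | rfl <;> assumption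
        have h0 := zetaProd_eq_zero_of_changeLevel _ hχ₁ hzne hzero hs
          (Finset.mem_insert_self _ _)
        have := h n {ψ₁, ψ, ψ₁ * ψ} Finset.card_le_three hs (fun φ hφ => ?_) (fun a => ?_)
          (by rw [h0]; simp)
        · rw [Finset.prod_insert hn1, Finset.prod_insert hn2, Finset.prod_singleton] at this
          refine this.trans ((le_abs_self _).trans ?_)
          rw [abs_mul, abs_mul]
          calc _ ≤ M * (‖LFunction ψ 1‖ * M) := by
                gcongr
                · exact (Complex.abs_re_le_norm _).trans (hb _ hψ₁1)
                · exact Complex.abs_re_le_norm _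
                · exact (Complex.abs_re_le_norm _).trans (hb _ hprod1)
            _ = _ := by ring
        · simp only [Finset.mem_insert, Finset.mem_singleton] at hφ
          rcases hφ with rfl | rfl | rfl
          · exact hψ₁2
          · exact hψ2
          · rw [mul_pow, hψ₁2, hψ2, mul_one]
        · rw [Finset.sum_insert hn1, Finset.sum_insert hn2, Finset.sum_singleton, MulChar.mul_apply]
          by_cases ha : IsUnit a
          · rw [MulChar.one_apply ha]
            rcases eq_zero_or_one_or_neg_one hψ2 a with h | h | h <;> rw [h] <;>
            rcases eq_zero_or_one_or_neg_one hψ₁2 a with h | h | h <;> rw [h] <;>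
              norm_num [Complex.le_def]
          · rw [MulChar.map_nonunit _ ha, MulChar.map_nonunit _ ha, MulChar.map_nonunit _ ha]
            simp
    have hcl := norm_LFunction_changeLevel_one_le (q := q) (r := q₁) hχ
    have h1 : c * (n : ℝ) ^ (-(ε / 2)) ≤
        (C ^ 2 * 2 ^ (ε / 2) * (n : ℝ) ^ (ε / 2)) * (2 ^ k * ‖LFunction χ 1‖) := by
      calc c * (n : ℝ) ^ (-(ε / 2)) ≤ c * (n : ℝ) ^ (-(16 * δ)) := by
            refine mul_le_mul_of_nonneg_left ?_ hc.le
            exact Real.rpow_le_rpow_of_exponent_le hn1 (by linarith)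
        _ ≤ _ := hkey
        _ = (C ^ 2 * 2 ^ (ε / 2) * (n : ℝ) ^ (ε / 2)) * ‖LFunction ψ 1‖ := by
            rw [mul_pow, ← Real.rpow_mul_natCast (by linarith),
              Real.mul_rpow (by norm_num) (by linarith)]
            push_cast
            rw [show ε / 4 * 2 = ε / 2 by ring]
            ring
        _ ≤ _ := by gcongr
    have h2 : (q₁ : ℝ) ^ (-ε) * (q : ℝ) ^ (-ε) = (n : ℝ) ^ (-(ε / 2)) / (n : ℝ) ^ (ε / 2) := by
      rw [← Real.rpow_sub (by linarith), hnr, ← Real.mul_rpow (by linarith) (by linarith)]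
      congr 1; ring
    rw [div_mul_eq_mul_div, div_le_iff₀ (by positivity), mul_assoc, h2, mul_div_assoc',
      div_le_iff₀ (by positivity)]
    refine h1.trans (le_of_eq ?_)
    ring

end MontgomeryHooley

namespace MontgomeryHooley

open Complex MeasureTheory Filter Topology DirichletCharacter

/-- Bounds for `L(s, χ)` and its derivative just to the left of `Re s = 1`, away from poles. -/
theorem norm_LFunction_le_of_away {η : ℝ} (hη : 0 < η) (hη1 : η ≤ 1 / 2) :
    ∃ C : ℝ, 1 ≤ C ∧ ∀ (q : ℕ) [NeZero q] (χ : DirichletCharacter ℂ q) (s : ℂ),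
      1 - η / 4 ≤ s.re → s.re ≤ 3 → (χ ≠ 1 ∨ 1 / 4 ≤ |s.im|) →
      ‖LFunction χ s‖ ≤ C * analyticSize q s ^ η ∧
        ‖deriv (LFunction χ) s‖ ≤ C * analyticSize q s ^ η := by
  obtain ⟨C, hC, h⟩ := norm_LFunction_le hη hη1
  have hb : ∀ (q : ℕ) [NeZero q] (χ : DirichletCharacter ℂ q) (s : ℂ),
      1 - η / 2 ≤ s.re → s.re ≤ 4 → (χ ≠ 1 ∨ 1 / 8 ≤ |s.im|) →
      ‖LFunction χ s‖ ≤ 9 * C * analyticSize q s ^ η := by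
    intro q _ χ s h1 h2 h3
    have hX2 := two_le_analyticSize (NeZero.pos q) s
    have hd : ‖density χ‖ / ‖s - 1‖ ≤ 8 := by
      rcases h3 with h3 | h3
      · rw [density_of_ne_one h3]; simp
      · have : 1 / 8 ≤ ‖s - 1‖ := by
          have := Complex.abs_im_le_norm (s - 1)
          simp at this; linarith
        rw [div_le_iff₀ (by linarith)]
        linarith [norm_density_le χ]
    refine (h q χ s h1 h2 ?_).trans ?_
    · rcases h3 with h3 | h3
      · exact Or.inr h3
      · left; rintro rfl; norm_num at h3
    · have : 0 ≤ C * analyticSize q s ^ η := by positivity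
      nlinarith
  have hCη : 9 * C ≤ 9 * C * (2 / (η / 4)) := by
    refine le_mul_of_one_le_right (by linarith) ?_
    rw [le_div_iff₀ (by positivity)]; linarith
  refine ⟨9 * C * (2 / (η / 4)), by linarith, ?_⟩
  intro q _ χ s hs1 hs3 hχ
  have hq : 1 ≤ q := NeZero.pos q
  have hX2 := two_le_analyticSize hq s
  constructor
  · refine (hb q χ s (by linarith) (by linarith) ?_).trans
      (mul_le_mul_of_nonneg_right hCη (by positivity))
    exact hχ.imp_right fun h => by linarith
  · have key : ∀ z : ℂ, ‖z - s‖ ≤ η / 4 → 1 - η / 2 ≤ z.re ∧ z.re ≤ 4 ∧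
        (χ ≠ 1 ∨ 1 / 8 ≤ |z.im|) := by
      intro z hz
      have hzre := abs_le.mp ((Complex.abs_re_le_norm (z - s)).trans hz)
      have hzim := (Complex.abs_im_le_norm (z - s)).trans hz
      rw [sub_re] at hzre
      rw [sub_im] at hzim
      refine ⟨by linarith, by linarith, hχ.imp_right fun h => ?_⟩
      have := abs_sub_abs_le_abs_sub s.im z.im
      rw [abs_sub_comm] at this
      linarith
    have := Complex.norm_deriv_le_of_forall_mem_sphere_norm_le (c := s) (R := η / 4)
      (C := 9 * C * (2 * analyticSize q s ^ η)) (f := LFunction χ) (by positivity) ?_ ?_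
    · refine this.trans (le_of_eq ?_)
      ring
    · refine DifferentiableOn.diffContOnCl_ball (U := Metric.closedBall s (η / 4))
        (fun z hz => ?_) le_rfl
      rw [Metric.mem_closedBall, dist_eq_norm] at hz
      refine (differentiableAt_LFunction χ z ?_).differentiableWithinAt
      rcases (key z hz).2.2 with h3 | h3
      · exact Or.inr h3
      · left; rintro rfl; norm_num at h3
    · intro z hz
      have hz' : ‖z - s‖ = η / 4 := by simpa [dist_eq_norm] using hz
      obtain ⟨k1, k2, k3⟩ := key z hz'.le
      refine (hb q χ z k1 k2 k3).trans (mul_le_mul_of_nonneg_left ?_ (by linarith))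
      exact analyticSize_rpow_le hq (by rw [hz']; linarith) hη.le (by linarith)

lemma lower_bound_of_pow_le {g : ℝ → ℝ} {M x : ℝ} (hM : 1 ≤ M) (hx0 : 0 < x)
    (h3 : ∀ y, x ≤ y → y ≤ 1 → y ^ 3 ≤ M ^ 4 * g y ^ 4)
    (hg : ∀ y, 0 ≤ g y) (hx1 : x ≤ 1) (hL : ∀ y, x ≤ y → y ≤ 1 → |g y - g x| ≤ M * (y - x)) :
    1 / (16 * M ^ 8) ≤ g x := by
  have hM0 : 0 < M := by linarith
  have hM8 : 1 ≤ M ^ 8 := one_le_pow₀ hM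
  have hM78 : M ^ 7 ≤ M ^ 8 := pow_le_pow_right₀ hM (by norm_num)
  set x₀ := 1 / (16 * M ^ 8) with hx₀
  have hx₀0 : 0 < x₀ := by positivity
  have hx₀1 : x₀ ≤ 1 := by
    rw [hx₀, div_le_one (by positivity)]; linarith
  have hlow : ∀ y, x ≤ y → x₀ ≤ y → y ≤ 1 → 1 / (8 * M ^ 7) ≤ g y := by
    intro y h1 h2 h4
    have h5 : x₀ ^ 3 ≤ M ^ 4 * g y ^ 4 :=
      (pow_le_pow_left₀ hx₀0.le h2 3).trans (h3 y h1 h4)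
    have h6 : (1 / (8 * M ^ 7)) ^ 4 ≤ g y ^ 4 := by
      rw [← div_le_iff₀' (by positivity)] at h5
      refine le_trans (le_of_eq ?_) h5
      rw [hx₀]; field_simp; ring
    exact le_of_pow_le_pow_left₀ (by norm_num) (hg y) h6
  rcases le_total x₀ x with h | h
  · refine le_trans ?_ (hlow x le_rfl h hx1)
    rw [hx₀]
    refine one_div_le_one_div_of_le (by positivity) ?_
    nlinarith
  · have h1 := hlow x₀ h le_rfl hx₀1
    have h2 := hL x₀ h hx₀1
    have h4 : M * (x₀ - x) ≤ 1 / (16 * M ^ 7) := by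
      have h5 : M * x₀ = 1 / (16 * M ^ 7) := by rw [hx₀]; field_simp
      nlinarith
    have h6 : 1 / (8 * M ^ 7) = 1 / (16 * M ^ 7) + 1 / (16 * M ^ 7) := by field_simp; norm_num
    have h7 : x₀ ≤ 1 / (16 * M ^ 7) := by
      rw [hx₀]
      refine one_div_le_one_div_of_le (by positivity) ?_
      nlinarith
    have := (abs_le.mp h2).2
    linarith

/-- A Lipschitz bound for `L(s, χ)` along horizontal segments. -/
lemma norm_LFunction_sub_le {q : ℕ} [NeZero q] {χ : DirichletCharacter ℂ q} {a b t B : ℝ}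
    (hab : a ≤ b) (h1 : ∀ y ∈ Set.Icc a b, DifferentiableAt ℂ (LFunction χ) (y + I * t))
    (h2 : ∀ y ∈ Set.Icc a b, ‖deriv (LFunction χ) (y + I * t)‖ ≤ B) :
    ‖LFunction χ (b + I * t) - LFunction χ (a + I * t)‖ ≤ B * (b - a) := by
  have := (convex_Icc a b).norm_image_sub_le_of_norm_hasDerivWithin_le
    (f := fun y : ℝ => LFunction χ (y + I * t))
    (f' := fun y : ℝ => deriv (LFunction χ) (y + I * t)) (C := B) (fun y hy => ?_) h2
    (Set.left_mem_Icc.mpr hab) (Set.right_mem_Icc.mpr hab)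
  · rwa [Real.norm_eq_abs, abs_of_nonneg (by linarith)] at this
  · have hd := (h1 y hy).hasDerivAt
    have hi : HasDerivAt (fun y : ℝ => (y : ℂ) + I * t) 1 y :=
      (Complex.ofRealCLM.hasDerivAt (x := y)).add_const (I * t)
    have := hd.comp y hi
    rw [mul_one] at this
    exact this.hasDerivWithinAt

end MontgomeryHooley

namespace MontgomeryHooley

open Complex MeasureTheory Filter Topology DirichletCharacter

lemma norm_LFunction_sub_one_le {q : ℕ} [NeZero q] {χ : DirichletCharacter ℂ q} (hχ : χ ≠ 1)
    {x t B : ℝ} (hx0 : 0 ≤ x) (hx1 : x ≤ 1)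
    (h2 : ∀ z : ℂ, 1 ≤ z.re → z.re ≤ 2 → |z.im| ≤ |t| → ‖deriv (LFunction χ) z‖ ≤ B) :
    ‖LFunction χ (1 + x + I * t) - LFunction χ 1‖ ≤ B * (x + |t|) := by
  have hB : 0 ≤ B := (norm_nonneg _).trans (h2 1 (by simp) (by simp) (by simp))
  have hconv : Convex ℝ {z : ℂ | (1 ≤ z.re ∧ z.re ≤ 2) ∧ (-|t| ≤ z.im ∧ z.im ≤ |t|)} := by
    refine Convex.inter (Convex.inter ?_ ?_) (Convex.inter ?_ ?_)
    · exact convex_halfSpace_re_ge 1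
    · exact convex_halfSpace_re_le 2
    · exact convex_halfSpace_im_ge _
    · exact convex_halfSpace_im_le _
  have := hconv.norm_image_sub_le_of_norm_deriv_le (f := LFunction χ) (C := B) (x := 1)
    (y := 1 + x + I * t) (fun z _ => (differentiable_LFunction hχ) z)
    (fun z hz => h2 z hz.1.1 hz.1.2 (abs_le.mpr hz.2)) (by simp)
    (by
      simp only [Set.mem_ofPred_eq]
      norm_num
      exact ⟨⟨by linarith, by linarith⟩, neg_abs_le t, le_abs_self t⟩)
  refine this.trans (mul_le_mul_of_nonneg_left ?_ hB)
  rw [show (1 + (x : ℂ) + I * t - 1) = x + I * t by ring]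
  refine (norm_add_le _ _).trans ?_
  rw [norm_mul, Complex.norm_real, Complex.norm_real, Complex.norm_I, one_mul, Real.norm_eq_abs,
    Real.norm_eq_abs, abs_of_nonneg hx0]

theorem exists_norm_LFunction_ge {ε : ℝ} (hε : 0 < ε) (hε1 : ε ≤ 1) :
    ∃ c : ℝ, 0 < c ∧ ∀ (q : ℕ) [NeZero q] (χ : DirichletCharacter ℂ q) (x t : ℝ),
      0 < x → x ≤ 1 → (χ ≠ 1 ∨ 1 / 2 ≤ |t|) →
      c * (q * (|t| + 2)) ^ (-ε) ≤ ‖LFunction χ (1 + x + I * t)‖ := by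
  have hη : 0 < ε / 16 := by positivity
  obtain ⟨C₀, hC₀, hb₀⟩ := norm_LFunction_le hη (by linarith)
  obtain ⟨C, hC, hb⟩ := norm_LFunction_le_of_away hη (by linarith)
  obtain ⟨c', hc', hS'⟩ := siegel hη (by linarith)
  obtain ⟨c₁, hc₁, hc₁1, hS⟩ : ∃ c₁ : ℝ, 0 < c₁ ∧ c₁ ≤ 1 ∧ ∀ (q : ℕ) [NeZero q]
      (χ : DirichletCharacter ℂ q), χ ≠ 1 → χ ^ 2 = 1 →
      c₁ * (q : ℝ) ^ (-(ε / 16)) ≤ ‖LFunction χ 1‖ :=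
    ⟨min c' 1, by positivity, min_le_right _ _, fun q _ χ h1 h2 =>
      (mul_le_mul_of_nonneg_right (min_le_left _ _) (by positivity)).trans (hS' q χ h1 h2)⟩
  set η := ε / 16 with hηdef
  set A : ℝ := 128 * C₀ ^ 4 * C / c₁ with hA
  have hCC : C ≤ A := by
    rw [hA, le_div_iff₀ hc₁]
    have : 1 ≤ C₀ ^ 4 := one_le_pow₀ hC₀
    nlinarith
  have hA1 : 1 ≤ A := hC.trans hCC
  refine ⟨min (c₁ / 2) (1 / (16 * A ^ 8)), by positivity, ?_⟩
  intro q _ χ x t hx0 hx1 hχ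
  have hq : (1 : ℝ) ≤ q := by exact_mod_cast NeZero.pos q
  set X : ℝ := q * (|t| + 2) with hX
  have hX2 : 2 ≤ X := by nlinarith [abs_nonneg t]
  have hX0 : 0 < X := by linarith
  have hX1 : 1 ≤ X := by linarith
  have hqX : (q : ℝ) ≤ X := by nlinarith [abs_nonneg t]
  have hXη : 1 ≤ X ^ η := Real.one_le_rpow hX1 hη.le
  have hXsize : ∀ z : ℂ, z.im = t → analyticSize q z = X := by
    intro z hz; rw [analyticSize, hz]
  set τ : ℝ := c₁ * X ^ (-(2 * η)) / (4 * C) with hτ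
  have hτ0 : 0 < τ := by positivity
  have hX2η : X ^ (-(2 * η)) ≤ 1 := Real.rpow_le_one_of_one_le_of_nonpos hX1 (by linarith)
  have hτ1 : τ ≤ 1 := by
    rw [hτ, div_le_one (by positivity)]
    nlinarith [Real.rpow_pos_of_pos hX0 (-(2 * η))]
  by_cases hnear : χ ≠ 1 ∧ χ ^ 2 = 1 ∧ x + |t| ≤ 2 * τ
  · obtain ⟨hχ1, hχ2, hsmall⟩ := hnear
    have h1 := norm_LFunction_sub_one_le hχ1 (B := C * X ^ η) (t := t) hx0.le hx1 (fun z hz1 hz2 hz3 => by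
      refine (hb q χ z (by linarith) (by linarith) (Or.inl hχ1)).2.trans ?_
      refine mul_le_mul_of_nonneg_left (Real.rpow_le_rpow ?_ ?_ hη.le) (by linarith)
      · rw [analyticSize]; positivity
      · rw [analyticSize, hX]; gcongr)
    have h2 := hS q χ hχ1 hχ2
    have h3 : C * X ^ η * (x + |t|) ≤ c₁ * X ^ (-η) / 2 := by
      calc C * X ^ η * (x + |t|) ≤ C * X ^ η * (2 * τ) := by gcongr
        _ = c₁ * (X ^ η * X ^ (-(2 * η))) / 2 := by rw [hτ]; field_simp; ring
        _ = c₁ * X ^ (-η) / 2 := by rw [← Real.rpow_add hX0]; congr 3; ring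
    have h4 : c₁ * X ^ (-η) ≤ c₁ * (q : ℝ) ^ (-η) :=
      mul_le_mul_of_nonneg_left
        (Real.rpow_le_rpow_of_nonpos (by linarith) hqX (by linarith)) hc₁.le
    have h5 : X ^ (-ε) ≤ X ^ (-η) := Real.rpow_le_rpow_of_exponent_le hX1 (by linarith)
    have h6 : ‖LFunction χ 1‖ ≤ ‖LFunction χ (1 + x + I * t)‖ +
        ‖LFunction χ (1 + x + I * t) - LFunction χ 1‖ := by
      rw [norm_sub_rev]
      simpa using norm_add_le (LFunction χ (1 + x + I * t))
        (LFunction χ 1 - LFunction χ (1 + x + I * t))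
    calc _ ≤ c₁ / 2 * X ^ (-η) :=
          mul_le_mul (min_le_left _ _) h5 (by positivity) (by positivity)
      _ ≤ _ := by linarith
  · have hfar : χ ^ 2 = 1 → τ ≤ x ∨ τ ≤ 2 * |t| := by
      intro h2
      rcases eq_or_ne χ 1 with h1 | h1
      · right
        have := hχ.resolve_left (not_not.mpr h1)
        linarith
      · have h3 : ¬ (x + |t| ≤ 2 * τ) := fun h3 => hnear ⟨h1, h2, h3⟩
        by_contra! h4
        linarith [h4.1, h4.2, abs_nonneg t]
    set M := A * X ^ (2 * η) with hM
    have hX2η1 : X ^ η ≤ X ^ (2 * η) := Real.rpow_le_rpow_of_exponent_le hX1 (by linarith)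
    have hM1 : 1 ≤ M := by nlinarith
    have hsqbound : ∀ y : ℝ, x ≤ y → y ≤ 1 →
        ‖LFunction (χ ^ 2) (1 + y + 2 * I * t)‖ ≤ 16 * C₀ * C / c₁ * X ^ (3 * η) := by
      intro y hy hy1
      have hd : ‖density (χ ^ 2)‖ / ‖(1 + y + 2 * I * t : ℂ) - 1‖ ≤ 1 / τ := by
        by_cases h2 : χ ^ 2 = 1
        · have : τ ≤ ‖(1 + y + 2 * I * t : ℂ) - 1‖ := by
            rw [show (1 + y + 2 * I * t : ℂ) - 1 = y + 2 * I * t by ring]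
            rcases hfar h2 with h | h
            · have := Complex.abs_re_le_norm ((y : ℂ) + 2 * I * t)
              simp at this
              linarith [le_abs_self y]
            · have := Complex.abs_im_le_norm ((y : ℂ) + 2 * I * t)
              simp [abs_mul] at this
              linarith
          exact div_le_div₀ zero_le_one (norm_density_le _) hτ0 this
        · rw [density_of_ne_one h2]; simp; positivity
      have h1 := hb₀ q (χ ^ 2) (1 + y + 2 * I * t) (by simp; linarith) (by simp; linarith)
        (Or.inl (by
          intro h
          have := congrArg Complex.re h
          simp at this; linarith))
      have hsz : analyticSize q (1 + y + 2 * I * t) ^ η ≤ 2 * X ^ η := by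
        have h2 : analyticSize q (1 + y + 2 * I * t) ≤ 2 * X := by
          rw [analyticSize, hX]
          simp [abs_mul]
          nlinarith [abs_nonneg t]
        calc _ ≤ (2 * X) ^ η := Real.rpow_le_rpow (by rw [analyticSize]; positivity) h2 hη.le
          _ = 2 ^ η * X ^ η := Real.mul_rpow (by norm_num) hX0.le
          _ ≤ _ := by
            refine mul_le_mul_of_nonneg_right ?_ (by positivity)
            calc (2 : ℝ) ^ η ≤ 2 ^ (1 : ℝ) :=
                  Real.rpow_le_rpow_of_exponent_le (by norm_num) (by linarith)
              _ = 2 := Real.rpow_one 2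
      have h3 : 1 + 1 / τ ≤ 2 / τ := by
        rw [show 2 / τ = 1 / τ + 1 / τ by ring]
        have : 1 ≤ 1 / τ := by rw [le_div_iff₀ hτ0]; linarith
        linarith
      have h4 : X ^ (3 * η) = X ^ η * X ^ (2 * η) := by rw [← Real.rpow_add hX0]; congr 1; ring
      calc _ ≤ C₀ * (2 * X ^ η) * (2 / τ) := by
            refine h1.trans ?_
            gcongr
            exact (add_le_add_right hd 1).trans h3
        _ = _ := by
          rw [hτ, h4, Real.rpow_neg hX0.le]
          have : X ^ (2 * η) ≠ 0 := by positivity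
          field_simp
          ring
    have htriv : ∀ y : ℝ, 0 < y → y ≤ 1 →
        ‖LFunctionTrivChar q (1 + y)‖ ≤ C₀ * X ^ η * (2 / y) := by
      intro y hy hy1
      have h1 := hb₀ q 1 (1 + y) (by simp; linarith) (by simp; linarith)
        (Or.inl (by
          intro h
          have := congrArg Complex.re h
          simp at this; linarith))
      refine h1.trans ?_
      gcongr
      · rw [analyticSize]; positivity
      · rw [analyticSize, hX]; simp; gcongr; linarith [abs_nonneg t]
      · rw [add_sub_cancel_left, Complex.norm_real, Real.norm_eq_abs, abs_of_pos hy,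
          show 2 / y = 1 / y + 1 / y by ring]
        have h2 : 1 ≤ 1 / y := by rw [le_div_iff₀ hy]; linarith
        have h3 : ‖density (1 : DirichletCharacter ℂ q)‖ / y ≤ 1 / y := by
          gcongr; exact norm_density_le _
        linarith
    have hmain := lower_bound_of_pow_le (g := fun y => ‖LFunction χ (1 + y + I * t)‖) (x := x)
      hM1 hx0 ?_ (fun y => norm_nonneg _) hx1 ?_
    · refine le_trans ?_ hmain
      have hM8 : M ^ 8 = A ^ 8 * X ^ ε := by
        rw [hM, mul_pow, ← Real.rpow_mul_natCast hX0.le, hηdef]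
        congr 2; push_cast; ring
      rw [hM8, Real.rpow_neg hX0.le]
      calc _ ≤ (1 / (16 * A ^ 8)) * (X ^ ε)⁻¹ :=
            mul_le_mul_of_nonneg_right (min_le_right _ _) (by positivity)
        _ = _ := by field_simp
    · intro y hxy hy1
      have hy0 : 0 < y := by linarith
      have h341 := norm_LFunction_product_ge_one χ hy0 t
      rw [norm_mul, norm_mul, norm_pow, norm_pow] at h341
      set g := ‖LFunction χ (1 + y + I * t)‖ with hg
      have h1 : 1 ≤ (C₀ * X ^ η * (2 / y)) ^ 3 * g ^ 4 * (16 * C₀ * C / c₁ * X ^ (3 * η)) := by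
        refine h341.trans ?_
        gcongr
        · exact htriv y hy0 hy1
        · exact hsqbound y hxy hy1
      have hX3 : X ^ (3 * η) = (X ^ η) ^ 3 := by
        rw [← Real.rpow_mul_natCast hX0.le]; congr 1; push_cast; ring
      have hX2' : X ^ (2 * η) = (X ^ η) ^ 2 := by
        rw [← Real.rpow_mul_natCast hX0.le]; congr 1; push_cast; ring
      have h2 : y ^ 3 ≤ A * (X ^ η) ^ 6 * g ^ 4 := by
        have : (C₀ * X ^ η * (2 / y)) ^ 3 * g ^ 4 * (16 * C₀ * C / c₁ * X ^ (3 * η)) =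
            (A * (X ^ η) ^ 6 * g ^ 4) / y ^ 3 := by
          rw [hX3, hA]; field_simp; ring
        rw [this, le_div_iff₀ (by positivity), one_mul] at h1
        exact h1
      refine h2.trans (mul_le_mul_of_nonneg_right ?_ (by positivity))
      rw [hM, hX2', mul_pow, ← pow_mul]
      refine mul_le_mul ?_ (pow_le_pow_right₀ hXη (by norm_num)) (by positivity) (by positivity)
      exact le_self_pow₀ hA1 (by norm_num)
    · intro y hxy hy1
      have hin : ∀ u ∈ Set.Icc (1 + x) (1 + y), ((u : ℂ) + I * t).re = u ∧
          ((u : ℂ) + I * t).im = t := by intro u _; simp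
      have := norm_LFunction_sub_le (χ := χ) (a := 1 + x) (b := 1 + y) (t := t) (B := M)
        (by linarith) (fun u hu => by
          refine differentiableAt_LFunction_of_one_lt χ ?_
          rw [(hin u hu).1]; linarith [hu.1]) (fun u hu => by
          have h1 := (hb q χ (u + I * t) (by rw [(hin u hu).1]; linarith [hu.1])
            (by rw [(hin u hu).1]; linarith [hu.2])
            (hχ.imp_right fun h => by rw [(hin u hu).2]; linarith)).2
          rw [hXsize _ (hin u hu).2] at h1
          refine h1.trans ?_
          rw [hM]
          exact mul_le_mul hCC hX2η1 (by positivity) (by positivity))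
      push_cast at this
      refine (abs_norm_sub_norm_le _ _).trans (this.trans (le_of_eq ?_))
      ring

end MontgomeryHooley

namespace MontgomeryHooley

open Complex MeasureTheory Filter Topology DirichletCharacter

/-- The lower bound for `L(s, χ)` persists slightly to the left of `Re s = 1`. -/
theorem exists_norm_LFunction_ge_of_left {ε : ℝ} (hε : 0 < ε) (hε1 : ε ≤ 1 / 2) :
    ∃ c δ : ℝ, 0 < c ∧ 0 < δ ∧ δ ≤ ε / 4 ∧ ∀ (q : ℕ) [NeZero q] (χ : DirichletCharacter ℂ q)
      (z : ℂ), 1 - δ * analyticSize q z ^ (-(2 * ε)) ≤ z.re → z.re ≤ 2 →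
      (χ ≠ 1 ∨ 1 / 2 ≤ |z.im|) → c * analyticSize q z ^ (-ε) ≤ ‖LFunction χ z‖ := by
  obtain ⟨C, hC, hb⟩ := norm_LFunction_le_of_away hε hε1
  obtain ⟨c, hc, hl⟩ := exists_norm_LFunction_ge hε (by linarith)
  refine ⟨c / 2, min (ε / 4) (c / (4 * C)), by positivity, by positivity, min_le_left _ _, ?_⟩
  intro q _ χ z h1 h2 h3
  set δ := min (ε / 4) (c / (4 * C)) with hδ
  have hδ0 : 0 < δ := by positivity
  set Y := analyticSize q z with hY
  have hY2 : 2 ≤ Y := two_le_analyticSize (NeZero.pos q) z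
  have hY0 : 0 < Y := by linarith
  have hYle : Y ^ (-(2 * ε)) ≤ 1 := Real.rpow_le_one_of_one_le_of_nonpos (by linarith) (by linarith)
  set ρ := δ * Y ^ (-(2 * ε)) with hρ
  have hρ0 : 0 < ρ := by positivity
  have hρδ : ρ ≤ δ := by nlinarith
  have hδε : δ ≤ ε / 4 := min_le_left _ _
  have hz : z = z.re + I * z.im := by rw [mul_comm]; exact (re_add_im z).symm
  have hlow : ∀ x : ℝ, 0 < x → x ≤ 1 → c * Y ^ (-ε) ≤ ‖LFunction χ (1 + x + I * z.im)‖ :=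
    fun x hx0 hx1 => hl q χ x z.im hx0 hx1 h3
  have hYpos : 0 < Y ^ (-ε) := by positivity
  rcases lt_or_ge 1 z.re with h | h
  · have := hlow (z.re - 1) (by linarith) (by linarith)
    rw [show (1 : ℂ) + ((z.re - 1 : ℝ) : ℂ) + I * z.im = z by
      conv_rhs => rw [hz]
      push_cast; ring] at this
    nlinarith
  · have h4 := hlow ρ hρ0 (by linarith)
    have h5 := norm_LFunction_sub_le (χ := χ) (a := z.re) (b := 1 + ρ) (t := z.im)
      (B := C * Y ^ ε) (by linarith) (fun y hy => by
        refine differentiableAt_LFunction χ _ ?_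
        rcases h3 with h3 | h3
        · exact Or.inr h3
        · left
          intro h'
          have := congrArg Complex.im h'
          simp at this
          norm_num [this] at h3) (fun y hy => by
        have := (hb q χ (y + I * z.im) (by simp; linarith [hy.1]) (by simp; linarith [hy.2])
          (h3.imp_right fun h => by simp; linarith)).2
        rwa [show analyticSize q (y + I * z.im) = Y by
          rw [hY, analyticSize, analyticSize]; simp] at this)
    rw [← hz] at h5
    have h6 : C * Y ^ ε * (1 + ρ - z.re) ≤ c / 2 * Y ^ (-ε) := by
      have hd : δ ≤ c / (4 * C) := min_le_right _ _
      rw [le_div_iff₀ (by positivity)] at hd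
      calc C * Y ^ ε * (1 + ρ - z.re) ≤ C * Y ^ ε * (2 * ρ) := by gcongr; linarith
        _ = (δ * (4 * C)) / 2 * (Y ^ ε * Y ^ (-(2 * ε))) := by rw [hρ]; ring
        _ = (δ * (4 * C)) / 2 * Y ^ (-ε) := by rw [← Real.rpow_add hY0]; congr 2; ring
        _ ≤ _ := by gcongr
    have h7 : ‖LFunction χ (1 + ρ + I * z.im)‖ ≤ ‖LFunction χ z‖ +
        ‖LFunction χ (((1 + ρ : ℝ) : ℂ) + I * z.im) - LFunction χ z‖ := by
      push_cast
      simpa using norm_add_le (LFunction χ z) (LFunction χ (1 + ρ + I * z.im) - LFunction χ z)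
    linarith

/-- Bounds for derivatives of `L'/L + κ L` to the right of `Re s = 1`, away from poles. -/
theorem norm_iteratedDeriv_logDeriv_le (k : ℕ) {ε : ℝ} (hε : 0 < ε) :
    ∃ C : ℝ, 0 < C ∧ ∀ (q : ℕ) [NeZero q] (χ : DirichletCharacter ℂ q) (κ s : ℂ), ‖κ‖ ≤ 1 →
      1 < s.re → s.re ≤ 3 / 2 → (χ ≠ 1 ∨ 3 / 4 ≤ |s.im|) →
      ‖iteratedDeriv k (fun z => logDeriv (LFunction χ) z + κ * LFunction χ z) s‖ ≤
        C * analyticSize q s ^ ε := by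
  set η := min (1 / 2) (ε / (2 * k + 2)) with hη
  have hη0 : 0 < η := by positivity
  have hη1 : η ≤ 1 / 2 := min_le_left _ _
  have hηε : (2 * k + 2) * η ≤ ε := by
    have : η ≤ ε / (2 * k + 2) := min_le_right _ _
    rwa [le_div_iff₀' (by positivity)] at this
  obtain ⟨c, δ, hc, hδ, hδη, hl⟩ := exists_norm_LFunction_ge_of_left hη0 hη1
  obtain ⟨C, hC, hb⟩ := norm_LFunction_le_of_away hη0 hη1
  refine ⟨k.factorial * (C / c * 4 + C * 2) * (4 / δ) ^ k, by positivity, ?_⟩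
  intro q _ χ κ s hκ h1 h2 h3
  have hq : 1 ≤ q := NeZero.pos q
  set X := analyticSize q s with hX
  have hX2 : 2 ≤ X := two_le_analyticSize hq s
  have hX0 : 0 < X := by linarith
  have hX1 : 1 ≤ X := by linarith
  set r := δ / 2 * X ^ (-(2 * η)) with hr
  have hr0 : 0 < r := by positivity
  have hXle : X ^ (-(2 * η)) ≤ 1 := Real.rpow_le_one_of_one_le_of_nonpos hX1 (by linarith)
  have hrδ : r ≤ δ / 2 := by nlinarith
  have key : ∀ z : ℂ, ‖z - s‖ ≤ r → LFunction χ z ≠ 0 ∧ DifferentiableAt ℂ (LFunction χ) z ∧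
      ‖logDeriv (LFunction χ) z + κ * LFunction χ z‖ ≤ (C / c * 4 + C * 2) * X ^ (2 * η) := by
    intro z hz
    have hzre := abs_le.mp ((Complex.abs_re_le_norm (z - s)).trans hz)
    have hzim := (Complex.abs_im_le_norm (z - s)).trans hz
    rw [sub_re] at hzre
    rw [sub_im] at hzim
    have hpow : ∀ θ : ℝ, 0 ≤ θ → θ ≤ 1 → analyticSize q z ^ θ ≤ 2 * X ^ θ := fun θ h0 h1 =>
      analyticSize_rpow_le hq (by linarith) h0 h1
    have hZ2 : 2 ≤ analyticSize q z := two_le_analyticSize hq z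
    have hZ0 : 0 < analyticSize q z := by linarith
    have haway : χ ≠ 1 ∨ 1 / 2 ≤ |z.im| := h3.imp_right fun h => by
      have := abs_sub_abs_le_abs_sub s.im z.im
      rw [abs_sub_comm] at this
      linarith
    have hpow2 : r ≤ δ * analyticSize q z ^ (-(2 * η)) := by
      rw [hr, Real.rpow_neg hX0.le, Real.rpow_neg hZ0.le]
      have h := hpow (2 * η) (by linarith) (by linarith)
      calc δ / 2 * (X ^ (2 * η))⁻¹ = δ * (2 * X ^ (2 * η))⁻¹ := by rw [mul_inv]; ring
        _ ≤ _ := by gcongr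
    have hL := hl q χ z (by linarith) (by linarith) haway
    have hB := hb q χ z (by linarith) (by linarith) (haway.imp_right fun h => by linarith)
    have hne : LFunction χ z ≠ 0 := by
      rw [← norm_pos_iff]
      refine lt_of_lt_of_le ?_ hL
      positivity
    refine ⟨hne, differentiableAt_LFunction χ z ?_, ?_⟩
    · rcases haway with h | h
      · exact Or.inr h
      · left; rintro rfl; norm_num at h
    · have hη' := hpow η hη0.le (by linarith)
      have hXX : X ^ (2 * η) = X ^ η * X ^ η := by rw [← Real.rpow_add hX0]; congr 1; ring
      have hXη : 1 ≤ X ^ η := Real.one_le_rpow hX1 hη0.le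
      have e1 : ‖logDeriv (LFunction χ) z‖ ≤ C / c * 4 * X ^ (2 * η) := by
        rw [logDeriv_apply, norm_div, div_le_iff₀ (norm_pos_iff.mpr hne)]
        have hZη : 0 < analyticSize q z ^ η := by positivity
        rw [Real.rpow_neg hZ0.le, ← div_eq_mul_inv, div_le_iff₀ hZη] at hL
        calc ‖deriv (LFunction χ) z‖ ≤ C * analyticSize q z ^ η := hB.2
          _ = C / c * analyticSize q z ^ η * c := by field_simp
          _ ≤ C / c * analyticSize q z ^ η * (‖LFunction χ z‖ * analyticSize q z ^ η) := by gcongr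
          _ = C / c * (analyticSize q z ^ η) ^ 2 * ‖LFunction χ z‖ := by ring
          _ ≤ C / c * (2 * X ^ η) ^ 2 * ‖LFunction χ z‖ := by gcongr
          _ = _ := by rw [hXX]; ring
      have e2 : ‖κ * LFunction χ z‖ ≤ C * 2 * X ^ (2 * η) := by
        rw [norm_mul]
        calc ‖κ‖ * ‖LFunction χ z‖ ≤ 1 * (C * (2 * X ^ η)) := by
              gcongr
              exact hB.1.trans (by gcongr)
          _ ≤ 1 * (C * (2 * (X ^ η * X ^ η))) := by gcongr; exact le_mul_of_one_le_left (by positivity) hXη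
          _ = _ := by rw [hXX]; ring
      exact (norm_add_le _ _).trans (by linarith)
  have hcl : DifferentiableOn ℂ (fun z => logDeriv (LFunction χ) z + κ * LFunction χ z)
      (Metric.ball s r) := by
    have hd : DifferentiableOn ℂ (LFunction χ) (Metric.ball s r) := fun z hz =>
      (key z (by rw [Metric.mem_ball, dist_eq_norm] at hz; exact hz.le)).2.1.differentiableWithinAt
    refine DifferentiableOn.add ?_ (hd.const_mul κ)
    refine DifferentiableOn.div (hd.deriv Metric.isOpen_ball) hd fun z hz => ?_
    exact (key z (by rw [Metric.mem_ball, dist_eq_norm] at hz; exact hz.le)).1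
  have hcauchy := Complex.norm_iteratedDeriv_le_of_forall_mem_sphere_norm_le (c := s) (R := r / 2)
    (C := (C / c * 4 + C * 2) * X ^ (2 * η)) k (by positivity)
    (DifferentiableOn.diffContOnCl_ball hcl (Metric.closedBall_subset_ball (by linarith)))
    (fun z hz => (key z (by
      rw [Metric.mem_sphere, dist_eq_norm] at hz; linarith)).2.2)
  refine hcauchy.trans ?_
  have hrk : (r / 2) ^ k = (δ / 4) ^ k * X ^ (-(2 * η * k)) := by
    rw [hr, show δ / 2 * X ^ (-(2 * η)) / 2 = δ / 4 * X ^ (-(2 * η)) by ring, mul_pow,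
      ← Real.rpow_mul_natCast hX0.le]
    congr 2; ring
  have hε2 : X ^ (2 * η) * X ^ (2 * η * k) ≤ X ^ ε := by
    rw [← Real.rpow_add hX0]
    exact Real.rpow_le_rpow_of_exponent_le hX1 (by linarith)
  calc _ = k.factorial * (C / c * 4 + C * 2) * (4 / δ) ^ k *
        (X ^ (2 * η) * X ^ (2 * η * k)) := by
        rw [hrk, Real.rpow_neg hX0.le, div_pow, div_pow]
        field_simp
    _ ≤ _ := by gcongr

lemma iteratedDeriv_LSeries_eq {a : ℕ → ℂ} (ha : LSeries.abscissaOfAbsConv a ≤ 1) (k : ℕ) {s : ℂ}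
    (hs : 1 < s.re) : ‖LSeries (LSeries.logMul^[k] a) s‖ = ‖iteratedDeriv k (LSeries a) s‖ := by
  rw [LSeries_iteratedDeriv k (ha.trans_lt (by exact_mod_cast hs))]
  simp

lemma iteratedDeriv_congr_of_one_lt_re {f g : ℂ → ℂ} (h : ∀ z : ℂ, 1 < z.re → f z = g z) (k : ℕ)
    {s : ℂ} (hs : 1 < s.re) : iteratedDeriv k f s = iteratedDeriv k g s := by
  refine Filter.EventuallyEq.iteratedDeriv_eq k ?_
  filter_upwards [(isOpen_lt continuous_const Complex.continuous_re).mem_nhds hs] with z hz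
  exact h z hz

lemma abscissaOfAbsConv_le_one_of_summable {a : ℕ → ℂ}
    (h : ∀ s : ℂ, 1 < s.re → LSeriesSummable a s) : LSeries.abscissaOfAbsConv a ≤ 1 := by
  refine LSeries.abscissaOfAbsConv_le_of_forall_lt_LSeriesSummable fun y hy => h _ ?_
  simpa using hy

theorem norm_LSeries_logMul_le_of_ne_one (k : ℕ) :
    ∃ C : ℝ, 0 < C ∧ ∀ (q : ℕ) [NeZero q] (χ : DirichletCharacter ℂ q) (s : ℂ), χ ≠ 1 →
      1 < s.re → s.re ≤ 3 / 2 →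
      ‖LSeries (LSeries.logMul^[k] ((fun n : ℕ => χ n) *
        fun n => (ArithmeticFunction.vonMangoldt n : ℂ))) s‖ ≤
        C * analyticSize q s ^ (1 / 2 : ℝ) := by
  obtain ⟨C, hC, h⟩ := norm_iteratedDeriv_logDeriv_le k (ε := 1 / 2) (by norm_num)
  refine ⟨C, hC, fun q _ χ s hχ h1 h2 => ?_⟩
  rw [iteratedDeriv_LSeries_eq (abscissaOfAbsConv_le_one_of_summable fun s hs =>
    LSeriesSummable_twist_vonMangoldt χ hs) k h1]
  have h3 := h q χ 0 s (by simp) h1 h2 (Or.inl hχ)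
  refine le_trans (le_of_eq ?_) h3
  rw [iteratedDeriv_congr_of_one_lt_re (g := fun z => -(logDeriv (LFunction χ) z +
    0 * LFunction χ z)) (fun z hz => by rw [logDeriv_LFunction_eq χ hz]; ring) k h1,
    iteratedDeriv_fun_neg, norm_neg]

theorem norm_LSeries_logMul_vonMangoldt_sub_one_le (k : ℕ) :
    ∃ C : ℝ, 0 < C ∧ ∀ s : ℂ, 1 < s.re → s.re ≤ 3 / 2 →
      ‖LSeries (LSeries.logMul^[k]
        ((fun n => (ArithmeticFunction.vonMangoldt n : ℂ)) - 1)) s‖ ≤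
        C * analyticSize 1 s ^ (1 / 2 : ℝ) := by
  obtain ⟨C, hC, h⟩ := norm_iteratedDeriv_logDeriv_le k (ε := 1 / 2) (by norm_num)
  set H := LFunctionTrivChar₁ 1 with hH
  have hH1 : H 1 = 1 := by simp [hH, LFunctionTrivChar₁]
  have hHd : Differentiable ℂ H := differentiable_LFunctionTrivChar₁ 1
  have hHne : ∀ z, z ≠ 1 → H z = (z - 1) * LFunctionTrivChar 1 z := fun z hz => by
    simp [hH, LFunctionTrivChar₁, Function.update_of_ne hz]
  have hH0 : ∀ z : ℂ, 1 ≤ z.re → H z ≠ 0 := by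
    intro z hz
    rcases eq_or_ne z 1 with rfl | hz1
    · rw [hH1]; norm_num
    · rw [hHne z hz1]
      exact mul_ne_zero (sub_ne_zero.mpr hz1)
        (LFunction_ne_zero_of_one_le_re _ (Or.inr hz1) hz)
  set g : ℂ → ℂ := fun z => logDeriv H z + dslope H 1 z with hg
  have hg_eq : ∀ z : ℂ, 1 < z.re → g z = logDeriv (LFunction (1 : DirichletCharacter ℂ 1)) z +
      1 * LFunction (1 : DirichletCharacter ℂ 1) z := by
    intro z hz
    have hz1 : z ≠ 1 := by rintro rfl; simp at hz
    have hz1' : z - 1 ≠ 0 := sub_ne_zero.mpr hz1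
    have e1 : logDeriv H z = 1 / (z - 1) + logDeriv (LFunction (1 : DirichletCharacter ℂ 1)) z := by
      have : H =ᶠ[𝓝 z] fun z => (z - 1) * LFunctionTrivChar 1 z := by
        filter_upwards [isOpen_ne.mem_nhds hz1] with w hw
        exact hHne w hw
      rw [logDeriv_apply, this.deriv_eq, this.eq_of_nhds, ← logDeriv_apply,
        logDeriv_mul z hz1' (LFunction_ne_zero_of_one_lt _ hz) (by fun_prop)
          (differentiableAt_LFunction_of_one_lt _ hz)]
      congr 1
      simp [logDeriv_apply]
    rw [hg]
    simp only
    rw [e1, dslope_of_ne _ hz1, slope_def_field, hH1, hHne z hz1]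
    field_simp
    ring
  have hgan : AnalyticOnNhd ℂ g {z | H z ≠ 0} := by
    have h1 : AnalyticOnNhd ℂ H {z | H z ≠ 0} := fun z _ => hHd.analyticAt z
    refine AnalyticOnNhd.add (h1.deriv.div h1 fun z hz => hz) fun z _ => ?_
    have : Differentiable ℂ (dslope H 1) := by
      rw [← differentiableOn_univ]
      exact (Complex.differentiableOn_dslope Filter.univ_mem).mpr hHd.differentiableOn
    exact this.analyticAt z
  have hcont : ContinuousOn (iteratedDeriv k g) {z | H z ≠ 0} := by
    rw [iteratedDeriv_eq_iterate]
    exact (hgan.iterated_deriv k).continuousOn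
  have hK : IsCompact (Set.Icc (1 : ℝ) (3 / 2) ×ℂ Set.Icc (-1 : ℝ) 1) :=
    isCompact_Icc.reProdIm isCompact_Icc
  obtain ⟨C', hC'⟩ := hK.exists_bound_of_continuousOn
    (hcont.mono fun z hz => hH0 z (mem_reProdIm.mp hz).1.1)
  refine ⟨max C C', lt_max_of_lt_left hC, fun s h1 h2 => ?_⟩
  have hsum1 : ∀ s : ℂ, 1 < s.re → LSeriesSummable
      (fun n => (ArithmeticFunction.vonMangoldt n : ℂ)) s := fun s hs =>
    ArithmeticFunction.LSeriesSummable_vonMangoldt hs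
  have hsum2 : ∀ s : ℂ, 1 < s.re → LSeriesSummable 1 s := fun s hs =>
    LSeriesSummable_one_iff.mpr hs
  rw [iteratedDeriv_LSeries_eq (abscissaOfAbsConv_le_one_of_summable fun s hs =>
    (hsum1 s hs).sub (hsum2 s hs)) k h1]
  have hser : ∀ z : ℂ, 1 < z.re → LSeries ((fun n => (ArithmeticFunction.vonMangoldt n : ℂ)) - 1) z
      = -(logDeriv (LFunction (1 : DirichletCharacter ℂ 1)) z +
        1 * LFunction (1 : DirichletCharacter ℂ 1) z) := by
    intro z hz
    rw [LSeries_sub (hsum1 z hz) (hsum2 z hz), logDeriv_LFunction_eq _ hz,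
      LSeries_one_eq_riemannZeta hz, LFunction_modOne_eq]
    have : LSeries (((fun n : ℕ => (1 : DirichletCharacter ℂ 1) n)) *
        fun n => (ArithmeticFunction.vonMangoldt n : ℂ)) z =
        LSeries (fun n => (ArithmeticFunction.vonMangoldt n : ℂ)) z :=
      LSeries_congr (fun {n} _ => by
        simp [Subsingleton.eq_one (n : ZMod 1)]) z
    rw [this]
    ring
  rw [iteratedDeriv_congr_of_one_lt_re hser k h1, iteratedDeriv_fun_neg, norm_neg]
  have hX2 := two_le_analyticSize (q := 1) le_rfl s
  rcases le_or_gt (3 / 4) |s.im| with h3 | h3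
  · refine (h 1 1 1 s (by simp) h1 h2 (Or.inr h3)).trans ?_
    gcongr
    exact le_max_left _ _
  · rw [← iteratedDeriv_congr_of_one_lt_re hg_eq k h1]
    have h4 := hC' s (mem_reProdIm.mpr ⟨⟨h1.le, h2⟩, by constructor <;> linarith [abs_lt.mp h3]⟩)
    have h5 : (1 : ℝ) ≤ analyticSize 1 s ^ (1 / 2 : ℝ) :=
      Real.one_le_rpow (by linarith) (by norm_num)
    calc _ ≤ max C C' * 1 := by rw [mul_one]; exact h4.trans (le_max_right _ _)
      _ ≤ _ := by gcongr

end MontgomeryHooley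

namespace MontgomeryHooley

open Complex MeasureTheory Filter Topology

/-- The kernel `max (1 - t) 0` on `t > 0`. -/
noncomputable def fejerKernel (t : ℝ) : ℂ :=
  Set.indicator (Set.Ioc 0 1) (fun _ => 1 : ℝ → ℂ) t -
    Set.indicator (Set.Ioc 0 1) (fun t => (t : ℂ) ^ (1 : ℂ) : ℝ → ℂ) t

lemma fejerKernel_of_pos {t : ℝ} (ht : 0 < t) : fejerKernel t = ((max (1 - t) 0 : ℝ) : ℂ) := by
  rw [fejerKernel]
  rcases le_or_gt t 1 with h | h
  · have hm : t ∈ Set.Ioc (0 : ℝ) 1 := ⟨ht, h⟩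
    rw [Set.indicator_of_mem hm, Set.indicator_of_mem hm, max_eq_left (by linarith)]
    simp
  · rw [Set.indicator_of_notMem (fun h' => by linarith [h'.2]),
      Set.indicator_of_notMem (fun h' => by linarith [h'.2]), max_eq_right (by linarith)]
    simp

lemma hasMellin_fejerKernel {s : ℂ} (hs : 0 < s.re) :
    HasMellin fejerKernel s (1 / s - 1 / (s + 1)) := by
  have h1 := hasMellin_one_Ioc hs
  have h2 := hasMellin_cpow_Ioc 1 (s := s) (by simp; linarith)
  have := hasMellin_sub h1.1 h2.1
  rw [h1.2, h2.2] at this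
  exact this

lemma continuousAt_fejerKernel {t : ℝ} (ht : 0 < t) : ContinuousAt fejerKernel t := by
  have h : ContinuousAt (fun t : ℝ => ((max (1 - t) 0 : ℝ) : ℂ)) t :=
    Continuous.continuousAt (by fun_prop)
  refine h.congr ?_
  filter_upwards [lt_mem_nhds ht] with u hu
  exact (fejerKernel_of_pos hu).symm

lemma norm_mellin_kernel_le {σ : ℝ} (hσ : 1 ≤ σ) (t : ℝ) :
    ‖(1 / ((σ : ℂ) + t * I) - 1 / ((σ : ℂ) + t * I + 1))‖ ≤ 4 * (1 + ‖t‖) ^ (-(2 : ℝ)) := by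
  have hre : ((σ : ℂ) + t * I).re = σ := by simp
  have hre1 : ((σ : ℂ) + t * I + 1).re = σ + 1 := by simp
  have him : ((σ : ℂ) + t * I).im = t := by simp
  have him1 : ((σ : ℂ) + t * I + 1).im = t := by simp
  have h1 := Complex.abs_re_le_norm ((σ : ℂ) + t * I)
  have h2 := Complex.abs_im_le_norm ((σ : ℂ) + t * I)
  have h3 := Complex.abs_re_le_norm ((σ : ℂ) + t * I + 1)
  have h4 := Complex.abs_im_le_norm ((σ : ℂ) + t * I + 1)
  rw [hre, abs_of_pos (by linarith)] at h1
  rw [hre1, abs_of_pos (by linarith)] at h3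
  rw [him] at h2
  rw [him1] at h4
  set z := (σ : ℂ) + t * I
  have hz : z ≠ 0 := by rw [← norm_pos_iff]; linarith
  have hz1 : z + 1 ≠ 0 := by rw [← norm_pos_iff]; linarith
  have e : 1 / z - 1 / (z + 1) = 1 / (z * (z + 1)) := by field_simp; ring
  rw [e, norm_div, norm_mul, norm_one, Real.norm_eq_abs, Real.rpow_neg (by positivity), ← div_eq_mul_inv,
    div_le_div_iff₀ (by positivity) (by positivity)]
  norm_cast
  have a1 : (1 + |t|) / 2 ≤ ‖z‖ := by linarith
  have a2 : (1 + |t|) / 2 ≤ ‖z + 1‖ := by linarith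
  nlinarith [abs_nonneg t, mul_le_mul a1 a2 (by positivity) (by positivity)]

lemma integrable_mellin_kernel {σ : ℝ} (hσ : 1 ≤ σ) :
    Integrable fun t : ℝ => (1 / ((σ : ℂ) + t * I) - 1 / ((σ : ℂ) + t * I + 1)) := by
  refine Integrable.mono' ((integrable_one_add_norm (E := ℝ) (μ := volume) (r := 2)
    (by simp)).const_mul 4) ?_ (ae_of_all _ fun t => norm_mellin_kernel_le hσ t)
  refine Continuous.aestronglyMeasurable ?_
  have h : ∀ t : ℝ, (σ : ℂ) + t * I ≠ 0 := fun t h => by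
    have := congrArg Complex.re h
    simp at this; linarith
  have h1 : ∀ t : ℝ, (σ : ℂ) + t * I + 1 ≠ 0 := fun t h => by
    have := congrArg Complex.re h
    simp at this; linarith
  fun_prop (disch := assumption)

lemma integral_kernel_eq {σ y : ℝ} (hσ : 1 ≤ σ) (hy : 0 < y) :
    ∫ t : ℝ, (y : ℂ) ^ (-((σ : ℂ) + t * I)) *
      (1 / ((σ : ℂ) + t * I) - 1 / ((σ : ℂ) + t * I + 1)) =
      (2 * Real.pi * max (1 - y) 0 : ℝ) := by
  have hm : ∀ t : ℝ, mellin fejerKernel ((σ : ℂ) + t * I) =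
      1 / ((σ : ℂ) + t * I) - 1 / ((σ : ℂ) + t * I + 1) := fun t =>
    (hasMellin_fejerKernel (by simp; linarith)).2
  have h := mellinInv_mellin_eq σ fejerKernel hy (hasMellin_fejerKernel (by simp; linarith)).1
    (by
      rw [VerticalIntegrable]
      simp_rw [hm]
      exact integrable_mellin_kernel hσ) (continuousAt_fejerKernel hy)
  rw [mellinInv, fejerKernel_of_pos hy] at h
  simp_rw [hm, smul_eq_mul] at h
  rw [one_div, inv_smul_eq_iff₀ (by positivity)] at h
  rw [h]
  push_cast
  simp

/-- A smoothed Perron bound. -/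
theorem norm_sum_mul_one_sub_le : ∃ C : ℝ, 0 < C ∧ ∀ (a : ℕ → ℂ) (σ x M : ℝ), 1 ≤ σ → 0 < x →
    LSeriesSummable a σ →
    (∀ t : ℝ, ‖LSeries a (σ + t * I)‖ ≤ M * (1 + |t|) ^ (1 / 2 : ℝ)) →
    ‖∑ n ∈ Icc 1 ⌊x⌋₊, a n * (1 - n / x)‖ ≤ C * M * x ^ σ := by
  set J := ∫ t : ℝ, (1 + ‖t‖) ^ (-(3 / 2) : ℝ) with hJ
  have hJint : Integrable fun t : ℝ => (1 + ‖t‖) ^ (-(3 / 2) : ℝ) :=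
    integrable_one_add_norm (by norm_num)
  refine ⟨4 * J + 1, by positivity, ?_⟩
  intro a σ x M hσ hx hsum hM
  have hM0 : 0 ≤ M := by simpa using (norm_nonneg _).trans (hM 0)
  set w : ℝ → ℂ := fun t => 1 / ((σ : ℂ) + t * I) - 1 / ((σ : ℂ) + t * I + 1) with hw
  have hwint : Integrable w := integrable_mellin_kernel hσ
  set F : ℕ → ℝ → ℂ := fun n t => LSeries.term a (σ + t * I) n *
    ((x : ℂ) ^ ((σ : ℂ) + t * I) * w t) with hF
  have hxc : (x : ℂ) ≠ 0 := by exact_mod_cast hx.ne'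
  have hFeq : ∀ n : ℕ, n ≠ 0 → F n = fun t : ℝ =>
      a n * ((((n : ℝ) / x : ℝ) : ℂ) ^ (-((σ : ℂ) + t * I)) * w t) := by
    intro n hn
    ext t
    have hn' : (0 : ℝ) < n := by exact_mod_cast Nat.pos_of_ne_zero hn
    rw [hF]
    simp only
    rw [LSeries.term_of_ne_zero hn, div_eq_mul_inv (n : ℝ) x, Complex.ofReal_mul,
      Complex.mul_cpow_ofReal_nonneg hn'.le (by positivity), Complex.ofReal_inv,
      Complex.inv_cpow _ _ (by rw [Complex.arg_ofReal_of_nonneg hx.le]; exact Real.pi_ne_zero.symm),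
      cpow_neg, cpow_neg, inv_inv, div_eq_mul_inv]
    push_cast
    ring
  have hnorm : ∀ n t, ‖F n t‖ = ‖LSeries.term a σ n‖ * x ^ σ * ‖w t‖ := by
    intro n t
    rw [hF]
    simp only
    rw [norm_mul, norm_mul, Complex.norm_cpow_eq_rpow_re_of_pos hx, LSeries.norm_term_eq,
      LSeries.norm_term_eq]
    simp [mul_assoc]
  have hFint : ∀ n, Integrable (F n) := by
    intro n
    refine Integrable.mono' (hwint.norm.const_mul (‖LSeries.term a σ n‖ * x ^ σ)) ?_
      (ae_of_all _ fun t => (hnorm n t).le)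
    refine AEStronglyMeasurable.mul ?_ (AEStronglyMeasurable.mul ?_ hwint.1)
    · refine Continuous.aestronglyMeasurable ?_
      rcases eq_or_ne n 0 with rfl | hn
      · simp only [LSeries.term_zero]; fun_prop
      · simp only [LSeries.term_of_ne_zero hn]
        have hn' : (n : ℂ) ≠ 0 := by exact_mod_cast hn
        refine continuous_const.div ?_ fun t => ?_
        · exact Continuous.const_cpow (by fun_prop) (Or.inl hn')
        · simp [cpow_eq_zero_iff, hn']
    · exact (Continuous.const_cpow (by fun_prop) (Or.inl hxc)).aestronglyMeasurable
  have hs := hasSum_integral_of_summable_integral_norm hFint (by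
    simp_rw [hnorm, integral_const_mul]
    exact (hsum.norm.mul_right _).mul_right _)
  have h_int : ∀ n, ∫ t, F n t = if n ∈ Icc 1 ⌊x⌋₊ then a n * (1 - n / x) * (2 * Real.pi) else 0 := by
    intro n
    rcases eq_or_ne n 0 with rfl | hn
    · simp [hF]
    · have hn' : (0 : ℝ) < n := by exact_mod_cast Nat.pos_of_ne_zero hn
      rw [hFeq n hn, integral_const_mul, integral_kernel_eq hσ (by positivity)]
      simp only [Finset.mem_Icc, Nat.le_floor_iff hx.le, Nat.one_le_iff_ne_zero, ne_eq, hn,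
        not_false_eq_true, true_and]
      split_ifs with h
      · rw [max_eq_left (by rw [sub_nonneg, div_le_one hx]; exact h)]
        push_cast; ring
      · rw [max_eq_right (by
          rw [sub_nonpos, one_le_div hx]; linarith)]
        simp
  simp_rw [h_int] at hs
  have heq := hs.unique (hasSum_sum_of_ne_finset_zero (s := Icc 1 ⌊x⌋₊) fun n hn => if_neg hn)
  rw [Finset.sum_congr rfl fun n hn => if_pos hn, ← Finset.sum_mul] at heq
  have hbound : ‖∫ t, ∑' n, F n t‖ ≤ 4 * J * M * x ^ σ := by
    calc ‖∫ t, ∑' n, F n t‖ ≤ ∫ t : ℝ, 4 * M * x ^ σ * (1 + ‖t‖) ^ (-(3 / 2) : ℝ) := by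
          refine norm_integral_le_of_norm_le (hJint.const_mul _) (ae_of_all _ fun t => ?_)
          have : ∑' n, F n t = LSeries a (σ + t * I) * ((x : ℂ) ^ ((σ : ℂ) + t * I) * w t) := by
            rw [LSeries, ← tsum_mul_right]
          rw [this, norm_mul, norm_mul, Complex.norm_cpow_eq_rpow_re_of_pos hx,
            show ((σ : ℂ) + t * I).re = σ by simp]
          have h1 := hM t
          have h2 := norm_mellin_kernel_le hσ t
          have h3 : (1 + ‖t‖) ^ (-(3 / 2) : ℝ) =
              (1 + |t|) ^ (1 / 2 : ℝ) * (1 + ‖t‖) ^ (-(2 : ℝ)) := by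
            rw [Real.norm_eq_abs, ← Real.rpow_add (by positivity)]; norm_num
          calc _ ≤ M * (1 + |t|) ^ (1 / 2 : ℝ) * (x ^ σ * (4 * (1 + ‖t‖) ^ (-(2 : ℝ)))) := by
                gcongr
            _ = _ := by rw [h3]; ring
      _ = _ := by rw [integral_const_mul]; ring
  rw [heq, norm_mul] at hbound
  have hpi : (1 : ℝ) ≤ ‖(2 * Real.pi : ℂ)‖ := by
    rw [norm_mul, Complex.norm_real, Real.norm_eq_abs, abs_of_pos Real.pi_pos]
    simp
    linarith [Real.pi_gt_three]
  calc _ ≤ _ * ‖(2 * Real.pi : ℂ)‖ := le_mul_of_one_le_right (norm_nonneg _) hpi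
    _ ≤ 4 * J * M * x ^ σ := hbound
    _ ≤ _ := by gcongr; linarith

end MontgomeryHooley

namespace MontgomeryHooley

open Complex MeasureTheory Filter Topology DirichletCharacter
open ArithmeticFunction (vonMangoldt)

lemma iterate_logMul_apply (a : ℕ → ℂ) (k n : ℕ) :
    LSeries.logMul^[k] a n = (Real.log n : ℂ) ^ k * a n := by
  induction k with
  | zero => simp
  | succ k ih =>
    rw [Function.iterate_succ_apply', LSeries.logMul, ih, pow_succ', Complex.ofReal_log (by positivity)]
    push_cast
    ring

lemma exists_log_pow_le (m : ℕ) : ∃ C : ℝ, 0 < C ∧ ∀ y : ℝ, 1 ≤ y → Real.log y ^ m ≤ C * y := by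
  rcases Nat.eq_zero_or_pos m with rfl | hm
  · exact ⟨1, one_pos, fun y hy => by simpa using hy⟩
  · have hm' : (0 : ℝ) < m := by exact_mod_cast hm
    refine ⟨(m : ℝ) ^ m, by positivity, fun y hy => ?_⟩
    have h := Real.log_le_rpow_div (x := y) (by linarith) (ε := 1 / m) (by positivity)
    calc Real.log y ^ m ≤ (y ^ (1 / m : ℝ) / (1 / m)) ^ m :=
          pow_le_pow_left₀ (Real.log_nonneg hy) h m
      _ = (m : ℝ) ^ m * y := by
          rw [div_pow, ← Real.rpow_mul_natCast (by linarith), one_div_mul_cancel hm'.ne',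
            Real.rpow_one, one_div, inv_pow, div_inv_eq_mul, mul_comm]

lemma sum_logPow_mul_one_sub_le {a : ℕ → ℂ} {k : ℕ} {M C : ℝ}
    (ha : ∀ s : ℂ, 1 < s.re → LSeriesSummable a s) (hC : ∀ (a : ℕ → ℂ) (σ x M : ℝ), 1 ≤ σ → 0 < x →
      LSeriesSummable a σ → (∀ t : ℝ, ‖LSeries a (σ + t * I)‖ ≤ M * (1 + |t|) ^ (1 / 2 : ℝ)) →
      ‖∑ n ∈ Icc 1 ⌊x⌋₊, a n * (1 - n / x)‖ ≤ C * M * x ^ σ)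
    (hM : ∀ s : ℂ, 1 < s.re → s.re ≤ 3 / 2 →
      ‖LSeries (LSeries.logMul^[k] a) s‖ ≤ M * (1 + |s.im|) ^ (1 / 2 : ℝ)) {x : ℝ} (hx : 8 ≤ x) :
    ‖∑ n ∈ Icc 1 ⌊x⌋₊, (Real.log n : ℂ) ^ k * a n * (1 - n / x)‖ ≤ C * M * (3 * x) := by
  have hlog : 2 ≤ Real.log x := by
    rw [Real.le_log_iff_exp_le (by linarith)]
    have := Real.exp_one_lt_d9
    have h2 : Real.exp 2 = Real.exp 1 * Real.exp 1 := by rw [← Real.exp_add]; norm_num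
    rw [h2]
    nlinarith [Real.exp_pos 1]
  have hx0 : 0 < x := by linarith
  set σ : ℝ := 1 + 1 / Real.log x with hσ
  have hσ1 : 1 < σ := by rw [hσ]; linarith [one_div_pos.mpr (show 0 < Real.log x by linarith)]
  have hσ2 : σ ≤ 3 / 2 := by
    have : 1 / Real.log x ≤ 1 / 2 := one_div_le_one_div_of_le (by norm_num) hlog
    linarith
  have hxσ : x ^ σ = x * Real.exp 1 := by
    rw [hσ, Real.rpow_add hx0, Real.rpow_one, Real.rpow_def_of_pos hx0, mul_one_div_cancel (by linarith)]
  have hsum : LSeriesSummable (LSeries.logMul^[k] a) σ := by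
    refine LSeriesSummable_of_abscissaOfAbsConv_lt_re ?_
    rw [LSeries.absicssaOfAbsConv_logPowMul]
    refine (abscissaOfAbsConv_le_one_of_summable ha).trans_lt ?_
    rw [Complex.ofReal_re]
    exact_mod_cast hσ1
  have := hC (LSeries.logMul^[k] a) σ x M hσ1.le hx0 hsum fun t => by
    have := hM (σ + t * I) (by simpa using hσ1) (by simpa using hσ2)
    simpa using this
  simp_rw [iterate_logMul_apply] at this
  refine this.trans ?_
  have hM0 : 0 ≤ M := by
    have := (norm_nonneg _).trans (hM (3 / 2) (by norm_num) (by norm_num))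
    simpa using this
  have hC0 : 0 ≤ C * M := by
    have := (norm_nonneg _).trans (hC (LSeries.logMul^[k] a) σ x M hσ1.le hx0 hsum fun t => by
      have := hM (σ + t * I) (by simpa using hσ1) (by simpa using hσ2)
      simpa using this)
    exact nonneg_of_mul_nonneg_left this (by positivity)
  rw [hxσ]
  have := Real.exp_one_lt_d9
  refine mul_le_mul_of_nonneg_left ?_ hC0
  nlinarith

lemma analyticSize_rpow_half_le {q : ℕ} (hq : 1 ≤ q) (s : ℂ) :
    analyticSize q s ^ (1 / 2 : ℝ) ≤ 2 * q * (1 + |s.im|) ^ (1 / 2 : ℝ) := by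
  have hq' : (1 : ℝ) ≤ q := by exact_mod_cast hq
  have h0 := abs_nonneg s.im
  calc analyticSize q s ^ (1 / 2 : ℝ) ≤ ((2 * q) ^ 2 * (1 + |s.im|)) ^ (1 / 2 : ℝ) := by
        refine Real.rpow_le_rpow (by rw [analyticSize]; positivity) ?_ (by norm_num)
        rw [analyticSize]
        nlinarith [mul_nonneg (sub_nonneg.mpr hq') h0, mul_nonneg (sub_nonneg.mpr hq') (sub_nonneg.mpr hq')]
    _ = _ := by
        rw [Real.mul_rpow (by positivity) (by positivity), ← Real.sqrt_eq_rpow,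
          Real.sqrt_sq (by positivity)]

theorem sum_vonMangoldt_char_smooth_le (k : ℕ) : ∃ C : ℝ, 0 < C ∧ ∀ (q : ℕ) [NeZero q]
    (χ : DirichletCharacter ℂ q) (x : ℝ), χ ≠ 1 → 8 ≤ x →
    ‖∑ n ∈ Icc 1 ⌊x⌋₊, (Real.log n : ℂ) ^ k * (χ n * vonMangoldt n) * (1 - n / x)‖ ≤
      C * q * x := by
  obtain ⟨C, hC, h⟩ := norm_sum_mul_one_sub_le
  obtain ⟨D, hD, h'⟩ := norm_LSeries_logMul_le_of_ne_one k
  refine ⟨C * (D * 2) * 3, by positivity, fun q _ χ x hχ hx => ?_⟩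
  have := sum_logPow_mul_one_sub_le (k := k) (M := D * (2 * q)) (C := C)
    (a := (fun n : ℕ => χ n) * fun n => (vonMangoldt n : ℂ))
    (fun s hs => LSeriesSummable_twist_vonMangoldt χ hs) h (fun s h1 h2 => by
      refine (h' q χ s hχ h1 h2).trans ?_
      rw [mul_assoc]
      exact mul_le_mul_of_nonneg_left (analyticSize_rpow_half_le (NeZero.pos q) s) hD.le) hx
  refine this.trans (le_of_eq (by ring))

theorem sum_vonMangoldt_smooth_le (k : ℕ) : ∃ C : ℝ, 0 < C ∧ ∀ x : ℝ, 8 ≤ x →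
    ‖∑ n ∈ Icc 1 ⌊x⌋₊, (Real.log n : ℂ) ^ k * (vonMangoldt n - 1) * (1 - n / x)‖ ≤ C * x := by
  obtain ⟨C, hC, h⟩ := norm_sum_mul_one_sub_le
  obtain ⟨D, hD, h'⟩ := norm_LSeries_logMul_vonMangoldt_sub_one_le k
  refine ⟨C * (D * 2) * 3, by positivity, fun x hx => ?_⟩
  have := sum_logPow_mul_one_sub_le (k := k) (M := D * 2) (C := C)
    (a := (fun n => (vonMangoldt n : ℂ)) - 1)
    (fun s hs => (ArithmeticFunction.LSeriesSummable_vonMangoldt hs).sub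
      (LSeriesSummable_one_iff.mpr hs)) h (fun s h1 h2 => by
      refine (h' s h1 h2).trans ?_
      rw [mul_assoc]
      refine mul_le_mul_of_nonneg_left ?_ hD.le
      simpa using analyticSize_rpow_half_le le_rfl s) hx
  refine this.trans (le_of_eq (by ring))

end MontgomeryHooley

namespace MontgomeryHooley

open Complex MeasureTheory Filter Topology DirichletCharacter
open ArithmeticFunction (vonMangoldt)

lemma sum_vonMangoldt_not_coprime_le_card {q : ℕ} (hq : 1 ≤ q) {x : ℝ} (hx : 1 ≤ x) :
    ∑ n ∈ (Icc 1 ⌊x⌋₊).filter (fun n => ¬ n.Coprime q), vonMangoldt n ≤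
      q.primeFactors.card * (2 * Real.log x + 1) * Real.log x := by
  set N := ⌊x⌋₊ with hN
  have hL : 0 ≤ Real.log x := Real.log_nonneg hx
  set S := (Icc 1 N).filter (fun n => ¬ n.Coprime q) with hS
  have h1 : ∑ n ∈ S, vonMangoldt n = ∑ n ∈ S.filter IsPrimePow, vonMangoldt n := by
    rw [Finset.sum_filter (s := S) (p := IsPrimePow)]
    refine Finset.sum_congr rfl fun n hn => ?_
    split_ifs with h
    · rfl
    · rw [ArithmeticFunction.vonMangoldt_apply, if_neg h]
  have h2 : S.filter IsPrimePow ⊆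
      (q.primeFactors ×ˢ range (Nat.log 2 N + 1)).image fun p => p.1 ^ p.2 := by
    intro n hn
    simp only [hS, Finset.mem_filter, Finset.mem_Icc] at hn
    obtain ⟨⟨⟨hn1, hnN⟩, hnq⟩, hpp⟩ := hn
    obtain ⟨p, j, hp, hj, rfl⟩ := (isPrimePow_nat_iff n).mp hpp
    rw [Finset.mem_image]
    refine ⟨(p, j), ?_, rfl⟩
    rw [Finset.mem_product, Finset.mem_range, Nat.lt_succ_iff]
    constructor
    · rw [Nat.mem_primeFactors]
      refine ⟨hp, ?_, by omega⟩
      by_contra h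
      exact hnq (((Nat.Prime.coprime_iff_not_dvd hp).mpr h).pow_left j)
    · refine Nat.le_log_of_pow_le (by norm_num) ?_
      exact (Nat.pow_le_pow_left hp.two_le j).trans hnN
  have h3 : ((S.filter IsPrimePow).card : ℝ) ≤ q.primeFactors.card * (2 * Real.log x + 1) := by
    have hc : (S.filter IsPrimePow).card ≤ q.primeFactors.card * (Nat.log 2 N + 1) := by
      refine (Finset.card_le_card h2).trans (Finset.card_image_le.trans ?_)
      rw [Finset.card_product, Finset.card_range]
    have hlog : (Nat.log 2 N : ℝ) ≤ 2 * Real.log x := by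
      have hN0 : N ≠ 0 := by
        rw [hN]; exact (Nat.floor_pos.mpr hx).ne'
      have : (2 : ℝ) ^ Nat.log 2 N ≤ x := by
        have h := Nat.pow_log_le_self 2 hN0
        calc (2 : ℝ) ^ Nat.log 2 N ≤ (N : ℝ) := by exact_mod_cast h
          _ ≤ x := Nat.floor_le (by linarith)
      have h' := Real.log_le_log (by positivity) this
      rw [Real.log_pow] at h'
      nlinarith [Real.log_two_gt_d9, (Nat.cast_nonneg (Nat.log 2 N) : (0:ℝ) ≤ _)]
    calc ((S.filter IsPrimePow).card : ℝ) ≤ q.primeFactors.card * (Nat.log 2 N + 1) := by exact_mod_cast hc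
      _ ≤ _ := by gcongr
  rw [h1]
  calc _ ≤ ∑ n ∈ S.filter IsPrimePow, Real.log x := by
        refine Finset.sum_le_sum fun n hn => ?_
        simp only [hS, Finset.mem_filter, Finset.mem_Icc] at hn
        refine ArithmeticFunction.vonMangoldt_le_log.trans (Real.log_le_log ?_ ?_)
        · exact_mod_cast hn.1.1.1
        · exact (Nat.le_floor_iff (by linarith)).mp hn.1.1.2
    _ = (S.filter IsPrimePow).card * Real.log x := by rw [Finset.sum_const, nsmul_eq_mul]
    _ ≤ _ := by gcongr

lemma sum_vonMangoldt_not_coprime_le {q : ℕ} (hq : 1 ≤ q) {x : ℝ} (hx : 1 ≤ x) :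
    ∑ n ∈ (Icc 1 ⌊x⌋₊).filter (fun n => ¬ n.Coprime q), vonMangoldt n ≤
      q * (2 * Real.log x + 1) * Real.log x := by
  refine (sum_vonMangoldt_not_coprime_le_card hq hx).trans ?_
  have hL : 0 ≤ Real.log x := Real.log_nonneg hx
  have : q.primeFactors.card ≤ q := by
    refine (Finset.card_le_card (t := Icc 1 q) fun p hp => ?_).trans (by simp)
    rw [Finset.mem_Icc]
    exact ⟨(Nat.prime_of_mem_primeFactors hp).one_lt.le, Nat.le_of_mem_primeFactors hp⟩
  gcongr

theorem sum_vonMangoldt_ap_smooth_le (k : ℕ) : ∃ C : ℝ, 0 < C ∧ ∀ (q a : ℕ) (x : ℝ), 1 ≤ q →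
    a.Coprime q → 8 ≤ x →
    |∑ n ∈ Icc 1 ⌊x⌋₊, (if n % q = a % q then vonMangoldt n else 0) * Real.log n ^ k * (x - n) -
      ∑ n ∈ Icc 1 ⌊x⌋₊, (1 / (q.totient : ℝ)) * Real.log n ^ k * (x - n)| ≤ C * q * x ^ 2 := by
  obtain ⟨C₁, hC₁, h₁⟩ := sum_vonMangoldt_char_smooth_le k
  obtain ⟨C₂, hC₂, h₂⟩ := sum_vonMangoldt_smooth_le k
  obtain ⟨C₃, hC₃, h₃⟩ := exists_log_pow_le (k + 1)
  obtain ⟨C₄, hC₄, h₄⟩ := exists_log_pow_le (k + 2)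
  refine ⟨C₁ + C₂ + 2 * C₄ + C₃, by positivity, fun q a x hq ha hx => ?_⟩
  have : NeZero q := ⟨by omega⟩
  have hx0 : 0 < x := by linarith
  have hL : 0 ≤ Real.log x := Real.log_nonneg (by linarith)
  set φ : ℝ := (q.totient : ℝ) with hφ
  have hφ1 : 1 ≤ φ := by
    rw [hφ]; exact_mod_cast Nat.totient_pos.mpr hq
  have hφ0 : 0 < φ := by linarith
  set N := ⌊x⌋₊ with hN
  set w : ℕ → ℝ := fun n => Real.log n ^ k * (1 - n / x) with hw
  have hw0 : ∀ n ∈ Icc 1 N, 0 ≤ w n ∧ w n ≤ Real.log x ^ k := by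
    intro n hn
    rw [Finset.mem_Icc, hN, Nat.le_floor_iff hx0.le] at hn
    have h1 : (1 : ℝ) ≤ n := by exact_mod_cast hn.1
    have h2 : (n : ℝ) / x ≤ 1 := (div_le_one hx0).mpr hn.2
    have h3 : 0 ≤ (n : ℝ) / x := by positivity
    have h4 : Real.log n ^ k ≤ Real.log x ^ k :=
      pow_le_pow_left₀ (Real.log_nonneg h1) (Real.log_le_log (by linarith) hn.2) k
    have h5 : 0 ≤ Real.log n ^ k := pow_nonneg (Real.log_nonneg h1) k
    constructor
    · exact mul_nonneg h5 (by linarith)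
    · calc w n ≤ Real.log n ^ k * 1 := mul_le_mul_of_nonneg_left (by linarith) h5
        _ ≤ _ := by rw [mul_one]; exact h4
  set T : DirichletCharacter ℂ q → ℂ := fun χ => ∑ n ∈ Icc 1 N, χ n * (vonMangoldt n * w n : ℝ)
    with hT
  have hTχ : ∀ χ, χ ≠ 1 → ‖T χ‖ ≤ C₁ * q * x := by
    intro χ hχ
    refine le_trans (le_of_eq ?_) (h₁ q χ x hχ hx)
    congr 1
    refine Finset.sum_congr rfl fun n _ => ?_
    rw [hw]; push_cast; ring
  have hT1 : ‖T 1 - ∑ n ∈ Icc 1 N, (w n : ℂ)‖ ≤ (C₂ + 2 * C₄ + C₃) * q * x := by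
    have e1 : T 1 = ∑ n ∈ Icc 1 N, ((vonMangoldt n * w n : ℝ) : ℂ) -
        ((∑ n ∈ (Icc 1 N).filter (fun n => ¬ n.Coprime q), vonMangoldt n * w n : ℝ) : ℂ) := by
      rw [Complex.ofReal_sum, Finset.sum_filter, ← Finset.sum_sub_distrib]
      refine Finset.sum_congr rfl fun n _ => ?_
      by_cases h : n.Coprime q
      · rw [MulChar.one_apply ((ZMod.isUnit_iff_coprime n q).mpr h)]
        simp [h]
      · rw [MulChar.map_nonunit _ (mt (ZMod.isUnit_iff_coprime n q).mp h)]
        simp [h]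
    have e2 : ‖∑ n ∈ Icc 1 N, ((vonMangoldt n * w n : ℝ) : ℂ) - ∑ n ∈ Icc 1 N, (w n : ℂ)‖ ≤
        C₂ * x := by
      refine le_trans (le_of_eq ?_) (h₂ x hx)
      rw [← Finset.sum_sub_distrib]
      congr 1
      refine Finset.sum_congr rfl fun n _ => ?_
      rw [hw]; push_cast; ring
    have e3 : ‖((∑ n ∈ (Icc 1 N).filter (fun n => ¬ n.Coprime q), vonMangoldt n * w n : ℝ) : ℂ)‖ ≤
        (2 * C₄ + C₃) * q * x := by
      rw [Complex.norm_real, Real.norm_eq_abs, abs_of_nonneg (Finset.sum_nonneg fun n hn =>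
        mul_nonneg ArithmeticFunction.vonMangoldt_nonneg (hw0 n (Finset.mem_filter.mp hn).1).1)]
      calc _ ≤ ∑ n ∈ (Icc 1 N).filter (fun n => ¬ n.Coprime q), vonMangoldt n * Real.log x ^ k := by
            refine Finset.sum_le_sum fun n hn => ?_
            exact mul_le_mul_of_nonneg_left (hw0 n (Finset.mem_filter.mp hn).1).2
              ArithmeticFunction.vonMangoldt_nonneg
        _ ≤ q * (2 * Real.log x + 1) * Real.log x * Real.log x ^ k := by
            rw [← Finset.sum_mul]
            exact mul_le_mul_of_nonneg_right (sum_vonMangoldt_not_coprime_le hq (by linarith))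
              (by positivity)
        _ = q * (2 * Real.log x ^ (k + 2) + Real.log x ^ (k + 1)) := by ring
        _ ≤ q * (2 * (C₄ * x) + C₃ * x) := by
            gcongr
            · exact h₄ x (by linarith)
            · exact h₃ x (by linarith)
        _ = _ := by ring
    have hq' : (1 : ℝ) ≤ q := by exact_mod_cast hq
    calc _ = ‖(∑ n ∈ Icc 1 N, ((vonMangoldt n * w n : ℝ) : ℂ) - ∑ n ∈ Icc 1 N, (w n : ℂ)) -
          ((∑ n ∈ (Icc 1 N).filter (fun n => ¬ n.Coprime q), vonMangoldt n * w n : ℝ) : ℂ)‖ := by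
          rw [e1]; congr 1; ring
      _ ≤ C₂ * x + (2 * C₄ + C₃) * q * x := (norm_sub_le _ _).trans (add_le_add e2 e3)
      _ ≤ _ := by nlinarith [mul_pos hC₂ hx0]
  have hau : IsUnit (a : ZMod q) := (ZMod.isUnit_iff_coprime a q).mpr ha
  have horth : ∑ χ : DirichletCharacter ℂ q, χ (a : ZMod q)⁻¹ * T χ =
      φ * ((∑ n ∈ Icc 1 N, (if n % q = a % q then vonMangoldt n else 0) * w n : ℝ) : ℂ) := by
    simp_rw [hT, Finset.mul_sum, ← mul_assoc]
    rw [Finset.sum_comm]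
    rw [Complex.ofReal_sum, Finset.mul_sum]
    refine Finset.sum_congr rfl fun n _ => ?_
    rw [← Finset.sum_mul, sum_char_inv_mul_char_eq ℂ hau]
    have hiff : ((a : ZMod q) = n) ↔ n % q = a % q := by
      rw [ZMod.natCast_eq_natCast_iff', eq_comm]
    by_cases h : n % q = a % q
    · rw [if_pos (hiff.mpr h), if_pos h]; simp [hφ]
    · rw [if_neg (mt hiff.mp h), if_neg h]; simp
  have hsum : ‖∑ χ : DirichletCharacter ℂ q, χ (a : ZMod q)⁻¹ * T χ - ∑ n ∈ Icc 1 N, (w n : ℂ)‖ ≤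
      φ * ((C₁ + C₂ + 2 * C₄ + C₃) * q * x) := by
    classical
    have hinv : (1 : DirichletCharacter ℂ q) (a : ZMod q)⁻¹ = 1 := by
      have hu : IsUnit ((a : ZMod q)⁻¹) :=
        ⟨hau.unit⁻¹, by rw [← ZMod.inv_coe_unit, IsUnit.unit_spec]⟩
      exact MulChar.one_apply hu
    have hcard : ((Finset.univ : Finset (DirichletCharacter ℂ q)).card : ℝ) = φ := by
      rw [Finset.card_univ, ← Nat.card_eq_fintype_card,
        DirichletCharacter.card_eq_totient_of_hasEnoughRootsOfUnity ℂ q]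
    have hq' : (1 : ℝ) ≤ q := by exact_mod_cast hq
    rw [← Finset.add_sum_erase _ _ (Finset.mem_univ (1 : DirichletCharacter ℂ q)), hinv, one_mul]
    calc _ = ‖(T 1 - ∑ n ∈ Icc 1 N, (w n : ℂ)) + ∑ χ ∈ Finset.univ.erase
            (1 : DirichletCharacter ℂ q), χ (a : ZMod q)⁻¹ * T χ‖ := by congr 1; ring
      _ ≤ (C₂ + 2 * C₄ + C₃) * q * x + ∑ χ ∈ Finset.univ.erase
            (1 : DirichletCharacter ℂ q), C₁ * q * x := by
          refine (norm_add_le _ _).trans (add_le_add hT1 ?_)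
          refine norm_sum_le_of_le _ fun χ hχ => ?_
          rw [norm_mul]
          calc _ ≤ 1 * (C₁ * q * x) := by
                gcongr
                · exact χ.norm_le_one _
                · exact hTχ χ (Finset.ne_of_mem_erase hχ)
            _ = _ := one_mul _
      _ ≤ (C₂ + 2 * C₄ + C₃) * q * x + φ * (C₁ * q * x) := by
          gcongr
          rw [Finset.sum_const, nsmul_eq_mul]
          gcongr
          rw [← hcard]
          exact_mod_cast Finset.card_le_card (Finset.erase_subset _ _)
      _ ≤ φ * ((C₂ + 2 * C₄ + C₃) * q * x) + φ * (C₁ * q * x) := by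
          refine add_le_add_left (le_mul_of_one_le_left ?_ hφ1) _
          positivity
      _ = _ := by ring
  rw [horth] at hsum
  have hfin : |φ * ∑ n ∈ Icc 1 N, (if n % q = a % q then vonMangoldt n else 0) * w n -
      ∑ n ∈ Icc 1 N, w n| ≤ φ * ((C₁ + C₂ + 2 * C₄ + C₃) * q * x) := by
    rw [← Real.norm_eq_abs, ← Complex.norm_real]
    push_cast at hsum ⊢
    exact hsum
  have e1 : ∑ n ∈ Icc 1 N, (if n % q = a % q then vonMangoldt n else 0) * Real.log n ^ k * (x - n)
      = x * ∑ n ∈ Icc 1 N, (if n % q = a % q then vonMangoldt n else 0) * w n := by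
    rw [Finset.mul_sum]
    refine Finset.sum_congr rfl fun n _ => ?_
    rw [hw]; field_simp
  have e2 : ∑ n ∈ Icc 1 N, (1 / φ) * Real.log n ^ k * (x - n) = x / φ * ∑ n ∈ Icc 1 N, w n := by
    rw [Finset.mul_sum]
    refine Finset.sum_congr rfl fun n _ => ?_
    rw [hw]; field_simp
  rw [e1, e2]
  set A := ∑ n ∈ Icc 1 N, (if n % q = a % q then vonMangoldt n else 0) * w n
  have e3 : x * A - x / φ * ∑ n ∈ Icc 1 N, w n = x / φ * (φ * A - ∑ n ∈ Icc 1 N, w n) := by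
    field_simp
  rw [e3, abs_mul, abs_of_pos (by positivity)]
  calc _ ≤ x / φ * (φ * ((C₁ + C₂ + 2 * C₄ + C₃) * q * x)) := by gcongr
    _ = _ := by field_simp

end MontgomeryHooley

namespace MontgomeryHooley

open Complex MeasureTheory Filter Topology DirichletCharacter
open ArithmeticFunction (vonMangoldt)

lemma mul_sum_le_riesz_sub_le {f : ℕ → ℝ} (hf : ∀ n, 0 ≤ f n) {y h : ℝ} (hy : 0 ≤ y)
    (hh : 0 ≤ h) :
    h * ∑ n ∈ Icc 1 ⌊y⌋₊, f n ≤
        ∑ n ∈ Icc 1 ⌊y + h⌋₊, f n * (y + h - n) - ∑ n ∈ Icc 1 ⌊y⌋₊, f n * (y - n) ∧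
      ∑ n ∈ Icc 1 ⌊y + h⌋₊, f n * (y + h - n) - ∑ n ∈ Icc 1 ⌊y⌋₊, f n * (y - n) ≤
        h * ∑ n ∈ Icc 1 ⌊y + h⌋₊, f n := by
  have hle : ⌊y⌋₊ ≤ ⌊y + h⌋₊ := Nat.floor_mono (by linarith)
  have hsub : Icc 1 ⌊y⌋₊ ⊆ Icc 1 ⌊y + h⌋₊ := Finset.Icc_subset_Icc le_rfl hle
  rw [← Finset.sum_sdiff hsub, ← Finset.sum_sdiff (f := f) hsub]
  have hd : ∀ n ∈ Icc 1 ⌊y + h⌋₊ \ Icc 1 ⌊y⌋₊, 0 ≤ y + h - n ∧ y + h - n ≤ h := by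
    intro n hn
    simp only [Finset.mem_sdiff, Finset.mem_Icc, not_and, not_le] at hn
    have h1 := (Nat.le_floor_iff (by linarith)).mp hn.1.2
    have h2 := (Nat.floor_lt hy).mp (hn.2 hn.1.1)
    constructor <;> linarith
  have e1 : ∑ n ∈ Icc 1 ⌊y⌋₊, f n * (y + h - n) =
      ∑ n ∈ Icc 1 ⌊y⌋₊, f n * (y - n) + h * ∑ n ∈ Icc 1 ⌊y⌋₊, f n := by
    rw [Finset.mul_sum, ← Finset.sum_add_distrib]
    exact Finset.sum_congr rfl fun n _ => by ring
  have e2 : 0 ≤ ∑ n ∈ Icc 1 ⌊y + h⌋₊ \ Icc 1 ⌊y⌋₊, f n * (y + h - n) :=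
    Finset.sum_nonneg fun n hn => mul_nonneg (hf n) (hd n hn).1
  have e3 : ∑ n ∈ Icc 1 ⌊y + h⌋₊ \ Icc 1 ⌊y⌋₊, f n * (y + h - n) ≤
      h * ∑ n ∈ Icc 1 ⌊y + h⌋₊ \ Icc 1 ⌊y⌋₊, f n := by
    rw [Finset.mul_sum]
    refine Finset.sum_le_sum fun n hn => ?_
    rw [mul_comm h]
    exact mul_le_mul_of_nonneg_left (hd n hn).2 (hf n)
  constructor <;> linarith

lemma abs_sum_sub_sum_le_of_riesz {f g : ℕ → ℝ} (hf : ∀ n, 0 ≤ f n) (hg : ∀ n, 0 ≤ g n)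
    {y h E B : ℝ} (hh : 0 < h) (hhy : h ≤ y)
    (hE : ∀ z : ℝ, y - h ≤ z → z ≤ y + h →
      |∑ n ∈ Icc 1 ⌊z⌋₊, f n * (z - n) - ∑ n ∈ Icc 1 ⌊z⌋₊, g n * (z - n)| ≤ E)
    (hB : ∀ n : ℕ, (n : ℝ) ≤ y + h → 1 ≤ n → g n ≤ B) (hB0 : 0 ≤ B) :
    |∑ n ∈ Icc 1 ⌊y⌋₊, f n - ∑ n ∈ Icc 1 ⌊y⌋₊, g n| ≤ (h + 1) * B + 2 * E / h := by
  have key : ∀ z : ℝ, 0 ≤ z → z + h ≤ y + h →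
      ∑ n ∈ Icc 1 ⌊z + h⌋₊, g n - ∑ n ∈ Icc 1 ⌊z⌋₊, g n ≤ (h + 1) * B := by
    intro z hz hzy
    have hle : ⌊z⌋₊ ≤ ⌊z + h⌋₊ := Nat.floor_mono (by linarith)
    have hsub : Icc 1 ⌊z⌋₊ ⊆ Icc 1 ⌊z + h⌋₊ := Finset.Icc_subset_Icc le_rfl hle
    rw [← Finset.sum_sdiff hsub, add_sub_cancel_right]
    have hc : ((Icc 1 ⌊z + h⌋₊ \ Icc 1 ⌊z⌋₊).card : ℝ) ≤ h + 1 := by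
      rw [Finset.card_sdiff_of_subset hsub, Nat.cast_sub (Finset.card_le_card hsub),
        Nat.card_Icc, Nat.card_Icc]
      have h1 := Nat.lt_floor_add_one z
      have h2 := Nat.floor_le (show 0 ≤ z + h by linarith)
      push_cast
      linarith
    calc _ ≤ ∑ n ∈ Icc 1 ⌊z + h⌋₊ \ Icc 1 ⌊z⌋₊, B := by
          refine Finset.sum_le_sum fun n hn => ?_
          have hn' := Finset.mem_Icc.mp (Finset.mem_sdiff.mp hn).1
          exact hB n (((Nat.le_floor_iff (by linarith)).mp hn'.2).trans hzy) hn'.1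
      _ = _ * B := by rw [Finset.sum_const, nsmul_eq_mul]
      _ ≤ _ := by gcongr
  have f1 := mul_sum_le_riesz_sub_le hf (y := y) (by linarith) hh.le
  have g1 := mul_sum_le_riesz_sub_le hg (y := y) (by linarith) hh.le
  have f2 := mul_sum_le_riesz_sub_le hf (y := y - h) (by linarith) hh.le
  have g2 := mul_sum_le_riesz_sub_le hg (y := y - h) (by linarith) hh.le
  have k1 := key y (by linarith) le_rfl
  have k2 := key (y - h) (by linarith) (by linarith)
  rw [sub_add_cancel] at f2 g2 k2
  have E1 := abs_le.mp (hE (y + h) (by linarith) le_rfl)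
  have E2 := abs_le.mp (hE y (by linarith) (by linarith))
  have E3 := abs_le.mp (hE (y - h) le_rfl (by linarith))
  have k1' := mul_le_mul_of_nonneg_left k1 hh.le
  have k2' := mul_le_mul_of_nonneg_left k2 hh.le
  have hd : 2 * E / h * h = 2 * E := div_mul_cancel₀ _ hh.ne'
  rw [abs_le]
  constructor
  · refine le_of_mul_le_mul_left ?_ hh
    nlinarith
  · refine le_of_mul_le_mul_left ?_ hh
    nlinarith

theorem sum_vonMangoldt_ap_log_le (K : ℕ) : ∃ C : ℝ, 0 < C ∧ ∀ (q a : ℕ) (y : ℝ), 1 ≤ q →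
    a.Coprime q → 16 ≤ y →
    |∑ n ∈ Icc 1 ⌊y⌋₊, ((if n % q = a % q then vonMangoldt n else 0) - 1 / (q.totient : ℝ)) *
      Real.log n ^ (2 * K)| ≤ C * q * y * Real.log y ^ K := by
  obtain ⟨C₁, hC₁, h₁⟩ := sum_vonMangoldt_ap_smooth_le (2 * K)
  obtain ⟨C₂, hC₂, h₂⟩ := exists_log_pow_le (2 * K)
  refine ⟨2 ^ (2 * K) * (1 + C₂) + 16 * C₁, by positivity, fun q a y hq ha hy => ?_⟩
  have hy0 : 0 < y := by linarith
  have hL : 1 ≤ Real.log y := by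
    rw [Real.le_log_iff_exp_le hy0]
    linarith [Real.exp_one_lt_d9]
  set L := Real.log y with hLdef
  have hLK : 1 ≤ L ^ K := one_le_pow₀ hL
  set h := y / (2 * L ^ K) with hh
  have hh0 : 0 < h := by positivity
  have hh2 : h ≤ y / 2 := by
    rw [hh]
    gcongr
    linarith
  have hφ1 : (1 : ℝ) ≤ q.totient := by exact_mod_cast Nat.totient_pos.mpr hq
  have hq' : (1 : ℝ) ≤ q := by exact_mod_cast hq
  have main := abs_sum_sub_sum_le_of_riesz
    (f := fun n => (if n % q = a % q then vonMangoldt n else 0) * Real.log n ^ (2 * K))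
    (g := fun n => (1 / (q.totient : ℝ)) * Real.log n ^ (2 * K))
    (y := y) (h := h) (E := C₁ * q * (2 * y) ^ 2) (B := (2 * L) ^ (2 * K)) ?_ ?_ hh0
    (by linarith) ?_ ?_ (by positivity)
  · rw [← Finset.sum_sub_distrib] at main
    calc _ = _ := by
          congr 1
          exact Finset.sum_congr rfl fun n _ => by rw [sub_mul]
      _ ≤ _ := main
      _ = 2 ^ (2 * K) * (y * L ^ K / 2 + L ^ (2 * K)) + 16 * C₁ * q * y * L ^ K := by
          rw [hh]
          field_simp
          ring
      _ ≤ 2 ^ (2 * K) * (q * y * L ^ K + C₂ * q * y * L ^ K) + 16 * C₁ * q * y * L ^ K := by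
          have i1 : y * L ^ K / 2 ≤ q * y * L ^ K := by
            have : 0 < y * L ^ K := by positivity
            nlinarith
          have i2 : L ^ (2 * K) ≤ C₂ * q * y * L ^ K := by
            have h' := h₂ y (by linarith)
            have : C₂ * y ≤ C₂ * q * y * L ^ K := by
              calc C₂ * y = C₂ * 1 * y * 1 := by ring
                _ ≤ _ := by gcongr
            exact h'.trans this
          gcongr
      _ = _ := by ring
  · intro n
    split_ifs
    · exact mul_nonneg ArithmeticFunction.vonMangoldt_nonneg
        (pow_nonneg (Real.log_natCast_nonneg n) _)
    · simp
  · intro n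
    exact mul_nonneg (by positivity) (pow_nonneg (Real.log_natCast_nonneg n) _)
  · intro z hz1 hz2
    refine (h₁ q a z hq ha (by linarith)).trans ?_
    have : 0 ≤ z := by linarith
    gcongr
    linarith
  · intro n hn hn1
    have h1 : (1 : ℝ) ≤ n := by exact_mod_cast hn1
    calc (1 / (q.totient : ℝ)) * Real.log n ^ (2 * K) ≤ 1 * Real.log n ^ (2 * K) := by
          gcongr
          exact (div_le_one (by linarith)).mpr hφ1
      _ ≤ (2 * L) ^ (2 * K) := by
          rw [one_mul]
          refine pow_le_pow_left₀ (Real.log_natCast_nonneg n) ?_ _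
          calc Real.log n ≤ Real.log (y ^ 2) :=
                Real.log_le_log (by linarith) (by nlinarith)
            _ = 2 * L := by rw [Real.log_pow]; push_cast; ring

lemma abs_sum_antitone_mul_le {w c : ℕ → ℝ} {s N : ℕ} {B : ℝ} (hsN : s ≤ N)
    (hw : ∀ n, s ≤ n → 0 ≤ w n ∧ w (n + 1) ≤ w n)
    (hB : ∀ m, s ≤ m → m ≤ N → |∑ n ∈ Ioc s m, c n| ≤ B) :
    |∑ n ∈ Ioc s N, w n * c n| ≤ B * w s := by
  have key : ∀ m, s ≤ m → m ≤ N →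
      |∑ n ∈ Ioc s m, w n * c n - w m * ∑ n ∈ Ioc s m, c n| ≤ B * (w s - w m) := by
    intro m hm
    induction m, hm using Nat.le_induction with
    | base => intro; simp
    | succ m hm ih =>
      intro hmN
      have ih := ih (by omega)
      rw [Finset.sum_Ioc_succ_top hm, Finset.sum_Ioc_succ_top hm]
      have e : ∑ n ∈ Ioc s m, w n * c n + w (m + 1) * c (m + 1) -
          w (m + 1) * (∑ n ∈ Ioc s m, c n + c (m + 1)) =
          (∑ n ∈ Ioc s m, w n * c n - w m * ∑ n ∈ Ioc s m, c n) +
          (w m - w (m + 1)) * ∑ n ∈ Ioc s m, c n := by ring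
      rw [e]
      refine (abs_add_le _ _).trans ?_
      rw [abs_mul, abs_of_nonneg (sub_nonneg.mpr (hw m hm).2)]
      have := mul_le_mul_of_nonneg_left (hB m hm (by omega)) (sub_nonneg.mpr (hw m hm).2)
      linarith
  have h1 := key N hsN le_rfl
  have h2 := hB N hsN le_rfl
  have h3 := (hw N hsN).1
  calc _ = |(∑ n ∈ Ioc s N, w n * c n - w N * ∑ n ∈ Ioc s N, c n) +
        w N * ∑ n ∈ Ioc s N, c n| := by rw [sub_add_cancel]
    _ ≤ B * (w s - w N) + w N * B := by
        refine (abs_add_le _ _).trans (add_le_add h1 ?_)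
        rw [abs_mul, abs_of_nonneg h3]
        gcongr
    _ = _ := by ring

end MontgomeryHooley

namespace MontgomeryHooley

open Complex MeasureTheory Filter Topology DirichletCharacter
open ArithmeticFunction (vonMangoldt)

lemma psi_eq_sum_ite (x : ℝ) (q a : ℕ) :
    psi x q a = ∑ n ∈ Icc 1 ⌊x⌋₊, if n % q = a % q then vonMangoldt n else 0 := by
  rw [psi, Finset.sum_filter]

lemma psi_nonneg (x : ℝ) (q a : ℕ) : 0 ≤ psi x q a :=
  Finset.sum_nonneg fun _ _ => ArithmeticFunction.vonMangoldt_nonneg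

/-- The Siegel–Walfisz theorem, with an error term that is linear in the modulus. -/
theorem abs_psi_sub_div_totient_le (K : ℕ) : ∃ C : ℝ, 0 < C ∧ ∀ (q a : ℕ) (x u : ℝ), 1 ≤ q →
    a.Coprime q → 256 ≤ x → 0 ≤ u → u ≤ x →
    |psi u q a - u / (q.totient : ℝ)| ≤ C * q * x / Real.log x ^ K := by
  obtain ⟨C₁, hC₁, h₁⟩ := sum_vonMangoldt_ap_log_le K
  obtain ⟨C₂, hC₂, h₂⟩ := exists_log_pow_le (K + 1)
  refine ⟨2 ^ (K + 1) * C₂ + 2 * 4 * 2 ^ (K + 1) * C₂ + 2 * C₁ * 4 ^ K, by positivity,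
    fun q a x u hq ha hx hu hux => ?_⟩
  have hx0 : 0 < x := by linarith
  have hL : 1 ≤ Real.log x := by
    rw [Real.le_log_iff_exp_le hx0]
    linarith [Real.exp_one_lt_d9]
  set L := Real.log x with hLdef
  have hL0 : 0 < L := by linarith
  have hq' : (1 : ℝ) ≤ q := by exact_mod_cast hq
  set φ : ℝ := (q.totient : ℝ) with hφ
  have hφ1 : 1 ≤ φ := by
    rw [hφ]; exact_mod_cast Nat.totient_pos.mpr hq
  have hφ0 : 0 < φ := by linarith
  set d : ℕ → ℝ := fun n => (if n % q = a % q then vonMangoldt n else 0) - 1 / φ with hd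
  set r := √x with hr
  have hr0 : 0 < r := Real.sqrt_pos.mpr hx0
  have hrr : r * r = x := Real.mul_self_sqrt hx0.le
  have hr16 : 16 ≤ r := by
    rw [hr]; exact Real.le_sqrt_of_sq_le (by linarith)
  have hlogr : Real.log r = L / 2 := by rw [hr, Real.log_sqrt hx0.le]
  set s := ⌈r⌉₊ with hs
  have hsr : r ≤ s := Nat.le_ceil r
  have hsr2 : (s : ℝ) ≤ 2 * r := by
    have := Nat.ceil_lt_add_one hr0.le
    linarith
  have hLK : L ^ (K + 1) ≤ 2 ^ (K + 1) * C₂ * r := by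
    have := h₂ r (by linarith)
    rw [hlogr, div_pow, div_le_iff₀ (by positivity)] at this
    linarith
  have htriv : ∀ m, m ≤ s → |∑ n ∈ Icc 1 m, d n| ≤ 4 * 2 ^ (K + 1) * C₂ * x / L ^ K := by
    intro m hm
    have hdn : ∀ n ∈ Icc 1 m, |d n| ≤ 2 * L := by
      intro n hn
      rw [Finset.mem_Icc] at hn
      have h1 : (1 : ℝ) ≤ n := by exact_mod_cast hn.1
      have h2 : (n : ℝ) ≤ s := by exact_mod_cast hn.2.trans hm
      have h3 : vonMangoldt n ≤ L := by
        refine ArithmeticFunction.vonMangoldt_le_log.trans ?_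
        exact Real.log_le_log (by linarith) (by nlinarith)
      have h4 : 1 / φ ≤ 1 := (div_le_one hφ0).mpr hφ1
      have h5 : 0 ≤ 1 / φ := by positivity
      have h6 := ArithmeticFunction.vonMangoldt_nonneg (n := n)
      rw [hd, abs_le]
      dsimp only
      split_ifs <;> constructor <;> linarith
    calc _ ≤ ∑ n ∈ Icc 1 m, |d n| := Finset.abs_sum_le_sum_abs _ _
      _ ≤ ∑ n ∈ Icc 1 m, 2 * L := Finset.sum_le_sum hdn
      _ = m * (2 * L) := by rw [Finset.sum_const, nsmul_eq_mul, Nat.card_Icc]; simp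
      _ ≤ (2 * r) * (2 * L) := by
          gcongr
          exact le_trans (by exact_mod_cast hm) hsr2
      _ = 4 * r * L ^ (K + 1) / L ^ K := by field_simp; ring
      _ ≤ 4 * r * (2 ^ (K + 1) * C₂ * r) / L ^ K := by gcongr
      _ = _ := by rw [← hrr]; ring
  have hmain : |∑ n ∈ Icc 1 ⌊u⌋₊, d n| ≤
      (2 * 4 * 2 ^ (K + 1) * C₂ + 2 * C₁ * 4 ^ K) * x * q / L ^ K := by
    rcases le_total ⌊u⌋₊ s with h | h
    · refine (htriv _ h).trans ?_
      gcongr ?_ / _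
      have p1 : 0 < 4 * 2 ^ (K + 1) * C₂ * x := by positivity
      have p2 : 0 < 2 * C₁ * 4 ^ K * x := by positivity
      nlinarith
    · have hsplit : ∑ n ∈ Icc 1 ⌊u⌋₊, d n = ∑ n ∈ Icc 1 s, d n + ∑ n ∈ Ioc s ⌊u⌋₊, d n := by
        have e : ∀ m, Icc 1 m = Ioc 0 m := fun m => rfl
        rw [e, e, Finset.sum_Ioc_consecutive _ (Nat.zero_le _) h]
      set w : ℕ → ℝ := fun n => 1 / Real.log n ^ (2 * K) with hw
      set c : ℕ → ℝ := fun n => d n * Real.log n ^ (2 * K) with hc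
      have hs16 : (16 : ℝ) ≤ s := by linarith
      have hlogpos : ∀ n, s ≤ n → 0 < Real.log n := fun n hn => Real.log_pos (by
        have : (s : ℝ) ≤ n := by exact_mod_cast hn
        linarith)
      have hdw : ∑ n ∈ Ioc s ⌊u⌋₊, d n = ∑ n ∈ Ioc s ⌊u⌋₊, w n * c n := by
        refine Finset.sum_congr rfl fun n hn => ?_
        have := hlogpos n (Finset.mem_Ioc.mp hn).1.le
        rw [hw, hc]
        field_simp
      have hbd : ∀ m, s ≤ m → m ≤ ⌊u⌋₊ → |∑ n ∈ Icc 1 m, c n| ≤ C₁ * q * x * L ^ K := by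
        intro m hm hmu
        have hmx : (m : ℝ) ≤ x := ((Nat.le_floor_iff hu).mp hmu).trans hux
        have hm16 : (16 : ℝ) ≤ m := hs16.trans (by exact_mod_cast hm)
        have := h₁ q a m hq ha hm16
        rw [Nat.floor_natCast] at this
        refine this.trans ?_
        have : Real.log m ≤ L := Real.log_le_log (by linarith) hmx
        have : 0 ≤ Real.log m := Real.log_natCast_nonneg m
        gcongr
      have habel := abs_sum_antitone_mul_le (w := w) (c := c) (B := 2 * (C₁ * q * x * L ^ K)) h
        (fun n hn => by
          have h1 := hlogpos n hn
          have hn16 : (16 : ℝ) ≤ n := hs16.trans (by exact_mod_cast hn)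
          refine ⟨by rw [hw]; positivity, ?_⟩
          rw [hw]
          dsimp only
          refine one_div_le_one_div_of_le (by positivity) (pow_le_pow_left₀ h1.le ?_ _)
          refine Real.log_le_log (by linarith) ?_
          push_cast; linarith)
        (fun m hm hmu => by
          have e : ∀ m, Icc 1 m = Ioc 0 m := fun m => rfl
          have e1 : ∑ n ∈ Ioc s m, c n = ∑ n ∈ Icc 1 m, c n - ∑ n ∈ Icc 1 s, c n := by
            rw [e, e, ← Finset.sum_Ioc_consecutive _ (Nat.zero_le _) hm]
            ring
          rw [e1]
          have := hbd m hm hmu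
          have := hbd s le_rfl h
          refine (abs_sub _ _).trans ?_
          linarith)
      have hws : w s ≤ 4 ^ K / L ^ (2 * K) := by
        have hls : L / 2 ≤ Real.log s := by
          rw [← hlogr]; exact Real.log_le_log hr0 hsr
        calc w s ≤ 1 / (L / 2) ^ (2 * K) := by
              rw [hw]
              dsimp only
              gcongr
          _ = _ := by
              rw [div_pow, pow_mul 2 2 K]; norm_num
      rw [hsplit, hdw]
      calc _ ≤ 4 * 2 ^ (K + 1) * C₂ * x / L ^ K + 2 * (C₁ * q * x * L ^ K) * w s :=
            (abs_add_le _ _).trans (add_le_add (htriv s le_rfl) habel)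
        _ ≤ 4 * 2 ^ (K + 1) * C₂ * x * q / L ^ K +
            2 * (C₁ * q * x * L ^ K) * (4 ^ K / L ^ (2 * K)) := by
            refine add_le_add ?_ (mul_le_mul_of_nonneg_left hws (by positivity))
            gcongr ?_ / _
            exact le_mul_of_one_le_right (by positivity) hq'
        _ = (4 * 2 ^ (K + 1) * C₂ + 2 * C₁ * 4 ^ K) * x * q / L ^ K := by
            rw [two_mul K, pow_add L]; field_simp
        _ ≤ _ := by
            gcongr
            linarith [show 0 < 2 ^ (K + 1) * C₂ by positivity]
  have hpsi : psi u q a - u / φ = ∑ n ∈ Icc 1 ⌊u⌋₊, d n + (⌊u⌋₊ - u) / φ := by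
    rw [hd, Finset.sum_sub_distrib, psi_eq_sum_ite, Finset.sum_const, nsmul_eq_mul, Nat.card_Icc]
    simp only [Nat.add_sub_cancel]
    ring
  have hfl : |((⌊u⌋₊ : ℝ) - u) / φ| ≤ 2 ^ (K + 1) * C₂ * q * x / L ^ K := by
    have h1 := Nat.floor_le hu
    have h2 := Nat.lt_floor_add_one u
    have h3 : |((⌊u⌋₊ : ℝ) - u) / φ| ≤ 1 := by
      rw [abs_div, abs_of_pos hφ0, div_le_one hφ0, abs_le]
      constructor <;> linarith
    refine h3.trans ?_
    rw [le_div_iff₀ (by positivity), one_mul]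
    calc L ^ K ≤ L ^ (K + 1) := pow_le_pow_right₀ hL (by omega)
      _ ≤ 2 ^ (K + 1) * C₂ * 1 * r := by rw [mul_one]; exact hLK
      _ ≤ 2 ^ (K + 1) * C₂ * q * x := by
          gcongr
          nlinarith
  rw [hpsi]
  calc _ ≤ _ := abs_add_le _ _
    _ ≤ _ := add_le_add hmain hfl
    _ = _ := by ring

end MontgomeryHooley

namespace MontgomeryHooley

open Complex MeasureTheory Filter Topology DirichletCharacter
open ArithmeticFunction (vonMangoldt)

/-- The additive character `θ ↦ exp (2πiθ)`. -/
noncomputable def expChar (θ : ℝ) : ℂ := Complex.exp ((2 * Real.pi * θ : ℝ) * I)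

lemma expChar_add (s t : ℝ) : expChar (s + t) = expChar s * expChar t := by
  rw [expChar, expChar, expChar, ← Complex.exp_add]
  push_cast
  ring_nf

lemma norm_expChar (s : ℝ) : ‖expChar s‖ = 1 := Complex.norm_exp_ofReal_mul_I _

lemma expChar_int (k : ℤ) : expChar k = 1 := by
  rw [expChar, ← Complex.exp_int_mul_two_pi_mul_I k]
  push_cast
  ring_nf

lemma conj_expChar (s : ℝ) : (starRingEnd ℂ) (expChar s) = expChar (-s) := by
  rw [expChar, expChar, ← Complex.exp_conj, map_mul, Complex.conj_ofReal, Complex.conj_I]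
  push_cast
  ring_nf

lemma expChar_natCast_mul (n : ℕ) (s : ℝ) : expChar (n * s) = expChar s ^ n := by
  rw [expChar, expChar, ← Complex.exp_nat_mul]
  push_cast
  ring_nf

lemma expChar_fract (s : ℝ) : expChar (Int.fract s) = expChar s := by
  have h := expChar_add (Int.fract s) ⌊s⌋
  rw [Int.fract_add_floor, expChar_int, mul_one] at h
  exact h.symm

lemma norm_expChar_sub_one_ge {u : ℝ} (hu0 : 0 ≤ u) (hu1 : u ≤ 1) :
    4 * min u (1 - u) ≤ ‖expChar u - 1‖ := by
  have h1 : ‖expChar u - 1‖ = 2 * |Real.sin (Real.pi * u)| := by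
    rw [expChar, mul_comm _ I, Complex.norm_exp_I_mul_ofReal_sub_one]
    rw [Real.norm_eq_abs, abs_mul, abs_of_pos (by norm_num : (0:ℝ) < 2)]
    congr 3
    ring
  have hs : ∀ v : ℝ, 0 ≤ v → v ≤ 1 / 2 → 2 * v ≤ Real.sin (Real.pi * v) := by
    intro v hv0 hv1
    have := Real.mul_le_sin (x := Real.pi * v) (by positivity) (by nlinarith [Real.pi_pos])
    calc 2 * v = 2 / Real.pi * (Real.pi * v) := by field_simp
      _ ≤ _ := this
  rw [h1]
  rcases le_total u (1 / 2) with h | h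
  · have := hs u hu0 h
    have h2 := le_abs_self (Real.sin (Real.pi * u))
    have := min_le_left u (1 - u)
    linarith
  · have := hs (1 - u) (by linarith) (by linarith)
    rw [show Real.pi * (1 - u) = Real.pi - Real.pi * u by ring, Real.sin_pi_sub] at this
    have h2 := le_abs_self (Real.sin (Real.pi * u))
    have := min_le_right u (1 - u)
    linarith

lemma norm_sum_expChar_le (N : ℕ) {β : ℝ} (hβ : 0 < Int.fract β) :
    ‖∑ n ∈ Icc 1 N, expChar (n * β)‖ ≤ (1 / Int.fract β + 1 / (1 - Int.fract β)) / 2 := by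
  set u := Int.fract β with hu
  have hu1 : u < 1 := Int.fract_lt_one β
  have hm : 0 < min u (1 - u) := lt_min hβ (by linarith)
  have hgeom : (expChar β - 1) * ∑ n ∈ Icc 1 N, expChar (n * β) =
      expChar β * (expChar β ^ N - 1) := by
    simp_rw [expChar_natCast_mul]
    induction N with
    | zero => simp
    | succ N ih =>
      rw [Finset.sum_Icc_succ_top (by omega), mul_add, ih]
      ring
  have hle : ‖expChar β - 1‖ * ‖∑ n ∈ Icc 1 N, expChar (n * β)‖ ≤ 2 := by
    rw [← norm_mul, hgeom, norm_mul, norm_expChar, one_mul]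
    refine (norm_sub_le _ _).trans ?_
    rw [norm_pow, norm_expChar, one_pow, norm_one]
    norm_num
  have hge : 4 * min u (1 - u) ≤ ‖expChar β - 1‖ := by
    rw [← expChar_fract]
    exact norm_expChar_sub_one_ge hβ.le hu1.le
  have h2 : ‖∑ n ∈ Icc 1 N, expChar (n * β)‖ ≤ 1 / min u (1 - u) / 2 := by
    rw [div_div, le_div_iff₀ (by positivity)]
    nlinarith [norm_nonneg (∑ n ∈ Icc 1 N, expChar (n * β))]
  refine h2.trans ?_
  gcongr
  have p1 : 0 < 1 / u := by positivity
  have p2 : 0 < 1 / (1 - u) := by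
    have : 0 < 1 - u := by linarith
    positivity
  rcases min_choice u (1 - u) with h | h <;> rw [h] <;> linarith

lemma sum_one_div_fract_le {ι : Type*} [DecidableEq ι] (R : Finset ι) (α : ι → ℝ) {M : ℕ}
    (hM : 1 ≤ M)
    (hα : ∀ s ∈ R, ∀ t ∈ R, s ≠ t → ∀ k : ℤ, 1 ≤ M * |α s - α t - k|) {r : ι} (hr : r ∈ R) :
    ∑ s ∈ R.erase r, 1 / Int.fract (α s - α r) ≤ M * (1 + Real.log M) := by
  have hM0 : (0 : ℝ) < M := by exact_mod_cast hM
  set u : ι → ℝ := fun s => Int.fract (α s - α r) with hu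
  have hu1 : ∀ s ∈ R.erase r, 1 ≤ M * u s := by
    intro s hs
    rw [Finset.mem_erase] at hs
    have := hα s hs.2 r hr hs.1 ⌊α s - α r⌋
    rwa [show α s - α r - ⌊α s - α r⌋ = u s from rfl, abs_of_nonneg (Int.fract_nonneg _)] at this
  have hinj : Set.InjOn (fun s => ⌊M * u s⌋₊) (R.erase r : Finset ι) := by
    intro s hs t ht hst
    by_contra hne
    rw [Finset.mem_coe] at hs ht
    have h1 := hα s (Finset.mem_of_mem_erase hs) t (Finset.mem_of_mem_erase ht) hne
      (⌊α s - α r⌋ - ⌊α t - α r⌋)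
    have e : α s - α t - ((⌊α s - α r⌋ - ⌊α t - α r⌋ : ℤ) : ℝ) = u s - u t := by
      simp only [hu, Int.fract]; push_cast; ring
    rw [e, ← abs_of_pos hM0, ← abs_mul, mul_sub] at h1
    have a1 := Nat.floor_le (show 0 ≤ M * u s by linarith [hu1 s hs])
    have a2 := Nat.floor_le (show 0 ≤ M * u t by linarith [hu1 t ht])
    have a3 := Nat.lt_floor_add_one (M * u s)
    have a4 := Nat.lt_floor_add_one (M * u t)
    dsimp only at hst
    rw [hst] at a1 a3
    have : |M * u s - M * u t| < 1 := by rw [abs_lt]; constructor <;> linarith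
    linarith
  calc ∑ s ∈ R.erase r, 1 / u s ≤ ∑ s ∈ R.erase r, (M : ℝ) * (1 / (⌊M * u s⌋₊ : ℝ)) := by
        refine Finset.sum_le_sum fun s hs => ?_
        have h1 := hu1 s hs
        have h2 : 0 < u s := by
          by_contra h
          push Not at h
          nlinarith
        have h3 : (1 : ℝ) ≤ ⌊M * u s⌋₊ := by exact_mod_cast Nat.floor_pos.mpr h1
        rw [mul_one_div, div_le_div_iff₀ h2 (by linarith), one_mul]
        exact Nat.floor_le (by linarith)
    _ = M * ∑ s ∈ R.erase r, 1 / (⌊M * u s⌋₊ : ℝ) := by rw [Finset.mul_sum]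
    _ = M * ∑ j ∈ (R.erase r).image (fun s => ⌊M * u s⌋₊), 1 / (j : ℝ) := by
        rw [Finset.sum_image hinj]
    _ ≤ M * ∑ j ∈ Icc 1 M, 1 / (j : ℝ) := by
        gcongr
        intro j hj
        rw [Finset.mem_image] at hj
        obtain ⟨s, hs, rfl⟩ := hj
        rw [Finset.mem_Icc]
        refine ⟨Nat.floor_pos.mpr (hu1 s hs), ?_⟩
        have : u s < 1 := Int.fract_lt_one _
        exact Nat.floor_le_of_le (by nlinarith)
    _ ≤ _ := by
        gcongr
        have := harmonic_le_one_add_log M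
        rw [harmonic_eq_sum_Icc] at this
        push_cast at this
        simpa [one_div] using this

/-- A form of the large sieve inequality that loses a logarithm. -/
theorem sum_norm_sum_expChar_sq_le {ι : Type*} [DecidableEq ι] (R : Finset ι) (α : ι → ℝ) {M : ℕ}
    (hM : 1 ≤ M)
    (hα : ∀ s ∈ R, ∀ t ∈ R, s ≠ t → ∀ k : ℤ, 1 ≤ M * |α s - α t - k|) (N : ℕ) (a : ℕ → ℝ) :
    ∑ r ∈ R, ‖∑ n ∈ Icc 1 N, a n * expChar (n * α r)‖ ^ 2 ≤
      (N + M * (1 + Real.log M)) * ∑ n ∈ Icc 1 N, a n ^ 2 := by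
  set Δ : ℝ := N + M * (1 + Real.log M) with hΔ
  have hlog : 0 ≤ Real.log M := Real.log_natCast_nonneg M
  have hΔ0 : 0 ≤ Δ := by positivity
  set S : ι → ℂ := fun r => ∑ n ∈ Icc 1 N, a n * expChar (n * α r) with hS
  set c : ι → ℂ := fun r => (starRingEnd ℂ) (S r) with hc
  set Z := ∑ r ∈ R, ‖S r‖ ^ 2 with hZ
  have hZ0 : 0 ≤ Z := Finset.sum_nonneg fun _ _ => by positivity
  have hkernel : ∀ r ∈ R, ∑ s ∈ R, ‖∑ n ∈ Icc 1 N, expChar (n * (α s - α r))‖ ≤ Δ := by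
    intro r hr
    rw [← Finset.add_sum_erase _ _ hr, hΔ]
    refine add_le_add ?_ ?_
    · refine (norm_sum_le _ _).trans ?_
      simp [norm_expChar]
    · have h1 := sum_one_div_fract_le R α hM hα hr
      have h2 := sum_one_div_fract_le R (fun s => - α s) hM (fun s hs t ht hst k => by
        have := hα s hs t ht hst (-k)
        rw [← abs_neg] at this
        convert this using 3
        push_cast; ring) hr
      have hpos : ∀ s ∈ R.erase r, 0 < Int.fract (α s - α r) := by
        intro s hs
        rw [Finset.mem_erase] at hs
        have := hα s hs.2 r hr hs.1 ⌊α s - α r⌋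
        refine lt_of_le_of_ne (Int.fract_nonneg _) fun h => ?_
        rw [show α s - α r - ⌊α s - α r⌋ = Int.fract (α s - α r) from rfl, ← h] at this
        norm_num at this
      have h3 : ∑ s ∈ R.erase r, 1 / (1 - Int.fract (α s - α r)) ≤ M * (1 + Real.log M) := by
        refine le_trans (le_of_eq ?_) h2
        refine Finset.sum_congr rfl fun s hs => ?_
        rw [← Int.fract_neg (hpos s hs).ne']
        congr 2
        ring
      calc _ ≤ ∑ s ∈ R.erase r,
            (1 / Int.fract (α s - α r) + 1 / (1 - Int.fract (α s - α r))) / 2 :=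
            Finset.sum_le_sum fun s hs => norm_sum_expChar_le N (hpos s hs)
        _ ≤ _ := by
            rw [← Finset.sum_div, Finset.sum_add_distrib]
            linarith
  have hdual : ∑ n ∈ Icc 1 N, ‖∑ r ∈ R, c r * expChar (n * α r)‖ ^ 2 ≤ Δ * Z := by
    have e1 : ∀ n : ℕ, ((‖∑ r ∈ R, c r * expChar (n * α r)‖ ^ 2 : ℝ) : ℂ) =
        ∑ r ∈ R, ∑ s ∈ R, (starRingEnd ℂ) (c r) * c s * expChar (n * (α s - α r)) := by
      intro n
      rw [← Complex.normSq_eq_norm_sq, Complex.normSq_eq_conj_mul_self, map_sum,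
        Finset.sum_mul_sum]
      refine Finset.sum_congr rfl fun r _ => Finset.sum_congr rfl fun s _ => ?_
      rw [map_mul, conj_expChar, mul_sub, sub_eq_add_neg, expChar_add]
      ring
    have e2 : ((∑ n ∈ Icc 1 N, ‖∑ r ∈ R, c r * expChar (n * α r)‖ ^ 2 : ℝ) : ℂ) =
        ∑ r ∈ R, ∑ s ∈ R, (starRingEnd ℂ) (c r) * c s *
          ∑ n ∈ Icc 1 N, expChar (n * (α s - α r)) := by
      rw [Complex.ofReal_sum]
      simp_rw [e1, Finset.mul_sum]
      rw [Finset.sum_comm]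
      refine Finset.sum_congr rfl fun r _ => ?_
      rw [Finset.sum_comm]
    have hsymm : ∀ r s, ‖∑ n ∈ Icc 1 N, expChar (n * (α s - α r))‖ =
        ‖∑ n ∈ Icc 1 N, expChar (n * (α r - α s))‖ := by
      intro r s
      rw [← Complex.norm_conj, map_sum]
      congr 1
      refine Finset.sum_congr rfl fun n _ => ?_
      rw [conj_expChar]
      congr 1
      ring
    have e3 : ∑ n ∈ Icc 1 N, ‖∑ r ∈ R, c r * expChar (n * α r)‖ ^ 2 ≤
        ∑ r ∈ R, ∑ s ∈ R, (‖S r‖ ^ 2 + ‖S s‖ ^ 2) / 2 *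
          ‖∑ n ∈ Icc 1 N, expChar (n * (α s - α r))‖ := by
      rw [← abs_of_nonneg (Finset.sum_nonneg fun n (_ : n ∈ Icc 1 N) =>
        sq_nonneg ‖∑ r ∈ R, c r * expChar (n * α r)‖), ← Real.norm_eq_abs, ← Complex.norm_real, e2]
      refine norm_sum_le_of_le _ fun r _ => norm_sum_le_of_le _ fun s _ => ?_
      rw [norm_mul, norm_mul, Complex.norm_conj]
      have : ‖c r‖ * ‖c s‖ ≤ (‖S r‖ ^ 2 + ‖S s‖ ^ 2) / 2 := by
        simp only [hc, Complex.norm_conj]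
        nlinarith [sq_nonneg (‖S r‖ - ‖S s‖)]
      gcongr
    refine e3.trans ?_
    have e4 : ∑ r ∈ R, ∑ s ∈ R, ‖S r‖ ^ 2 * ‖∑ n ∈ Icc 1 N, expChar (n * (α s - α r))‖ ≤
        Δ * Z := by
      rw [hZ, Finset.mul_sum]
      refine Finset.sum_le_sum fun r hr => ?_
      rw [← Finset.mul_sum, mul_comm]
      exact mul_le_mul_of_nonneg_right (hkernel r hr) (by positivity)
    have e5 : ∑ r ∈ R, ∑ s ∈ R, ‖S s‖ ^ 2 * ‖∑ n ∈ Icc 1 N, expChar (n * (α s - α r))‖ ≤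
        Δ * Z := by
      rw [Finset.sum_comm]
      refine le_trans (le_of_eq ?_) e4
      refine Finset.sum_congr rfl fun r _ => Finset.sum_congr rfl fun s _ => ?_
      rw [hsymm]
    have e6 : ∑ r ∈ R, ∑ s ∈ R, (‖S r‖ ^ 2 + ‖S s‖ ^ 2) / 2 *
          ‖∑ n ∈ Icc 1 N, expChar (n * (α s - α r))‖ =
        (∑ r ∈ R, ∑ s ∈ R, ‖S r‖ ^ 2 * ‖∑ n ∈ Icc 1 N, expChar (n * (α s - α r))‖ +
        ∑ r ∈ R, ∑ s ∈ R, ‖S s‖ ^ 2 * ‖∑ n ∈ Icc 1 N, expChar (n * (α s - α r))‖) / 2 := by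
      rw [← Finset.sum_add_distrib, Finset.sum_div]
      refine Finset.sum_congr rfl fun r _ => ?_
      rw [← Finset.sum_add_distrib, Finset.sum_div]
      exact Finset.sum_congr rfl fun s _ => by ring
    rw [e6]
    linarith
  have hZeq : (Z : ℂ) = ∑ n ∈ Icc 1 N, (a n : ℂ) * ∑ r ∈ R, c r * expChar (n * α r) := by
    have : ∀ r, ((‖S r‖ ^ 2 : ℝ) : ℂ) = ∑ n ∈ Icc 1 N, (a n : ℂ) * (c r * expChar (n * α r)) := by
      intro r
      rw [← Complex.normSq_eq_norm_sq, Complex.normSq_eq_conj_mul_self]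
      change c r * ∑ n ∈ Icc 1 N, a n * expChar (n * α r) = _
      rw [Finset.mul_sum]
      exact Finset.sum_congr rfl fun n _ => by ring
    rw [hZ, Complex.ofReal_sum]
    simp_rw [this, Finset.mul_sum]
    rw [Finset.sum_comm]
  have hCS : Z ^ 2 ≤ (∑ n ∈ Icc 1 N, a n ^ 2) * (Δ * Z) := by
    have h1 : Z ≤ ∑ n ∈ Icc 1 N, |a n| * ‖∑ r ∈ R, c r * expChar (n * α r)‖ := by
      rw [← abs_of_nonneg hZ0, ← Real.norm_eq_abs, ← Complex.norm_real, hZeq]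
      refine norm_sum_le_of_le _ fun n _ => ?_
      rw [norm_mul, Complex.norm_real, Real.norm_eq_abs]
    calc Z ^ 2 ≤ (∑ n ∈ Icc 1 N, |a n| * ‖∑ r ∈ R, c r * expChar (n * α r)‖) ^ 2 := by gcongr
      _ ≤ (∑ n ∈ Icc 1 N, |a n| ^ 2) *
          ∑ n ∈ Icc 1 N, ‖∑ r ∈ R, c r * expChar (n * α r)‖ ^ 2 :=
          Finset.sum_mul_sq_le_sq_mul_sq _ _ _
      _ ≤ _ := by
          simp_rw [sq_abs]
          gcongr
  rcases hZ0.eq_or_lt with h | h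
  · rw [← h]
    positivity
  · refine le_of_mul_le_mul_right ?_ h
    nlinarith

end MontgomeryHooley

namespace MontgomeryHooley

open Complex MeasureTheory Filter Topology DirichletCharacter
open ArithmeticFunction (vonMangoldt)

/-- The exponential sum `∑_{n ≤ x} Λ(n) e(nθ)`. -/
noncomputable def expSum (x θ : ℝ) : ℂ := ∑ n ∈ Icc 1 ⌊x⌋₊, (vonMangoldt n : ℝ) * expChar (n * θ)

/-- The sum of `‖expSum x (b / d)‖ ^ 2` over reduced residues `b` modulo `d`. -/
noncomputable def primitivePart (x : ℝ) (d : ℕ) : ℝ :=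
  ∑ b ∈ (range d).filter (fun b => b.Coprime d), ‖expSum x (b / d)‖ ^ 2

/-- The second moment of `psi x q` over all residue classes modulo `q`. -/
noncomputable def secondMoment (x : ℝ) (q : ℕ) : ℝ := ∑ a ∈ Icc 1 q, psi x q a ^ 2

lemma primitivePart_nonneg (x : ℝ) (d : ℕ) : 0 ≤ primitivePart x d :=
  Finset.sum_nonneg fun _ _ => by positivity

lemma existsUnique_mem_Icc_mod_eq {q : ℕ} (hq : 1 ≤ q) (m : ℕ) :
    ∃ a ∈ Icc 1 q, m % q = a % q ∧ ∀ b ∈ Icc 1 q, m % q = b % q → b = a := by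
  have hlt := Nat.mod_lt m hq
  rcases Nat.eq_zero_or_pos (m % q) with h | h
  · refine ⟨q, by simp; omega, by rw [h, Nat.mod_self], fun b hb hbm => ?_⟩
    rw [Finset.mem_Icc] at hb
    rcases hb.2.eq_or_lt with h' | h'
    · exact h'
    · rw [Nat.mod_eq_of_lt h'] at hbm; omega
  · refine ⟨m % q, by rw [Finset.mem_Icc]; omega, by rw [Nat.mod_mod], fun b hb hbm => ?_⟩
    rw [Finset.mem_Icc] at hb
    rcases hb.2.eq_or_lt with h' | h'
    · rw [h', Nat.mod_self] at hbm; omega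
    · rw [Nat.mod_eq_of_lt h'] at hbm; omega

lemma secondMoment_eq_sum (x : ℝ) {q : ℕ} (hq : 1 ≤ q) :
    secondMoment x q = ∑ m ∈ Icc 1 ⌊x⌋₊, ∑ n ∈ Icc 1 ⌊x⌋₊,
      if m % q = n % q then vonMangoldt m * vonMangoldt n else 0 := by
  rw [secondMoment]
  simp_rw [psi_eq_sum_ite, sq, Finset.sum_mul_sum]
  rw [Finset.sum_comm]
  refine Finset.sum_congr rfl fun m _ => ?_
  rw [Finset.sum_comm]
  refine Finset.sum_congr rfl fun n _ => ?_
  obtain ⟨a, ha, ham, hau⟩ := existsUnique_mem_Icc_mod_eq hq m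
  rw [Finset.sum_eq_single_of_mem a ha]
  · rw [if_pos ham, ham]
    by_cases h : n % q = a % q
    · rw [if_pos h, if_pos h.symm]
    · rw [if_neg h, if_neg (Ne.symm h), mul_zero]
  · intro b hb hba
    rw [if_neg (fun h => hba (hau b hb h)), zero_mul]

lemma sum_range_expChar {q : ℕ} (hq : 1 ≤ q) (k : ℤ) :
    ∑ b ∈ range q, expChar (b * (k / q)) = if (q : ℤ) ∣ k then (q : ℂ) else 0 := by
  have hq0 : (q : ℝ) ≠ 0 := by positivity
  split_ifs with h
  · obtain ⟨j, rfl⟩ := h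
    have : ∀ b ∈ range q, expChar (b * (((q * j : ℤ) : ℝ) / q)) = 1 := by
      intro b _
      rw [← expChar_int (b * j)]
      congr 1
      push_cast
      field_simp
    rw [Finset.sum_congr rfl this]
    simp
  · simp_rw [expChar_natCast_mul]
    have h1 : expChar (k / q) ^ q = 1 := by
      rw [← expChar_natCast_mul, ← expChar_int k]
      congr 1
      field_simp
    have h2 : expChar (k / q) ≠ 1 := by
      intro h'
      rw [expChar, Complex.exp_eq_one_iff] at h'
      obtain ⟨n, hn⟩ := h'
      apply h
      refine ⟨n, ?_⟩
      have h3 : ((2 * Real.pi * (k / q) : ℝ) : ℂ) = ((n * (2 * Real.pi) : ℝ) : ℂ) := by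
        refine mul_right_cancel₀ Complex.I_ne_zero ?_
        rw [hn]; push_cast; ring
      have h4 := Complex.ofReal_injective h3
      have h5 : (k : ℝ) / q = n := by
        have := Real.pi_pos
        refine mul_left_cancel₀ (show 2 * Real.pi ≠ 0 by positivity) ?_
        rw [h4]; ring
      rw [div_eq_iff hq0] at h5
      have : (k : ℝ) = ((q * n : ℤ) : ℝ) := by push_cast; rw [h5]; ring
      exact_mod_cast this
    have := mul_geom_sum (expChar (k / q)) q
    rw [h1, sub_self, mul_eq_zero] at this
    exact this.resolve_left (sub_ne_zero.mpr h2)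

lemma mul_secondMoment_eq_sum_range (x : ℝ) {q : ℕ} (hq : 1 ≤ q) :
    q * secondMoment x q = ∑ b ∈ range q, ‖expSum x (b / q)‖ ^ 2 := by
  have hq0 : (q : ℝ) ≠ 0 := by positivity
  have e1 : ∀ b : ℕ, ((‖expSum x (b / q)‖ ^ 2 : ℝ) : ℂ) =
      ∑ m ∈ Icc 1 ⌊x⌋₊, ∑ n ∈ Icc 1 ⌊x⌋₊, (vonMangoldt m * vonMangoldt n : ℝ) *
        expChar (b * (((n - m : ℤ) : ℝ) / q)) := by
    intro b
    rw [← Complex.normSq_eq_norm_sq, Complex.normSq_eq_conj_mul_self, expSum, map_sum,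
      Finset.sum_mul_sum]
    refine Finset.sum_congr rfl fun m _ => Finset.sum_congr rfl fun n _ => ?_
    rw [map_mul, conj_expChar, Complex.conj_ofReal]
    have : (b * (((n - m : ℤ) : ℝ) / q)) = -(m * ((b : ℝ) / q)) + n * ((b : ℝ) / q) := by
      push_cast; ring
    rw [this, expChar_add]
    push_cast
    ring
  have e2 : ((q * secondMoment x q : ℝ) : ℂ) = ((∑ b ∈ range q, ‖expSum x (b / q)‖ ^ 2 : ℝ) : ℂ) := by
    rw [Complex.ofReal_sum]
    simp_rw [e1]
    rw [Finset.sum_comm, secondMoment_eq_sum x hq, Finset.mul_sum, Complex.ofReal_sum]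
    refine Finset.sum_congr rfl fun m _ => ?_
    rw [Finset.sum_comm, Finset.mul_sum, Complex.ofReal_sum]
    refine Finset.sum_congr rfl fun n _ => ?_
    rw [← Finset.mul_sum, sum_range_expChar hq]
    have hiff : (q : ℤ) ∣ (n - m : ℤ) ↔ m % q = n % q := (Nat.modEq_iff_dvd).symm
    by_cases h : m % q = n % q
    · rw [if_pos h, if_pos (hiff.mpr h)]; push_cast; ring
    · rw [if_neg h, if_neg (mt hiff.mp h)]; simp
  exact Complex.ofReal_injective e2

lemma sum_range_div_eq_sum_divisors {q : ℕ} (hq : 1 ≤ q) (F : ℝ → ℝ) :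
    ∑ b ∈ range q, F (b / q) =
      ∑ d ∈ q.divisors, ∑ b ∈ (range d).filter (fun b => b.Coprime d), F (b / d) := by
  have hmaps : ∀ b ∈ range q, q / b.gcd q ∈ q.divisors := fun b _ =>
    Nat.mem_divisors.mpr ⟨Nat.div_dvd_of_dvd (Nat.gcd_dvd_right b q), by omega⟩
  rw [← Finset.sum_fiberwise_of_maps_to hmaps]
  refine Finset.sum_congr rfl fun d hd => ?_
  obtain ⟨g, hg⟩ := Nat.dvd_of_mem_divisors hd
  have hd0 : 0 < d := Nat.pos_of_mem_divisors hd
  have hg0 : 0 < g := Nat.pos_of_ne_zero fun h => by rw [h] at hg; omega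
  subst hg
  have hgcd : ∀ b : ℕ, d * g / b.gcd (d * g) = d ↔ b.gcd (d * g) = g := by
    intro b
    have h0 : 0 < b.gcd (d * g) := Nat.gcd_pos_of_pos_right b hq
    rw [Nat.div_eq_iff_eq_mul_left h0 (Nat.gcd_dvd_right _ _)]
    constructor
    · intro h; exact (Nat.eq_of_mul_eq_mul_left hd0 h).symm
    · intro h; rw [h]
  refine Finset.sum_nbij' (fun b => b / g) (fun c => c * g) ?_ ?_ ?_ ?_ ?_
  · intro b hb
    rw [Finset.mem_filter, Finset.mem_range, hgcd] at hb
    rw [Finset.mem_filter, Finset.mem_range]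
    refine ⟨Nat.div_lt_of_lt_mul (by rw [mul_comm]; exact hb.1), ?_⟩
    have h := Nat.coprime_div_gcd_div_gcd (m := b) (n := d * g) (by rw [hb.2]; exact hg0)
    rwa [hb.2, Nat.mul_div_cancel _ hg0] at h
  · intro c hc
    rw [Finset.mem_filter, Finset.mem_range] at hc
    rw [Finset.mem_filter, Finset.mem_range, hgcd, Nat.gcd_mul_right, hc.2.gcd_eq_one, one_mul]
    exact ⟨Nat.mul_lt_mul_of_pos_right hc.1 hg0, rfl⟩
  · intro b hb
    rw [Finset.mem_filter, hgcd] at hb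
    exact Nat.div_mul_cancel (hb.2 ▸ Nat.gcd_dvd_left b (d * g))
  · intro c _
    exact Nat.mul_div_cancel _ hg0
  · intro b hb
    rw [Finset.mem_filter, hgcd] at hb
    have hdvd : g ∣ b := hb.2 ▸ Nat.gcd_dvd_left b (d * g)
    congr 1
    have hg' : (g : ℝ) ≠ 0 := by positivity
    have hd' : (d : ℝ) ≠ 0 := by positivity
    rw [Nat.cast_div hdvd hg']
    push_cast
    field_simp

lemma mul_secondMoment_eq_sum_divisors (x : ℝ) {q : ℕ} (hq : 1 ≤ q) :
    q * secondMoment x q = ∑ d ∈ q.divisors, primitivePart x d := by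
  rw [mul_secondMoment_eq_sum_range x hq,
    sum_range_div_eq_sum_divisors hq (fun θ => ‖expSum x θ‖ ^ 2)]
  rfl

lemma sum_primitivePart_le (x : ℝ) {y : ℕ} (hy : 1 ≤ y) :
    ∑ d ∈ Icc 1 y, primitivePart x d ≤
      (⌊x⌋₊ + (y ^ 2 : ℕ) * (1 + Real.log (y ^ 2 : ℕ))) *
        ∑ n ∈ Icc 1 ⌊x⌋₊, vonMangoldt n ^ 2 := by
  set R : Finset (Σ _ : ℕ, ℕ) := (Icc 1 y).sigma fun d => (range d).filter (fun b => b.Coprime d)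
    with hR
  have h := sum_norm_sum_expChar_sq_le R (fun p => (p.2 : ℝ) / p.1) (M := y ^ 2)
    (Nat.one_le_pow _ _ hy) ?_ ⌊x⌋₊ (fun n => vonMangoldt n)
  · refine le_trans (le_of_eq ?_) h
    rw [hR, Finset.sum_sigma]
    rfl
  · rintro ⟨d, b⟩ hs ⟨d', b'⟩ ht hne k
    simp only [hR, Finset.mem_sigma, Finset.mem_Icc, Finset.mem_filter, Finset.mem_range] at hs ht
    obtain ⟨⟨hd1, hdy⟩, hbd, hcop⟩ := hs
    obtain ⟨⟨hd1', hdy'⟩, hbd', hcop'⟩ := ht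
    have hd0 : (0 : ℝ) < d := by exact_mod_cast hd1
    have hd0' : (0 : ℝ) < d' := by exact_mod_cast hd1'
    have hnum : (b * d' - b' * d - k * d * d' : ℤ) ≠ 0 := by
      intro h0
      have c1 : (d : ℤ) ∣ d' := by
        have : (d : ℤ) ∣ b * d' := ⟨b' + k * d', by linarith⟩
        exact IsCoprime.dvd_of_dvd_mul_left (Nat.isCoprime_iff_coprime.mpr hcop.symm) this
      have c2 : (d' : ℤ) ∣ d := by
        have : (d' : ℤ) ∣ b' * d := ⟨b - k * d, by linarith⟩
        exact IsCoprime.dvd_of_dvd_mul_left (Nat.isCoprime_iff_coprime.mpr hcop'.symm) this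
      have hdd : d = d' :=
        Nat.dvd_antisymm (Int.natCast_dvd_natCast.mp c1) (Int.natCast_dvd_natCast.mp c2)
      subst hdd
      have h1 : ((b : ℤ) - b' - k * d) * d = 0 := by linarith
      have hdz : (d : ℤ) ≠ 0 := by omega
      have h2 : (b : ℤ) - b' - k * d = 0 := (mul_eq_zero.mp h1).resolve_right hdz
      have hk : k = 0 := by
        by_contra hk
        rcases lt_or_gt_of_ne hk with h | h
        · have : k * d ≤ -1 * d := mul_le_mul_of_nonneg_right (by omega) (by omega)
          omega
        · have : 1 * d ≤ k * d := mul_le_mul_of_nonneg_right (by omega) (by omega)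
          omega
      rw [hk] at h2
      have : b = b' := by omega
      exact hne (by rw [this])
    have habs : (1 : ℝ) ≤ |((b * d' - b' * d - k * d * d' : ℤ) : ℝ)| := by
      rw [← Int.cast_abs]
      exact_mod_cast Int.one_le_abs hnum
    have e : (b : ℝ) / d - b' / d' - k = ((b * d' - b' * d - k * d * d' : ℤ) : ℝ) / (d * d') := by
      push_cast
      field_simp
    dsimp only
    rw [e, abs_div, abs_of_pos (show (0 : ℝ) < d * d' by positivity), ← mul_div_assoc,
      le_div_iff₀ (by positivity), one_mul]
    have h1 : (d : ℝ) * d' ≤ y ^ 2 := by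
      rw [sq]
      gcongr
    push_cast at habs ⊢
    calc (d : ℝ) * d' ≤ y ^ 2 * 1 := by rw [mul_one]; exact h1
      _ ≤ _ := by gcongr

end MontgomeryHooley

namespace MontgomeryHooley

open Complex MeasureTheory Filter Topology DirichletCharacter
open ArithmeticFunction (vonMangoldt)

lemma totient_prod_primes {s : Finset ℕ} (hs : ∀ p ∈ s, p.Prime) :
    ((∏ p ∈ s, p).totient : ℝ) = ∏ p ∈ s, ((p : ℝ) - 1) := by
  have h := Nat.totient_mul_prod_primeFactors (∏ p ∈ s, p)
  rw [Nat.primeFactors_prod hs, mul_comm] at h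
  have hpos : 0 < ∏ p ∈ s, p := Finset.prod_pos fun p hp => (hs p hp).pos
  rw [Nat.eq_of_mul_eq_mul_left hpos h, Nat.cast_prod]
  exact Finset.prod_congr rfl fun p hp => by
    rw [Nat.cast_sub (hs p hp).one_lt.le, Nat.cast_one]

lemma sum_divisors_squarefree_one_div_totient {q : ℕ} (hq : 1 ≤ q) :
    ∑ d ∈ q.divisors, (if Squarefree d then 1 / (d.totient : ℝ) else 0) =
      q / (q.totient : ℝ) := by
  have hq0 : (q : ℝ) ≠ 0 := by positivity
  have hprime : ∀ s ⊆ q.primeFactors, ∀ p ∈ s, p.Prime := fun s hs p hp =>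
    Nat.prime_of_mem_primeFactors (hs hp)
  rw [← Finset.sum_filter]
  have h1 : ∑ d ∈ q.divisors with Squarefree d, 1 / (d.totient : ℝ) =
      ∑ s ∈ q.primeFactors.powerset, ∏ p ∈ s, 1 / ((p : ℝ) - 1) := by
    refine Finset.sum_nbij' (fun d => d.primeFactors) (fun s => ∏ p ∈ s, p) ?_ ?_ ?_ ?_ ?_
    · intro d hd
      rw [Finset.mem_filter, Nat.mem_divisors] at hd
      exact Finset.mem_powerset.mpr (Nat.primeFactors_mono hd.1.1 hd.1.2)
    · intro s hs
      rw [Finset.mem_powerset] at hs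
      rw [Finset.mem_filter, Nat.mem_divisors]
      refine ⟨⟨(Finset.prod_dvd_prod_of_subset _ _ _ hs).trans (Nat.prod_primeFactors_dvd q),
        by omega⟩, ?_⟩
      have hpr := hprime s hs
      refine Finset.squarefree_prod_of_pairwise_isCoprime (fun a ha b hb hab => ?_)
        fun p hp => (hpr p hp).squarefree
      exact Nat.coprime_iff_isRelPrime.mp ((Nat.coprime_primes (hpr a ha) (hpr b hb)).mpr hab)
    · intro d hd
      rw [Finset.mem_filter] at hd
      exact Nat.prod_primeFactors_of_squarefree hd.2
    · intro s hs
      rw [Finset.mem_powerset] at hs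
      exact Nat.primeFactors_prod (hprime s hs)
    · intro d hd
      rw [Finset.mem_filter] at hd
      conv_lhs => rw [← Nat.prod_primeFactors_of_squarefree hd.2]
      rw [totient_prod_primes fun p hp => Nat.prime_of_mem_primeFactors hp]
      simp
  rw [h1, ← Finset.prod_one_add]
  have h2 := Nat.totient_mul_prod_primeFactors q
  have h3 : (q.totient : ℝ) * ∏ p ∈ q.primeFactors, (p : ℝ) =
      q * ∏ p ∈ q.primeFactors, ((p : ℝ) - 1) := by
    have : ∏ p ∈ q.primeFactors, ((p : ℝ) - 1) = ((∏ p ∈ q.primeFactors, (p - 1) : ℕ) : ℝ) := by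
      rw [Nat.cast_prod]
      exact Finset.prod_congr rfl fun p hp => by
        rw [Nat.cast_sub (Nat.prime_of_mem_primeFactors hp).one_lt.le, Nat.cast_one]
    rw [this]
    have h2' := congrArg (Nat.cast : ℕ → ℝ) h2
    rw [Nat.cast_mul, Nat.cast_prod, Nat.cast_mul] at h2'
    exact h2'
  have hp1 : ∀ p ∈ q.primeFactors, (p : ℝ) - 1 ≠ 0 := fun p hp => by
    have : (1 : ℝ) < p := by exact_mod_cast (Nat.prime_of_mem_primeFactors hp).one_lt
    linarith
  have h4 : ∏ p ∈ q.primeFactors, ((p : ℝ) - 1) ≠ 0 := Finset.prod_ne_zero_iff.mpr hp1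
  have h5 : (q.totient : ℝ) ≠ 0 := by
    exact_mod_cast (Nat.totient_pos.mpr hq).ne'
  have h6 : ∏ p ∈ q.primeFactors, (1 + 1 / ((p : ℝ) - 1)) =
      (∏ p ∈ q.primeFactors, (p : ℝ)) / ∏ p ∈ q.primeFactors, ((p : ℝ) - 1) := by
    rw [← Finset.prod_div_distrib]
    refine Finset.prod_congr rfl fun p hp => ?_
    have := hp1 p hp
    field_simp
    ring
  rw [h6, div_eq_div_iff h4 h5, ← h3]
  ring

lemma sum_psi_filter_eq (x : ℝ) {q : ℕ} (hq : 1 ≤ q) (P : ℕ → Prop) [DecidablePred P]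
    (hP : ∀ m a, m % q = a % q → (P m ↔ P a)) :
    ∑ a ∈ (Icc 1 q).filter P, psi x q a = ∑ n ∈ (Icc 1 ⌊x⌋₊).filter P, vonMangoldt n := by
  simp_rw [psi_eq_sum_ite]
  rw [Finset.sum_comm, Finset.sum_filter]
  refine Finset.sum_congr rfl fun n _ => ?_
  obtain ⟨a, ha, han, hau⟩ := existsUnique_mem_Icc_mod_eq hq n
  split_ifs with h
  · rw [Finset.sum_eq_single_of_mem a (Finset.mem_filter.mpr ⟨ha, (hP n a han).mp h⟩),
      if_pos han]
    intro b hb hba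
    rw [if_neg fun h' => hba (hau b (Finset.mem_filter.mp hb).1 h')]
  · refine Finset.sum_eq_zero fun b hb => if_neg fun h' => h ?_
    exact (hP n b h').mpr (Finset.mem_filter.mp hb).2

lemma coprime_iff_of_mod_eq {q : ℕ} (m a : ℕ) (h : m % q = a % q) : m.Coprime q ↔ a.Coprime q := by
  rw [Nat.Coprime, Nat.Coprime, Nat.ModEq.gcd_eq (show m ≡ a [MOD q] from h)]

lemma card_filter_coprime_Icc (q : ℕ) :
    ((Icc 1 q).filter (fun a => a.Coprime q)).card = q.totient := by
  rw [← Nat.filter_coprime_Ico_eq_totient q 1]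
  congr 1
  ext a
  simp only [Finset.mem_filter, Finset.mem_Icc, Finset.mem_Ico, Nat.coprime_comm]
  omega

theorem abs_mul_secondMoment_sub_le (K : ℕ) : ∃ C : ℝ, 0 < C ∧ ∀ (q : ℕ) (x : ℝ), 1 ≤ q →
    256 ≤ x → |q * secondMoment x q - x ^ 2 * (q / (q.totient : ℝ))| ≤
      C * q ^ 4 * x ^ 2 / Real.log x ^ K := by
  obtain ⟨C₁, hC₁, h₁⟩ := abs_psi_sub_div_totient_le K
  obtain ⟨C₂, hC₂, h₂⟩ := exists_log_pow_le (K + 4)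
  refine ⟨C₁ * (C₁ + 2) + 9 * C₂, by positivity, fun q x hq hx => ?_⟩
  have hx0 : 0 < x := by linarith
  have hL : 1 ≤ Real.log x := by
    rw [Real.le_log_iff_exp_le hx0]
    linarith [Real.exp_one_lt_d9]
  set L := Real.log x with hLdef
  have hLK : 1 ≤ L ^ K := one_le_pow₀ hL
  have hq' : (1 : ℝ) ≤ q := by exact_mod_cast hq
  set φ : ℝ := (q.totient : ℝ) with hφ
  have hφ1 : 1 ≤ φ := by
    rw [hφ]; exact_mod_cast Nat.totient_pos.mpr hq
  have hφq : φ ≤ q := by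
    rw [hφ]; exact_mod_cast Nat.totient_le q
  have hφ0 : 0 < φ := by linarith
  set E := C₁ * q * x / L ^ K with hE
  have hE0 : 0 ≤ E := by positivity
  have hEx : E ≤ C₁ * q * x := div_le_self (by positivity) hLK
  have hcard : (((Icc 1 q).filter (fun a => a.Coprime q)).card : ℝ) = φ := by
    rw [card_filter_coprime_Icc]
  have hcop : |∑ a ∈ (Icc 1 q).filter (fun a => a.Coprime q), psi x q a ^ 2 - x ^ 2 / φ| ≤
      C₁ * (C₁ + 2) * q ^ 3 * x ^ 2 / L ^ K := by
    have e : x ^ 2 / φ = ∑ a ∈ (Icc 1 q).filter (fun a => a.Coprime q), (x / φ) ^ 2 := by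
      rw [Finset.sum_const, nsmul_eq_mul, hcard]
      field_simp
    rw [e, ← Finset.sum_sub_distrib]
    calc _ ≤ ∑ a ∈ (Icc 1 q).filter (fun a => a.Coprime q), |psi x q a ^ 2 - (x / φ) ^ 2| :=
          Finset.abs_sum_le_sum_abs _ _
      _ ≤ ∑ a ∈ (Icc 1 q).filter (fun a => a.Coprime q), E * ((C₁ + 2) * q * x) := by
          refine Finset.sum_le_sum fun a ha => ?_
          have h := h₁ q a x x hq (Finset.mem_filter.mp ha).2 hx hx0.le le_rfl
          rw [sq_sub_sq, abs_mul, mul_comm]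
          gcongr
          have h1 : x / φ ≤ x := div_le_self hx0.le hφ1
          have h2 : 0 ≤ x / φ := by positivity
          have h3 := psi_nonneg x q a
          have h4 := (abs_le.mp h).2
          rw [abs_of_nonneg (by positivity)]
          nlinarith
      _ = φ * (E * ((C₁ + 2) * q * x)) := by rw [Finset.sum_const, nsmul_eq_mul, hcard]
      _ ≤ q * (E * ((C₁ + 2) * q * x)) := by gcongr
      _ = _ := by rw [hE]; ring
  have hncop : ∑ a ∈ (Icc 1 q).filter (fun a => ¬ a.Coprime q), psi x q a ^ 2 ≤
      9 * C₂ * q ^ 3 * x ^ 2 / L ^ K := by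
    have h3 : ∑ a ∈ (Icc 1 q).filter (fun a => ¬ a.Coprime q), psi x q a ≤ q * (3 * L) * L := by
      rw [sum_psi_filter_eq x hq _ fun m a h => not_congr (coprime_iff_of_mod_eq m a h)]
      refine (sum_vonMangoldt_not_coprime_le hq (by linarith)).trans ?_
      gcongr
      linarith
    calc _ ≤ (∑ a ∈ (Icc 1 q).filter (fun a => ¬ a.Coprime q), psi x q a) ^ 2 :=
          Finset.sum_sq_le_sq_sum_of_nonneg fun a _ => psi_nonneg x q a
      _ ≤ (q * (3 * L) * L) ^ 2 := by
          gcongr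
          exact Finset.sum_nonneg fun a _ => psi_nonneg x q a
      _ = 9 * q ^ 2 * L ^ (K + 4) / L ^ K := by field_simp; ring
      _ ≤ 9 * q ^ 2 * (C₂ * x) / L ^ K := by
          gcongr
          exact h₂ x (by linarith)
      _ ≤ _ := by
          gcongr ?_ / _
          have : q ^ 2 * x ≤ q ^ 3 * x ^ 2 := by
            exact mul_le_mul (pow_le_pow_right₀ hq' (by norm_num)) (by nlinarith) hx0.le
              (by positivity)
          nlinarith
  have hsplit : secondMoment x q = ∑ a ∈ (Icc 1 q).filter (fun a => a.Coprime q), psi x q a ^ 2 +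
      ∑ a ∈ (Icc 1 q).filter (fun a => ¬ a.Coprime q), psi x q a ^ 2 := by
    rw [secondMoment, Finset.sum_filter_add_sum_filter_not]
  have hn0 : 0 ≤ ∑ a ∈ (Icc 1 q).filter (fun a => ¬ a.Coprime q), psi x q a ^ 2 :=
    Finset.sum_nonneg fun _ _ => by positivity
  have e : q * secondMoment x q - x ^ 2 * (q / φ) = q * ((∑ a ∈ (Icc 1 q).filter
      (fun a => a.Coprime q), psi x q a ^ 2 - x ^ 2 / φ) +
      ∑ a ∈ (Icc 1 q).filter (fun a => ¬ a.Coprime q), psi x q a ^ 2) := by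
    rw [hsplit]; ring
  rw [e, abs_mul, abs_of_pos (by linarith)]
  calc _ ≤ q * (C₁ * (C₁ + 2) * q ^ 3 * x ^ 2 / L ^ K + 9 * C₂ * q ^ 3 * x ^ 2 / L ^ K) := by
        gcongr
        refine (abs_add_le _ _).trans (add_le_add hcop ?_)
        rwa [abs_of_nonneg hn0]
    _ = _ := by ring

theorem abs_primitivePart_sub_le (K : ℕ) : ∃ C : ℝ, 0 < C ∧ ∀ (d : ℕ) (x : ℝ), 1 ≤ d →
    256 ≤ x → |primitivePart x d - x ^ 2 * (if Squarefree d then 1 / (d.totient : ℝ) else 0)| ≤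
      C * d ^ 5 * x ^ 2 / Real.log x ^ K := by
  obtain ⟨C, hC, h⟩ := abs_mul_secondMoment_sub_le K
  refine ⟨C, hC, fun d x hd hx => ?_⟩
  have hL : 0 ≤ Real.log x := Real.log_nonneg (by linarith)
  have hinv := (ArithmeticFunction.sum_eq_iff_sum_mul_moebius_eq
    (f := fun d => primitivePart x d - x ^ 2 * (if Squarefree d then 1 / (d.totient : ℝ) else 0))
    (g := fun q => q * secondMoment x q - x ^ 2 * (q / (q.totient : ℝ)))).mp (fun q hq => by
      rw [Finset.sum_sub_distrib, ← mul_secondMoment_eq_sum_divisors x hq, ← Finset.mul_sum,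
        sum_divisors_squarefree_one_div_totient hq]) d hd
  rw [← hinv]
  calc _ ≤ ∑ p ∈ d.divisorsAntidiagonal, C * d ^ 4 * x ^ 2 / Real.log x ^ K := by
        refine (Finset.abs_sum_le_sum_abs _ _).trans (Finset.sum_le_sum fun p hp => ?_)
        rw [Nat.mem_divisorsAntidiagonal] at hp
        have hp2 : 1 ≤ p.2 := Nat.pos_of_ne_zero fun h0 => by rw [h0] at hp; omega
        have hpd : p.2 ≤ d := Nat.le_of_dvd hd ⟨p.1, by rw [← hp.1]; ring⟩
        rw [abs_mul]
        have h1 : |((ArithmeticFunction.moebius p.1 : ℤ) : ℝ)| ≤ 1 := by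
          rw [← Int.cast_abs]
          exact_mod_cast ArithmeticFunction.abs_moebius_le_one
        calc _ ≤ 1 * (C * p.2 ^ 4 * x ^ 2 / Real.log x ^ K) :=
              mul_le_mul h1 (h p.2 x hp2 hx) (abs_nonneg _) zero_le_one
          _ ≤ _ := by
              rw [one_mul]
              have : (p.2 : ℝ) ≤ d := by exact_mod_cast hpd
              gcongr
    _ = (d.divisorsAntidiagonal.card : ℝ) * (C * d ^ 4 * x ^ 2 / Real.log x ^ K) := by
        rw [Finset.sum_const, nsmul_eq_mul]
    _ ≤ d * (C * d ^ 4 * x ^ 2 / Real.log x ^ K) := by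
        gcongr
        rw [← Nat.map_div_right_divisors, Finset.card_map]
        exact Nat.card_divisors_le_self d
    _ = _ := by ring

end MontgomeryHooley

namespace MontgomeryHooley

open Complex MeasureTheory Filter Topology DirichletCharacter
open ArithmeticFunction (vonMangoldt)

/-- The multiplicative function `μ(d)² / φ(d)`. -/
noncomputable def sqfreeInvTotient (d : ℕ) : ℝ := if Squarefree d then 1 / (d.totient : ℝ) else 0

lemma sqfreeInvTotient_nonneg (d : ℕ) : 0 ≤ sqfreeInvTotient d := by
  unfold sqfreeInvTotient
  split_ifs <;> positivity

lemma sqfreeInvTotient_le (d : ℕ) : sqfreeInvTotient d ≤ 1 / (d.totient : ℝ) := by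
  unfold sqfreeInvTotient
  split_ifs
  · exact le_rfl
  · positivity

lemma sqfreeInvTotient_le_one (d : ℕ) : sqfreeInvTotient d ≤ 1 := by
  refine (sqfreeInvTotient_le d).trans ?_
  rcases Nat.eq_zero_or_pos d.totient with h | h
  · simp [h]
  · exact div_le_one_of_le₀ (by exact_mod_cast h) (by positivity)

lemma sum_Icc_sum_divisors (N : ℕ) (f : ℕ → ℕ → ℝ) :
    ∑ q ∈ Icc 1 N, ∑ d ∈ q.divisors, f d q =
      ∑ d ∈ Icc 1 N, ∑ m ∈ Icc 1 (N / d), f d (d * m) := by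
  rw [Finset.sum_sigma', Finset.sum_sigma']
  refine Finset.sum_nbij' (fun p => ⟨p.2, p.1 / p.2⟩) (fun p => ⟨p.1 * p.2, p.1⟩) ?_ ?_ ?_ ?_ ?_
  · rintro ⟨q, d⟩ h
    simp only [Finset.mem_sigma, Finset.mem_Icc, Nat.mem_divisors] at h ⊢
    obtain ⟨⟨h1, h2⟩, h3, h4⟩ := h
    have hd : 0 < d := Nat.pos_of_dvd_of_pos h3 h1
    exact ⟨⟨hd, (Nat.le_of_dvd h1 h3).trans h2⟩, Nat.div_pos (Nat.le_of_dvd h1 h3) hd,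
      Nat.div_le_div_right h2⟩
  · rintro ⟨d, m⟩ h
    simp only [Finset.mem_sigma, Finset.mem_Icc, Nat.mem_divisors] at h ⊢
    obtain ⟨⟨h1, h2⟩, h3, h4⟩ := h
    refine ⟨⟨Nat.mul_pos h1 h3, ?_⟩, dvd_mul_right _ _, (Nat.mul_pos h1 h3).ne'⟩
    rw [mul_comm]
    exact (Nat.le_div_iff_mul_le h1).mp h4
  · rintro ⟨q, d⟩ h
    simp only [Finset.mem_sigma, Nat.mem_divisors] at h
    simp only [Nat.mul_div_cancel' h.2.1]
  · rintro ⟨d, m⟩ h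
    simp only [Finset.mem_sigma, Finset.mem_Icc] at h
    simp only [Nat.mul_div_cancel_left m h.1.1]
  · rintro ⟨q, d⟩ h
    simp only [Finset.mem_sigma, Nat.mem_divisors] at h
    simp only [Nat.mul_div_cancel' h.2.1]

lemma one_div_totient_eq {q : ℕ} (hq : 1 ≤ q) :
    1 / (q.totient : ℝ) = ∑ d ∈ q.divisors, sqfreeInvTotient d / q := by
  have h := sum_divisors_squarefree_one_div_totient hq
  have hq0 : (q : ℝ) ≠ 0 := by positivity
  rw [← Finset.sum_div]
  unfold sqfreeInvTotient
  rw [h]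
  field_simp

lemma sum_mul_one_div_totient (N : ℕ) (F : ℕ → ℝ) :
    ∑ q ∈ Icc 1 N, F q * (1 / (q.totient : ℝ)) =
      ∑ d ∈ Icc 1 N, sqfreeInvTotient d / d * ∑ m ∈ Icc 1 (N / d), F (d * m) / m := by
  calc _ = ∑ q ∈ Icc 1 N, ∑ d ∈ q.divisors, F q * (sqfreeInvTotient d / q) :=
        Finset.sum_congr rfl fun q hq => by
          rw [one_div_totient_eq (Finset.mem_Icc.mp hq).1, Finset.mul_sum]
    _ = _ := by
        rw [sum_Icc_sum_divisors N fun d q => F q * (sqfreeInvTotient d / q)]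
        refine Finset.sum_congr rfl fun d hd => ?_
        rw [Finset.mul_sum]
        refine Finset.sum_congr rfl fun m hm => ?_
        have h1 : (d : ℝ) ≠ 0 := by
          have := (Finset.mem_Icc.mp hd).1
          positivity
        have h2 : (m : ℝ) ≠ 0 := by
          have := (Finset.mem_Icc.mp hm).1
          positivity
        push_cast
        field_simp

lemma sum_one_div_sq_le (n : ℕ) : ∑ m ∈ Icc 1 n, 1 / (m : ℝ) ^ 2 ≤ 2 - 1 / (n : ℝ) := by
  induction n with
  | zero => norm_num
  | succ n ih =>
    rw [Finset.sum_Icc_succ_top (by omega)]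
    rcases Nat.eq_zero_or_pos n with rfl | hn
    · norm_num
    · have h : 1 / ((n + 1 : ℕ) : ℝ) ^ 2 ≤ 1 / n - 1 / ((n + 1 : ℕ) : ℝ) := by
        have : (0 : ℝ) < n := by exact_mod_cast hn
        push_cast
        rw [div_sub_div _ _ (by positivity) (by positivity), div_le_div_iff₀ (by positivity)
          (by positivity)]
        nlinarith
      linarith

lemma sum_one_div_sq_le_two (n : ℕ) : ∑ m ∈ Icc 1 n, 1 / (m : ℝ) ^ 2 ≤ 2 :=
  (sum_one_div_sq_le n).trans (by simp)

lemma sum_one_div_mul_totient_le (N : ℕ) :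
    ∑ e ∈ Icc 1 N, 1 / (e : ℝ) * (1 / (e.totient : ℝ)) ≤ 4 := by
  rw [sum_mul_one_div_totient N fun e => 1 / (e : ℝ)]
  calc _ ≤ ∑ d ∈ Icc 1 N, 1 / (d : ℝ) ^ 2 * 2 := by
        refine Finset.sum_le_sum fun d hd => ?_
        have h1 : ∑ m ∈ Icc 1 (N / d), 1 / ((d * m : ℕ) : ℝ) / m =
            1 / d * ∑ m ∈ Icc 1 (N / d), 1 / (m : ℝ) ^ 2 := by
          rw [Finset.mul_sum]
          refine Finset.sum_congr rfl fun m _ => ?_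
          push_cast
          rw [div_div, mul_assoc, ← sq, one_div_mul_one_div]
        rw [h1, ← mul_assoc]
        refine mul_le_mul ?_ (sum_one_div_sq_le_two _)
          (Finset.sum_nonneg fun m _ => by positivity) (by positivity)
        rw [div_mul_div_comm, mul_one, ← sq]
        gcongr
        exact sqfreeInvTotient_le_one d
    _ ≤ 4 := by
        rw [← Finset.sum_mul]
        linarith [sum_one_div_sq_le_two N]

lemma sum_sqfreeInvTotient_div_le (N : ℕ) :
    ∑ d ∈ Icc 1 N, sqfreeInvTotient d / d ≤ 4 := by
  refine le_trans (Finset.sum_le_sum fun d _ => ?_) (sum_one_div_mul_totient_le N)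
  rw [one_div_mul_eq_div]
  have := sqfreeInvTotient_le d
  gcongr

lemma sum_one_div_le_one_add_log {n N : ℕ} (hn : n ≤ N) :
    ∑ m ∈ Icc 1 n, 1 / (m : ℝ) ≤ 1 + Real.log N := by
  calc _ ≤ ∑ m ∈ Icc 1 N, 1 / (m : ℝ) :=
        Finset.sum_le_sum_of_subset_of_nonneg (Finset.Icc_subset_Icc_right hn)
          fun _ _ _ => by positivity
    _ = (harmonic N : ℝ) := by
        rw [harmonic_eq_sum_Icc]
        push_cast
        simp_rw [one_div]
    _ ≤ _ := harmonic_le_one_add_log N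

lemma sum_one_div_totient_le (N : ℕ) :
    ∑ q ∈ Icc 1 N, 1 / (q.totient : ℝ) ≤ 4 * (1 + Real.log N) := by
  have h := sum_mul_one_div_totient N fun _ => 1
  simp only [one_mul] at h
  rw [h]
  calc _ ≤ ∑ d ∈ Icc 1 N, sqfreeInvTotient d / d * (1 + Real.log N) := by
        refine Finset.sum_le_sum fun d _ => ?_
        refine mul_le_mul_of_nonneg_left (sum_one_div_le_one_add_log (Nat.div_le_self N d)) ?_
        have := sqfreeInvTotient_nonneg d
        positivity
    _ ≤ _ := by
        rw [← Finset.sum_mul]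
        have : 0 ≤ Real.log N := Real.log_natCast_nonneg N
        gcongr
        exact sum_sqfreeInvTotient_div_le N

lemma one_div_mul_sqrt_le {m : ℕ} (hm : 1 ≤ m) :
    1 / (√(m : ℝ) * m) ≤ 4 * (1 / √(m : ℝ) - 1 / √((m + 1 : ℕ) : ℝ)) := by
  have hm' : (1 : ℝ) ≤ m := by exact_mod_cast hm
  push_cast
  set a := √(m : ℝ) with ha
  set b := √((m : ℝ) + 1) with hb
  have ha2 : a ^ 2 = m := Real.sq_sqrt (by positivity)
  have hb2 : b ^ 2 = m + 1 := Real.sq_sqrt (by positivity)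
  have ha0 : 0 < a := Real.sqrt_pos.mpr (by positivity)
  have hab : a ≤ b := Real.sqrt_le_sqrt (by linarith)
  have hb0 : 0 < b := by linarith
  have h1 : 1 / a - 1 / b = 1 / (a * b * (a + b)) := by
    have : (b - a) * (a + b) = 1 := by nlinarith
    rw [div_sub_div _ _ ha0.ne' hb0.ne', div_eq_div_iff (by positivity) (by positivity)]
    linear_combination (a * b) * this
  rw [h1, mul_one_div, div_le_div_iff₀ (by positivity) (by positivity)]
  have : b * (a + b) ≤ 4 * m := by nlinarith
  nlinarith

lemma sum_one_div_mul_sqrt_le {k : ℕ} (hk : 1 ≤ k) (n : ℕ) :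
    ∑ m ∈ Icc k n, 1 / (√(m : ℝ) * m) ≤ 4 / √(k : ℝ) := by
  rcases le_or_gt k n with hkn | hkn
  · have h : ∑ m ∈ Icc k n, 1 / (√(m : ℝ) * m) ≤
        4 * (1 / √(k : ℝ) - 1 / √((n + 1 : ℕ) : ℝ)) := by
      induction n, hkn using Nat.le_induction with
      | base => simpa using one_div_mul_sqrt_le hk
      | succ n hn ih =>
        rw [Finset.sum_Icc_succ_top (by omega)]
        have := one_div_mul_sqrt_le (m := n + 1) (by omega)
        linarith
    refine h.trans ?_
    have : 0 ≤ 1 / √((n + 1 : ℕ) : ℝ) := by positivity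
    rw [show 4 / √(k : ℝ) = 4 * (1 / √(k : ℝ)) by ring]
    linarith
  · rw [Finset.Icc_eq_empty (by omega), Finset.sum_empty]
    positivity

lemma sum_one_div_totient_mul_sqrt_le (M N : ℕ) :
    ∑ q ∈ Ioc M N, 1 / √(q : ℝ) * (1 / (q.totient : ℝ)) ≤ 16 / √((M + 1 : ℕ) : ℝ) := by
  have h0 : ∑ q ∈ Ioc M N, 1 / √(q : ℝ) * (1 / (q.totient : ℝ)) =
      ∑ q ∈ Icc 1 N, (if M < q then 1 / √(q : ℝ) else 0) * (1 / (q.totient : ℝ)) := by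
    simp_rw [ite_mul, zero_mul]
    rw [← Finset.sum_filter]
    refine Finset.sum_congr ?_ fun _ _ => rfl
    ext q
    simp only [Finset.mem_Ioc, Finset.mem_filter, Finset.mem_Icc]
    omega
  rw [h0, sum_mul_one_div_totient]
  calc _ ≤ ∑ d ∈ Icc 1 N, sqfreeInvTotient d / d * (4 / √((M + 1 : ℕ) : ℝ)) := by
        refine Finset.sum_le_sum fun d hd => ?_
        have hd1 : 1 ≤ d := (Finset.mem_Icc.mp hd).1
        refine mul_le_mul_of_nonneg_left ?_ (div_nonneg (sqfreeInvTotient_nonneg d) (by positivity))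
        have h1 : M + 1 ≤ d * (M / d + 1) :=
          Nat.lt_mul_div_succ M hd1
        calc _ ≤ ∑ m ∈ Icc (M / d + 1) (N / d), 1 / √((d * m : ℕ) : ℝ) / m := by
              simp_rw [ite_div, zero_div]
              rw [← Finset.sum_filter]
              refine Finset.sum_le_sum_of_subset_of_nonneg ?_ fun _ _ _ => by positivity
              intro m hm
              simp only [Finset.mem_filter, Finset.mem_Icc] at hm ⊢
              refine ⟨Nat.succ_le_of_lt ((Nat.div_lt_iff_lt_mul hd1).mpr ?_), hm.1.2⟩
              rw [mul_comm]
              exact hm.2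
          _ = 1 / √(d : ℝ) * ∑ m ∈ Icc (M / d + 1) (N / d), 1 / (√(m : ℝ) * m) := by
              rw [Finset.mul_sum]
              refine Finset.sum_congr rfl fun m _ => ?_
              rw [Nat.cast_mul, Real.sqrt_mul (by positivity), div_div, one_div_mul_one_div,
                mul_assoc]
          _ ≤ 1 / √(d : ℝ) * (4 / √((M / d + 1 : ℕ) : ℝ)) := by
              gcongr
              exact sum_one_div_mul_sqrt_le (Nat.le_add_left 1 _) _
          _ = 4 / √((d * (M / d + 1) : ℕ) : ℝ) := by
              rw [Nat.cast_mul, Real.sqrt_mul (by positivity), div_mul_div_comm, one_mul]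
          _ ≤ _ := by
              have h2 : ((M + 1 : ℕ) : ℝ) ≤ ((d * (M / d + 1) : ℕ) : ℝ) := by exact_mod_cast h1
              gcongr
    _ ≤ 4 * (4 / √((M + 1 : ℕ) : ℝ)) := by
        rw [← Finset.sum_mul]
        gcongr
        exact sum_sqfreeInvTotient_div_le N
    _ = _ := by ring

end MontgomeryHooley

namespace MontgomeryHooley

open Complex MeasureTheory Filter Topology DirichletCharacter
open ArithmeticFunction (vonMangoldt)

/-- The constant `∑ μ(d)² / (d φ(d))`. -/
noncomputable def totientConst : ℝ := ∑' d : ℕ, sqfreeInvTotient d / d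

lemma log_le_two_mul_sqrt {y : ℝ} (hy : 0 < y) : Real.log y ≤ 2 * √y := by
  have h := Real.log_le_sub_one_of_pos (Real.sqrt_pos.mpr hy)
  rw [Real.log_sqrt hy.le] at h
  linarith

lemma sum_range_succ_eq_sum_Icc {f : ℕ → ℝ} (h0 : f 0 = 0) (N : ℕ) :
    ∑ d ∈ range (N + 1), f d = ∑ d ∈ Icc 1 N, f d := by
  rw [Finset.range_eq_Ico, Finset.sum_eq_sum_Ico_succ_bot (by omega), h0, zero_add]
  rfl

lemma summable_and_tendsto_of_sum_Icc_le {f : ℕ → ℝ} (h0 : f 0 = 0) (hf : ∀ d, 0 ≤ f d) {B : ℝ}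
    (hB : ∀ N, ∑ d ∈ Icc 1 N, f d ≤ B) :
    Tendsto (fun N => ∑ d ∈ Icc 1 N, f d) atTop (𝓝 (∑' d, f d)) := by
  have hs : Summable f := summable_of_sum_range_le (c := B) hf fun n => by
    refine le_trans ?_ (hB n)
    rw [← sum_range_succ_eq_sum_Icc h0, Finset.sum_range_succ]
    linarith [hf n]
  have h := (tendsto_add_atTop_iff_nat 1).mpr hs.hasSum.tendsto_sum_nat
  simpa only [sum_range_succ_eq_sum_Icc h0] using h

lemma tendsto_sum_sqfreeInvTotient :
    Tendsto (fun N : ℕ => ∑ d ∈ Icc 1 N, sqfreeInvTotient d / d) atTop (𝓝 totientConst) :=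
  summable_and_tendsto_of_sum_Icc_le (by simp)
    (fun d => div_nonneg (sqfreeInvTotient_nonneg d) (by positivity)) sum_sqfreeInvTotient_div_le

lemma sqfreeInvTotient_div_mul_sqrt_le (d : ℕ) :
    sqfreeInvTotient d / d * √(d : ℝ) ≤ 1 / √(d : ℝ) * (1 / (d.totient : ℝ)) := by
  rcases Nat.eq_zero_or_pos d with rfl | hd
  · simp
  have h1 : (0 : ℝ) < √(d : ℝ) := Real.sqrt_pos.mpr (by exact_mod_cast hd)
  have h2 : (d : ℝ) = √(d : ℝ) * √(d : ℝ) := (Real.mul_self_sqrt (by positivity)).symm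
  have h3 := sqfreeInvTotient_le d
  calc _ = 1 / √(d : ℝ) * sqfreeInvTotient d := by
        conv_lhs => enter [1, 2]; rw [h2]
        field_simp
    _ ≤ _ := by gcongr

lemma tendsto_sum_sqfreeInvTotient_mul_log :
    Tendsto (fun N : ℕ => ∑ d ∈ Icc 1 N, sqfreeInvTotient d / d * Real.log d) atTop
      (𝓝 (∑' d : ℕ, sqfreeInvTotient d / d * Real.log d)) := by
  refine summable_and_tendsto_of_sum_Icc_le (B := 2 * 16) (by simp) (fun d => mul_nonneg
    (div_nonneg (sqfreeInvTotient_nonneg d) (by positivity)) (Real.log_natCast_nonneg d)) ?_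
  intro N
  calc _ ≤ ∑ d ∈ Icc 1 N, 2 * (1 / √(d : ℝ) * (1 / (d.totient : ℝ))) := by
        refine Finset.sum_le_sum fun d hd => ?_
        have hd0 : (0 : ℝ) < d := by exact_mod_cast (Finset.mem_Icc.mp hd).1
        have h1 := sqfreeInvTotient_div_mul_sqrt_le d
        calc _ ≤ sqfreeInvTotient d / d * (2 * √(d : ℝ)) :=
              mul_le_mul_of_nonneg_left (log_le_two_mul_sqrt hd0)
                (div_nonneg (sqfreeInvTotient_nonneg d) (by positivity))
          _ ≤ _ := by linarith
    _ ≤ 2 * 16 := by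
        rw [← Finset.mul_sum]
        have := sum_one_div_totient_mul_sqrt_le 0 N
        simp only [zero_add, Nat.cast_one, Real.sqrt_one, div_one] at this
        exact mul_le_mul_of_nonneg_left this zero_le_two

/-- Asymptotics of `∑ μ(d)² g(z/d) / (d φ(d))` when `g` is close to a shifted logarithm. -/
theorem abs_sum_sqfreeInvTotient_mul_sub_le {g : ℝ → ℝ} {c C₀ : ℝ} (hC₀ : 0 ≤ C₀)
    (hg : ∀ w, 1 ≤ w → |g w - (Real.log w + c)| ≤ C₀ / w) :
    ∃ c' C' : ℝ, 0 < C' ∧ ∀ z : ℝ, 1 ≤ z →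
      |∑ d ∈ Icc 1 ⌊z⌋₊, sqfreeInvTotient d / d * g (z / d) - (totientConst * Real.log z + c')| ≤
        C' * (1 + Real.log z) / z := by
  set b := ∑' d : ℕ, sqfreeInvTotient d / d * Real.log d with hb
  refine ⟨c * totientConst - b, 4 * C₀ + 16 * (2 + |c|), by positivity, fun z hz => ?_⟩
  have hz0 : 0 < z := by linarith
  have hlz : 0 ≤ Real.log z := Real.log_nonneg hz
  set M := ⌊z⌋₊ with hM
  have hM1 : 1 ≤ M := Nat.le_floor (by simpa using hz)
  have hMz : (M : ℝ) ≤ z := Nat.floor_le hz0.le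
  have hzM : z < ((M + 1 : ℕ) : ℝ) := by push_cast; exact Nat.lt_floor_add_one z
  have hbound : ∀ N ≥ M, |∑ d ∈ Icc 1 M, sqfreeInvTotient d / d * g (z / d) -
      (Real.log z + c) * ∑ d ∈ Icc 1 N, sqfreeInvTotient d / d +
      ∑ d ∈ Icc 1 N, sqfreeInvTotient d / d * Real.log d| ≤
      (4 * C₀ + 16 * (2 + |c|)) * (1 + Real.log z) / z := by
    intro N hN
    have hsplit : ∀ f : ℕ → ℝ, ∑ d ∈ Icc 1 N, f d = ∑ d ∈ Icc 1 M, f d + ∑ d ∈ Ioc M N, f d :=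
      fun f => (Finset.sum_Ioc_consecutive f (Nat.zero_le M) hN).symm
    have e : ∑ d ∈ Icc 1 M, sqfreeInvTotient d / d * g (z / d) -
        (Real.log z + c) * ∑ d ∈ Icc 1 N, sqfreeInvTotient d / d +
        ∑ d ∈ Icc 1 N, sqfreeInvTotient d / d * Real.log d =
        ∑ d ∈ Icc 1 M, sqfreeInvTotient d / d * (g (z / d) - (Real.log z - Real.log d + c)) +
        ∑ d ∈ Ioc M N, sqfreeInvTotient d / d * (Real.log d - Real.log z - c) := by
      rw [hsplit, hsplit]
      simp only [mul_sub, mul_add, Finset.sum_sub_distrib, Finset.sum_add_distrib,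
        ← Finset.sum_mul]
      ring
    rw [e]
    have h1 : |∑ d ∈ Icc 1 M, sqfreeInvTotient d / d *
        (g (z / d) - (Real.log z - Real.log d + c))| ≤ 4 * C₀ * (1 + Real.log z) / z := by
      calc _ ≤ ∑ d ∈ Icc 1 M, C₀ / z * (1 / (d.totient : ℝ)) := by
            refine (Finset.abs_sum_le_sum_abs _ _).trans (Finset.sum_le_sum fun d hd => ?_)
            obtain ⟨hd1, hdM⟩ := Finset.mem_Icc.mp hd
            have hd0 : (0 : ℝ) < d := by exact_mod_cast hd1
            have hdz : (d : ℝ) ≤ z := le_trans (by exact_mod_cast hdM) hMz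
            have h := hg (z / d) ((one_le_div hd0).mpr hdz)
            rw [Real.log_div hz0.ne' hd0.ne'] at h
            have hh := sqfreeInvTotient_nonneg d
            rw [abs_mul, abs_of_nonneg (by positivity)]
            calc _ ≤ sqfreeInvTotient d / d * (C₀ / (z / d)) := by gcongr
              _ = C₀ / z * sqfreeInvTotient d := by field_simp
              _ ≤ _ := by
                gcongr
                exact sqfreeInvTotient_le d
        _ = C₀ / z * ∑ d ∈ Icc 1 M, 1 / (d.totient : ℝ) := by rw [Finset.mul_sum]
        _ ≤ C₀ / z * (4 * (1 + Real.log M)) := by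
            gcongr
            exact sum_one_div_totient_le M
        _ ≤ C₀ / z * (4 * (1 + Real.log z)) := by gcongr
        _ = _ := by ring
    have h2 : |∑ d ∈ Ioc M N, sqfreeInvTotient d / d * (Real.log d - Real.log z - c)| ≤
        16 * (2 + |c|) / z := by
      calc _ ≤ ∑ d ∈ Ioc M N, (2 + |c|) / √z * (1 / √(d : ℝ) * (1 / (d.totient : ℝ))) := by
            refine (Finset.abs_sum_le_sum_abs _ _).trans (Finset.sum_le_sum fun d hd => ?_)
            obtain ⟨hdM, -⟩ := Finset.mem_Ioc.mp hd
            have hzd : z ≤ d := hzM.le.trans (by exact_mod_cast hdM)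
            have hd0 : (0 : ℝ) < d := by linarith
            have hh := sqfreeInvTotient_nonneg d
            have hsz : 0 < √z := Real.sqrt_pos.mpr hz0
            have hq : 1 ≤ √((d : ℝ) / z) := by
              rw [Real.one_le_sqrt]
              exact (one_le_div hz0).mpr hzd
            have hl := log_le_two_mul_sqrt (div_pos hd0 hz0)
            rw [Real.log_div hd0.ne' hz0.ne'] at hl
            have hlog : |Real.log d - Real.log z - c| ≤ (2 + |c|) * √((d : ℝ) / z) := by
              refine (abs_sub _ _).trans ?_
              rw [abs_of_nonneg (sub_nonneg.mpr (Real.log_le_log hz0 hzd))]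
              nlinarith [abs_nonneg c]
            rw [abs_mul, abs_of_nonneg (by positivity)]
            calc _ ≤ sqfreeInvTotient d / d * ((2 + |c|) * √((d : ℝ) / z)) := by gcongr
              _ = (2 + |c|) / √z * (sqfreeInvTotient d / d * √(d : ℝ)) := by
                rw [Real.sqrt_div hd0.le]; ring
              _ ≤ _ := by
                gcongr ?_ * ?_
                exact sqfreeInvTotient_div_mul_sqrt_le d
        _ = (2 + |c|) / √z * ∑ d ∈ Ioc M N, 1 / √(d : ℝ) * (1 / (d.totient : ℝ)) := by
            rw [Finset.mul_sum]
        _ ≤ (2 + |c|) / √z * (16 / √((M + 1 : ℕ) : ℝ)) := by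
            gcongr
            exact sum_one_div_totient_mul_sqrt_le M N
        _ ≤ (2 + |c|) / √z * (16 / √z) := by
            have : 0 < √z := Real.sqrt_pos.mpr hz0
            gcongr
        _ = _ := by
            rw [div_mul_div_comm, Real.mul_self_sqrt hz0.le]
            ring
    refine (abs_add_le _ _).trans ((add_le_add h1 h2).trans ?_)
    rw [← add_div]
    gcongr
    nlinarith [abs_nonneg c]
  have hlim := ((tendsto_sum_sqfreeInvTotient.const_mul (Real.log z + c)).const_sub
    (∑ d ∈ Icc 1 M, sqfreeInvTotient d / d * g (z / d))).add tendsto_sum_sqfreeInvTotient_mul_log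
  have := le_of_tendsto hlim.abs (eventually_atTop.mpr ⟨M, hbound⟩)
  refine (le_of_eq ?_).trans this
  congr 1
  ring

lemma abs_sum_one_div_sub_le {w : ℝ} (hw : 1 ≤ w) :
    |∑ m ∈ Icc 1 ⌊w⌋₊, 1 / (m : ℝ) - (Real.log w + Real.eulerMascheroniConstant)| ≤ 2 / w := by
  set n := ⌊w⌋₊ with hn
  have hn1 : 1 ≤ n := Nat.le_floor (by simpa using hw)
  have hn1' : (1 : ℝ) ≤ n := by exact_mod_cast hn1
  have hnw : (n : ℝ) ≤ w := Nat.floor_le (by linarith)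
  have hwn : w < n + 1 := Nat.lt_floor_add_one w
  have hs : ∑ m ∈ Icc 1 n, 1 / (m : ℝ) = (harmonic n : ℝ) := by
    rw [harmonic_eq_sum_Icc]
    push_cast
    simp_rw [one_div]
  have h1 := Real.eulerMascheroniSeq_lt_eulerMascheroniConstant n
  have h2 := Real.eulerMascheroniConstant_lt_eulerMascheroniSeq' n
  rw [Real.eulerMascheroniSeq] at h1
  rw [Real.eulerMascheroniSeq', if_neg (by omega)] at h2
  have h3 : Real.log (n + 1) - Real.log n ≤ 1 / n := by
    rw [← Real.log_div (by positivity) (by positivity)]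
    have := Real.log_le_sub_one_of_pos (show (0 : ℝ) < (n + 1) / n by positivity)
    have e : ((n : ℝ) + 1) / n - 1 = 1 / n := by field_simp; ring
    linarith
  have h4 : Real.log n ≤ Real.log w := Real.log_le_log (by positivity) hnw
  have h5 : Real.log w ≤ Real.log (n + 1) := Real.log_le_log (by positivity) hwn.le
  have h6 : 1 / (n : ℝ) ≤ 2 / w := by
    rw [div_le_div_iff₀ (by positivity) (by positivity)]
    linarith
  rw [hs, abs_le]
  constructor <;> linarith

theorem abs_sum_one_div_totient_sub_le : ∃ c C : ℝ, 0 < C ∧ ∀ z : ℝ, 1 ≤ z →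
    |∑ q ∈ Icc 1 ⌊z⌋₊, 1 / (q.totient : ℝ) - (totientConst * Real.log z + c)| ≤
      C * (1 + Real.log z) / z := by
  obtain ⟨c, C, hC, h⟩ := abs_sum_sqfreeInvTotient_mul_sub_le
    (g := fun w => ∑ m ∈ Icc 1 ⌊w⌋₊, 1 / (m : ℝ)) (c := Real.eulerMascheroniConstant)
    (C₀ := 2) zero_le_two fun w hw => abs_sum_one_div_sub_le hw
  refine ⟨c, C, hC, fun z hz => ?_⟩
  convert h z hz using 3
  have := sum_mul_one_div_totient ⌊z⌋₊ fun _ => 1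
  simp only [one_mul] at this
  rw [this]
  refine Finset.sum_congr rfl fun d _ => ?_
  rw [Nat.floor_div_natCast]

lemma sum_Icc_natCast (n : ℕ) : ∑ m ∈ Icc 1 n, (m : ℝ) = n * (n + 1) / 2 := by
  induction n with
  | zero => simp
  | succ n ih =>
    rw [Finset.sum_Icc_succ_top (by omega), ih]
    push_cast
    ring

lemma abs_sum_one_sub_sq_div_sub_le {w : ℝ} (hw : 1 ≤ w) :
    |∑ m ∈ Icc 1 ⌊w⌋₊, (1 - m / w) ^ 2 / (m : ℝ) -
      (Real.log w + (Real.eulerMascheroniConstant - 3 / 2))| ≤ 5 / w := by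
  have h := abs_le.mp (abs_sum_one_div_sub_le hw)
  have hw0 : 0 < w := by linarith
  set n := ⌊w⌋₊ with hn
  have hnw : (n : ℝ) ≤ w := Nat.floor_le (by linarith)
  have hwn : w < n + 1 := Nat.lt_floor_add_one w
  have e : ∑ m ∈ Icc 1 n, (1 - m / w) ^ 2 / (m : ℝ) =
      ∑ m ∈ Icc 1 n, 1 / (m : ℝ) - 2 * (n / w) + n * (n + 1) / 2 / w ^ 2 := by
    have : ∀ m ∈ Icc 1 n, (1 - m / w) ^ 2 / (m : ℝ) = 1 / m - 2 / w + m / w ^ 2 := by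
      intro m hm
      have : (0 : ℝ) < m := by exact_mod_cast (Finset.mem_Icc.mp hm).1
      field_simp
      ring
    rw [Finset.sum_congr rfl this, Finset.sum_add_distrib, Finset.sum_sub_distrib,
      ← Finset.sum_div (Icc 1 n) (fun m : ℕ => (m : ℝ)), sum_Icc_natCast, Finset.sum_const, Nat.card_Icc, nsmul_eq_mul]
    simp only [Nat.add_sub_cancel]
    ring
  have e1 : 1 - 1 / w ≤ n / w := by
    rw [one_sub_div hw0.ne']
    gcongr
    linarith
  have e2 : (n : ℝ) / w ≤ 1 := div_le_one_of_le₀ hnw hw0.le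
  have e3 : (n : ℝ) * (n + 1) / 2 / w ^ 2 = ((n / w) ^ 2 + (n / w) * (1 / w)) / 2 := by
    field_simp
  rw [e, e3]
  set u := (n : ℝ) / w with hu
  set v := 1 / w with hv
  have hv0 : 0 < v := by positivity
  have hv1 : v ≤ 1 := div_le_one_of_le₀ hw hw0.le
  have hu0 : 0 ≤ u := by positivity
  rw [show 2 / w = 2 * v by rw [hv]; ring] at h
  rw [show 5 / w = 5 * v by rw [hv]; ring, abs_le]
  constructor <;> nlinarith

theorem abs_sum_one_sub_sq_div_totient_sub_le : ∃ c C : ℝ, 0 < C ∧ ∀ z : ℝ, 1 ≤ z →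
    |∑ r ∈ Icc 1 ⌊z⌋₊, (1 - r / z) ^ 2 / (r.totient : ℝ) - (totientConst * Real.log z + c)| ≤
      C * (1 + Real.log z) / z := by
  obtain ⟨c, C, hC, h⟩ := abs_sum_sqfreeInvTotient_mul_sub_le
    (g := fun w => ∑ m ∈ Icc 1 ⌊w⌋₊, (1 - m / w) ^ 2 / (m : ℝ))
    (c := Real.eulerMascheroniConstant - 3 / 2) (C₀ := 5) (by norm_num)
    fun w hw => abs_sum_one_sub_sq_div_sub_le hw
  refine ⟨c, C, hC, fun z hz => ?_⟩
  convert h z hz using 3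
  have := sum_mul_one_div_totient ⌊z⌋₊ fun r => (1 - r / z) ^ 2
  simp only [mul_one_div] at this
  rw [this]
  refine Finset.sum_congr rfl fun d hd => ?_
  have hd0 : (0 : ℝ) < d := by exact_mod_cast (Finset.mem_Icc.mp hd).1
  rw [Nat.floor_div_natCast]
  congr 1
  refine Finset.sum_congr rfl fun m _ => ?_
  have hz0 : 0 < z := by linarith
  congr 3
  push_cast
  field_simp

end MontgomeryHooley

namespace MontgomeryHooley

open Complex MeasureTheory Filter Topology DirichletCharacter
open ArithmeticFunction (vonMangoldt)

/-- The contribution of the modulus `q` to the variance `V`. -/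
noncomputable def varianceTerm (x : ℝ) (q : ℕ) : ℝ :=
  ∑ a ∈ (Finset.Icc 1 q).filter (fun a => Nat.gcd a q = 1),
    (psi x q a - x / (Nat.totient q : ℝ)) ^ 2

lemma V_eq_sum_varianceTerm (x Q : ℝ) : V x Q = ∑ q ∈ Icc 1 ⌊Q⌋₊, varianceTerm x q := rfl

lemma one_le_log_of_le {x : ℝ} (hx : 256 ≤ x) : 1 ≤ Real.log x := by
  rw [Real.le_log_iff_exp_le (by linarith)]
  linarith [Real.exp_one_lt_d9]

lemma card_primeFactors_le_two_mul_log {q : ℕ} (hq : 1 ≤ q) :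
    (q.primeFactors.card : ℝ) ≤ 2 * Real.log q := by
  have h : 2 ^ q.primeFactors.card ≤ q :=
    calc 2 ^ q.primeFactors.card = ∏ _p ∈ q.primeFactors, 2 := by rw [Finset.prod_const]
      _ ≤ ∏ p ∈ q.primeFactors, p :=
        Finset.prod_le_prod' fun p hp => (Nat.prime_of_mem_primeFactors hp).two_le
      _ ≤ q := Nat.le_of_dvd hq (Nat.prod_primeFactors_dvd q)
  have h2 : (2 : ℝ) ^ q.primeFactors.card ≤ q := by exact_mod_cast h
  have h3 := Real.log_le_log (by positivity) h2
  rw [Real.log_pow] at h3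
  nlinarith [Real.log_two_gt_d9, (Nat.cast_nonneg q.primeFactors.card : (0 : ℝ) ≤ _)]

lemma sum_vonMangoldt_not_coprime_le_log {q : ℕ} (hq : 1 ≤ q) {x : ℝ} (hqx : q ≤ x)
    (hx : 256 ≤ x) :
    ∑ n ∈ (Icc 1 ⌊x⌋₊).filter (fun n => ¬ n.Coprime q), vonMangoldt n ≤ 6 * Real.log x ^ 3 := by
  have hL := one_le_log_of_le hx
  have hq0 : (0 : ℝ) < q := by exact_mod_cast hq
  calc _ ≤ q.primeFactors.card * (2 * Real.log x + 1) * Real.log x :=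
        sum_vonMangoldt_not_coprime_le_card hq (by linarith)
    _ ≤ (2 * Real.log x) * (3 * Real.log x) * Real.log x := by
        have h1 := card_primeFactors_le_two_mul_log hq
        have h2 := Real.log_le_log hq0 hqx
        gcongr <;> linarith
    _ = _ := by ring

lemma psi_one_one (x : ℝ) : psi x 1 1 = ∑ n ∈ Icc 1 ⌊x⌋₊, vonMangoldt n := by
  rw [psi, Finset.filter_true_of_mem fun n _ => by simp [Nat.mod_one]]

lemma abs_sum_vonMangoldt_sub_le (K : ℕ) : ∃ C : ℝ, 0 < C ∧ ∀ (x u : ℝ), 256 ≤ x → 0 ≤ u →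
    u ≤ x → |∑ n ∈ Icc 1 ⌊u⌋₊, vonMangoldt n - u| ≤ C * x / Real.log x ^ K := by
  obtain ⟨C, hC, h⟩ := abs_psi_sub_div_totient_le K
  refine ⟨C, hC, fun x u hx hu hux => ?_⟩
  have := h 1 1 x u le_rfl (by simp) hx hu hux
  rw [psi_one_one] at this
  simpa using this

theorem abs_varianceTerm_sub_le (K : ℕ) : ∃ C : ℝ, 0 < C ∧ ∀ (q : ℕ) (x : ℝ), 1 ≤ q → q ≤ x →
    256 ≤ x → |varianceTerm x q - (secondMoment x q - x ^ 2 / (q.totient : ℝ))| ≤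
      C * (x ^ 2 / Real.log x ^ K * (1 / (q.totient : ℝ)) + x) := by
  obtain ⟨C₁, hC₁, h₁⟩ := abs_sum_vonMangoldt_sub_le K
  obtain ⟨C₂, hC₂, h₂⟩ := exists_log_pow_le (K + 3)
  obtain ⟨C₃, hC₃, h₃⟩ := exists_log_pow_le 6
  refine ⟨2 * C₁ + 12 * C₂ + 36 * C₃, by positivity, fun q x hq hqx hx => ?_⟩
  have hx0 : 0 < x := by linarith
  have hL := one_le_log_of_le hx
  set L := Real.log x with hLdef
  set φ : ℝ := (q.totient : ℝ) with hφ
  have hφ0 : 0 < φ := by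
    rw [hφ]; exact_mod_cast Nat.totient_pos.mpr hq
  have hn : ∑ a ∈ (Icc 1 q).filter (fun a => ¬ a.Coprime q), psi x q a =
      ∑ n ∈ (Icc 1 ⌊x⌋₊).filter (fun n => ¬ n.Coprime q), vonMangoldt n :=
    sum_psi_filter_eq x hq _ fun m a h => not_congr (coprime_iff_of_mod_eq m a h)
  have hc : ∑ a ∈ (Icc 1 q).filter (fun a => a.Coprime q), psi x q a =
      ∑ n ∈ (Icc 1 ⌊x⌋₊).filter (fun n => n.Coprime q), vonMangoldt n :=
    sum_psi_filter_eq x hq _ fun m a h => coprime_iff_of_mod_eq m a h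
  have htot := Finset.sum_filter_add_sum_filter_not (Icc 1 ⌊x⌋₊) (fun n => n.Coprime q)
    (fun n => vonMangoldt n)
  set Nc := ∑ n ∈ (Icc 1 ⌊x⌋₊).filter (fun n => ¬ n.Coprime q), vonMangoldt n with hNc
  have hNc0 : 0 ≤ Nc := Finset.sum_nonneg fun _ _ => ArithmeticFunction.vonMangoldt_nonneg
  have hNc1 : Nc ≤ 6 * L ^ 3 := sum_vonMangoldt_not_coprime_le_log hq hqx hx
  have hψ := h₁ x x hx hx0.le le_rfl
  have hL3 : 6 * L ^ 3 ≤ 6 * C₂ * (x / L ^ K) := by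
    have : L ^ 3 = L ^ (K + 3) / L ^ K := by field_simp; ring
    rw [this]
    have := h₂ x (by linarith)
    calc _ ≤ 6 * (C₂ * x / L ^ K) := by gcongr
      _ = _ := by ring
  have hsq : ∑ a ∈ (Icc 1 q).filter (fun a => ¬ a.Coprime q), psi x q a ^ 2 ≤ 36 * C₃ * x := by
    calc _ ≤ (∑ a ∈ (Icc 1 q).filter (fun a => ¬ a.Coprime q), psi x q a) ^ 2 :=
          Finset.sum_sq_le_sq_sum_of_nonneg fun a _ => psi_nonneg x q a
      _ ≤ (6 * L ^ 3) ^ 2 := by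
          rw [hn]
          gcongr
      _ = 36 * L ^ 6 := by ring
      _ ≤ 36 * (C₃ * x) := by
          gcongr
          exact h₃ x (by linarith)
      _ = _ := by ring
  have hsq0 : 0 ≤ ∑ a ∈ (Icc 1 q).filter (fun a => ¬ a.Coprime q), psi x q a ^ 2 :=
    Finset.sum_nonneg fun _ _ => by positivity
  have hvar : varianceTerm x q = ∑ a ∈ (Icc 1 q).filter (fun a => a.Coprime q), psi x q a ^ 2 -
      2 * (x / φ) * ∑ a ∈ (Icc 1 q).filter (fun a => a.Coprime q), psi x q a + x ^ 2 / φ := by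
    have hcard : (((Icc 1 q).filter (fun a => a.Coprime q)).card : ℝ) = φ := by
      rw [card_filter_coprime_Icc]
    have e : x ^ 2 / φ = ∑ a ∈ (Icc 1 q).filter (fun a => a.Coprime q), (x / φ) ^ 2 := by
      rw [Finset.sum_const, nsmul_eq_mul, hcard]
      field_simp
    rw [e, Finset.mul_sum, ← Finset.sum_sub_distrib, ← Finset.sum_add_distrib]
    refine Finset.sum_congr rfl fun a _ => ?_
    ring
  have hsplit : secondMoment x q = ∑ a ∈ (Icc 1 q).filter (fun a => a.Coprime q), psi x q a ^ 2 +
      ∑ a ∈ (Icc 1 q).filter (fun a => ¬ a.Coprime q), psi x q a ^ 2 := by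
    rw [secondMoment, Finset.sum_filter_add_sum_filter_not]
  set Sn := ∑ a ∈ (Icc 1 q).filter (fun a => ¬ a.Coprime q), psi x q a ^ 2
  set Sc := ∑ a ∈ (Icc 1 q).filter (fun a => a.Coprime q), psi x q a ^ 2
  set Mc := ∑ n ∈ (Icc 1 ⌊x⌋₊).filter (fun n => n.Coprime q), vonMangoldt n
  have e : varianceTerm x q - (secondMoment x q - x ^ 2 / φ) = -(2 * (x / φ) * (Mc - x)) - Sn := by
    rw [hvar, hsplit, hc]
    field_simp
    ring
  have hMc : |Mc - x| ≤ (C₁ + 6 * C₂) * (x / L ^ K) := by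
    have e2 : Mc - x = (∑ n ∈ Icc 1 ⌊x⌋₊, vonMangoldt n - x) - Nc := by
      rw [← htot]; ring
    rw [e2]
    refine (abs_sub _ _).trans ?_
    rw [abs_of_nonneg hNc0]
    have : C₁ * x / L ^ K = C₁ * (x / L ^ K) := by ring
    linarith
  rw [e]
  refine (abs_sub _ _).trans ?_
  rw [abs_neg, abs_mul, abs_of_nonneg hsq0, abs_of_pos (by positivity)]
  calc _ ≤ 2 * (x / φ) * ((C₁ + 6 * C₂) * (x / L ^ K)) + 36 * C₃ * x := by gcongr
    _ = (2 * C₁ + 12 * C₂) * (x ^ 2 / L ^ K * (1 / φ)) + 36 * C₃ * x := by ring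
    _ ≤ _ := by
      have : 0 ≤ x ^ 2 / L ^ K * (1 / φ) := by positivity
      nlinarith [mul_nonneg hC₃.le this, mul_pos hC₁ hx0, mul_pos hC₂ hx0]

theorem abs_sum_varianceTerm_sub_le (K : ℕ) : ∃ C : ℝ, 0 < C ∧ ∀ (M N : ℕ) (x : ℝ), N ≤ x →
    256 ≤ x → |∑ q ∈ Ioc M N, varianceTerm x q -
      ∑ q ∈ Ioc M N, (secondMoment x q - x ^ 2 / (q.totient : ℝ))| ≤
      C * (x ^ 2 / Real.log x ^ K + N * x) := by
  obtain ⟨C, hC, h⟩ := abs_varianceTerm_sub_le (K + 1)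
  refine ⟨8 * C, by positivity, fun M N x hN hx => ?_⟩
  have hx0 : 0 < x := by linarith
  have hL := one_le_log_of_le hx
  have hlog : Real.log N ≤ Real.log x := by
    rcases Nat.eq_zero_or_pos N with rfl | hN0
    · simpa using by linarith
    · exact Real.log_le_log (by exact_mod_cast hN0) hN
  rw [← Finset.sum_sub_distrib]
  calc _ ≤ ∑ q ∈ Ioc M N, C * (x ^ 2 / Real.log x ^ (K + 1) * (1 / (q.totient : ℝ)) + x) := by
        refine (Finset.abs_sum_le_sum_abs _ _).trans (Finset.sum_le_sum fun q hq => ?_)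
        have hq' := Finset.mem_Ioc.mp hq
        exact h q x (by omega) (le_trans (by exact_mod_cast hq'.2) hN) hx
    _ ≤ ∑ q ∈ Icc 1 N, C * (x ^ 2 / Real.log x ^ (K + 1) * (1 / (q.totient : ℝ)) + x) := by
        refine Finset.sum_le_sum_of_subset_of_nonneg (fun q hq => ?_) fun _ _ _ => by positivity
        have hq' := Finset.mem_Ioc.mp hq
        exact Finset.mem_Icc.mpr ⟨by omega, hq'.2⟩
    _ = C * (x ^ 2 / Real.log x ^ (K + 1) * ∑ q ∈ Icc 1 N, 1 / (q.totient : ℝ) + N * x) := by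
        rw [← Finset.mul_sum, Finset.sum_add_distrib, ← Finset.mul_sum, Finset.sum_const,
          Nat.card_Icc, nsmul_eq_mul]
        simp only [Nat.add_sub_cancel]
    _ ≤ C * (x ^ 2 / Real.log x ^ (K + 1) * (8 * Real.log x) + N * x) := by
        gcongr
        refine (sum_one_div_totient_le N).trans ?_
        linarith
    _ = C * (8 * (x ^ 2 / Real.log x ^ K) + N * x) := by
        field_simp
        ring
    _ ≤ _ := by
        have : 0 ≤ N * x := by positivity
        nlinarith

end MontgomeryHooley

namespace MontgomeryHooley

open Complex MeasureTheory Filter Topology DirichletCharacter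
open ArithmeticFunction (vonMangoldt)

lemma sum_div_le_of_partial_sums {T : ℕ → ℝ} (hT : ∀ d, 0 ≤ T d) {D N : ℕ} (hDN : D ≤ N) :
    ∑ d ∈ Ioc D N, T d / d ≤ (∑ d ∈ Icc 1 N, T d) / ((N : ℝ) + 1) +
      ∑ y ∈ Ioc D N, (∑ d ∈ Icc 1 y, T d) / ((y : ℝ) * (y + 1)) := by
  induction N, hDN using Nat.le_induction with
  | base =>
    simp only [Finset.Ioc_self, Finset.sum_empty, add_zero]
    exact div_nonneg (Finset.sum_nonneg fun d _ => hT d) (by positivity)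
  | succ N hN ih =>
    rw [Finset.sum_Ioc_succ_top (by omega), Finset.sum_Ioc_succ_top (by omega)]
    have e : ∑ d ∈ Icc 1 (N + 1), T d = ∑ d ∈ Icc 1 N, T d + T (N + 1) :=
      Finset.sum_Icc_succ_top (by omega) _
    rw [e]
    set P := ∑ d ∈ Icc 1 N, T d
    push_cast
    have h : (P + T (N + 1)) / ((N : ℝ) + 1 + 1) + (P + T (N + 1)) / (((N : ℝ) + 1) * (N + 1 + 1)) =
        P / ((N : ℝ) + 1) + T (N + 1) / (N + 1) := by
      field_simp
    linarith

lemma sum_Ioc_one_div_mul_succ_le (D N : ℕ) :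
    ∑ y ∈ Ioc D N, 1 / ((y : ℝ) * (y + 1)) ≤ 1 / ((D : ℝ) + 1) := by
  rcases le_total N D with h | hDN
  · rw [Finset.Ioc_eq_empty (by omega), Finset.sum_empty]
    positivity
  · have : ∑ y ∈ Ioc D N, 1 / ((y : ℝ) * (y + 1)) = 1 / ((D : ℝ) + 1) - 1 / ((N : ℝ) + 1) := by
      induction N, hDN using Nat.le_induction with
      | base => simp
      | succ N hN ih =>
        rw [Finset.sum_Ioc_succ_top (by omega), ih]
        push_cast
        field_simp
        ring
    rw [this]
    have : 0 ≤ 1 / ((N : ℝ) + 1) := by positivity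
    linarith

lemma sum_vonMangoldt_sq_le : ∃ C : ℝ, 0 < C ∧ ∀ x : ℝ, 256 ≤ x →
    ∑ n ∈ Icc 1 ⌊x⌋₊, vonMangoldt n ^ 2 ≤ C * x * Real.log x := by
  obtain ⟨C, hC, h⟩ := abs_sum_vonMangoldt_sub_le 0
  refine ⟨C + 1, by positivity, fun x hx => ?_⟩
  have h1 := (abs_le.mp (h x x hx (by linarith) le_rfl)).2
  rw [pow_zero, div_one] at h1
  have hL : 0 ≤ Real.log x := Real.log_nonneg (by linarith)
  calc _ ≤ ∑ n ∈ Icc 1 ⌊x⌋₊, vonMangoldt n * Real.log x := by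
        refine Finset.sum_le_sum fun n hn => ?_
        rw [sq]
        refine mul_le_mul_of_nonneg_left (ArithmeticFunction.vonMangoldt_le_log.trans ?_)
          ArithmeticFunction.vonMangoldt_nonneg
        obtain ⟨hn1, hn2⟩ := Finset.mem_Icc.mp hn
        exact Real.log_le_log (by exact_mod_cast hn1) ((Nat.le_floor_iff (by linarith)).mp hn2)
    _ = (∑ n ∈ Icc 1 ⌊x⌋₊, vonMangoldt n) * Real.log x := by rw [Finset.sum_mul]
    _ ≤ _ := by
        gcongr
        linarith

lemma sum_primitivePart_le_mul : ∃ C : ℝ, 0 < C ∧ ∀ (y : ℕ) (x : ℝ), 1 ≤ y → y ≤ x → 256 ≤ x →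
    ∑ d ∈ Icc 1 y, primitivePart x d ≤ C * (x * Real.log x) * (x + 3 * Real.log x * y ^ 2) := by
  obtain ⟨C, hC, h⟩ := sum_vonMangoldt_sq_le
  refine ⟨C, hC, fun y x hy hyx hx => ?_⟩
  have hL := one_le_log_of_le hx
  have hy0 : (0 : ℝ) < y := by exact_mod_cast hy
  have hl := Real.log_le_log hy0 hyx
  refine (sum_primitivePart_le x hy).trans ?_
  rw [mul_comm, ← mul_assoc C]
  have hS : 0 ≤ ∑ n ∈ Icc 1 ⌊x⌋₊, vonMangoldt n ^ 2 := Finset.sum_nonneg fun _ _ => sq_nonneg _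
  have hlog : (1 + Real.log ((y ^ 2 : ℕ) : ℝ)) ≤ 3 * Real.log x := by
    push_cast
    rw [Real.log_pow]
    push_cast
    linarith
  have hfl : (⌊x⌋₊ : ℝ) ≤ x := Nat.floor_le (by linarith)
  have hlog0 : 0 ≤ Real.log ((y ^ 2 : ℕ) : ℝ) := Real.log_natCast_nonneg _
  refine mul_le_mul (h x hx) ?_ (by positivity) (by positivity)
  refine add_le_add hfl ?_
  calc _ ≤ ((y ^ 2 : ℕ) : ℝ) * (3 * Real.log x) := by gcongr
    _ = _ := by push_cast; ring

lemma sum_Ioc_primitivePart_div_le : ∃ C : ℝ, 0 < C ∧ ∀ (D N : ℕ) (x : ℝ), N ≤ x → 256 ≤ x →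
    ∑ d ∈ Ioc D N, primitivePart x d / d ≤
      C * (x * Real.log x) * (2 * x / ((D : ℝ) + 1) + 6 * Real.log x * N) := by
  obtain ⟨C, hC, h⟩ := sum_primitivePart_le_mul
  refine ⟨C, hC, fun D N x hN hx => ?_⟩
  have hx0 : 0 < x := by linarith
  have hL := one_le_log_of_le hx
  rcases lt_or_ge D N with hDN | hDN
  swap
  · rw [Finset.Ioc_eq_empty (by omega), Finset.sum_empty]
    positivity
  refine (sum_div_le_of_partial_sums (primitivePart_nonneg x) hDN.le).trans ?_
  set B := C * (x * Real.log x) with hB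
  have hB0 : 0 ≤ B := by positivity
  have hDN' : (D : ℝ) ≤ N := by exact_mod_cast hDN.le
  have h1 : (∑ d ∈ Icc 1 N, primitivePart x d) / ((N : ℝ) + 1) ≤
      B * (x / ((D : ℝ) + 1) + 3 * Real.log x * N) := by
    calc _ ≤ B * (x + 3 * Real.log x * N ^ 2) / ((N : ℝ) + 1) := by
          gcongr
          exact h N x (by omega) hN hx
      _ = B * (x / ((N : ℝ) + 1) + 3 * Real.log x * (N * (N / (N + 1)))) := by
          field_simp
      _ ≤ _ := by
          have : (N : ℝ) / (N + 1) ≤ 1 := div_le_one_of_le₀ (by linarith) (by positivity)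
          gcongr
          nlinarith [(Nat.cast_nonneg N : (0 : ℝ) ≤ N)]
  have h2 : ∑ y ∈ Ioc D N, (∑ d ∈ Icc 1 y, primitivePart x d) / ((y : ℝ) * (y + 1)) ≤
      B * (x / ((D : ℝ) + 1) + 3 * Real.log x * N) := by
    calc _ ≤ ∑ y ∈ Ioc D N, B * (x * (1 / ((y : ℝ) * (y + 1))) + 3 * Real.log x) := by
          refine Finset.sum_le_sum fun y hy => ?_
          have hy' := Finset.mem_Ioc.mp hy
          have hy1 : 1 ≤ y := by omega
          have hy0 : (0 : ℝ) < y := by exact_mod_cast hy1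
          have hyx : (y : ℝ) ≤ x := le_trans (by exact_mod_cast hy'.2) hN
          calc _ ≤ B * (x + 3 * Real.log x * y ^ 2) / ((y : ℝ) * (y + 1)) := by
                gcongr
                exact h y x hy1 hyx hx
            _ = B * (x * (1 / ((y : ℝ) * (y + 1))) + 3 * Real.log x * (y / (y + 1))) := by
                field_simp
            _ ≤ _ := by
                have h5 : 3 * Real.log x * ((y : ℝ) / (y + 1)) ≤ 3 * Real.log x :=
                  mul_le_of_le_one_right (by positivity)
                    (div_le_one_of_le₀ (by linarith) (by positivity))
                exact mul_le_mul_of_nonneg_left (by linarith) hB0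
      _ = B * (x * ∑ y ∈ Ioc D N, 1 / ((y : ℝ) * (y + 1)) + (N - D : ℕ) * (3 * Real.log x)) := by
          rw [← Finset.mul_sum, Finset.sum_add_distrib, ← Finset.mul_sum, Finset.sum_const,
            Nat.card_Ioc, nsmul_eq_mul]
      _ ≤ B * (x * (1 / ((D : ℝ) + 1)) + N * (3 * Real.log x)) := by
          have : ((N - D : ℕ) : ℝ) ≤ N := by exact_mod_cast Nat.sub_le N D
          gcongr
          exact sum_Ioc_one_div_mul_succ_le D N
      _ = _ := by ring
  refine (add_le_add h1 h2).trans (le_of_eq ?_)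
  ring

theorem sum_secondMoment_sub_le (K : ℕ) : ∃ C : ℝ, 0 < C ∧ ∀ (D N : ℕ) (x : ℝ), 1 ≤ N → N ≤ x →
    256 ≤ x → ∑ q ∈ Icc 1 N, (secondMoment x q - x ^ 2 / (q.totient : ℝ)) ≤
      C * (1 + Real.log N) * ((D : ℝ) ^ 6 * x ^ 2 / Real.log x ^ K +
        (x * Real.log x) * (2 * x / ((D : ℝ) + 1) + 6 * Real.log x * N)) := by
  obtain ⟨C₁, hC₁, h₁⟩ := abs_primitivePart_sub_le K
  obtain ⟨C₂, hC₂, h₂⟩ := sum_Ioc_primitivePart_div_le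
  refine ⟨C₁ + C₂, by positivity, fun D N x hN1 hN hx => ?_⟩
  have hx0 : 0 < x := by linarith
  have hL := one_le_log_of_le hx
  have hlN : 0 ≤ Real.log N := Real.log_natCast_nonneg N
  set L := Real.log x
  set E := C₁ * (D : ℝ) ^ 6 * x ^ 2 / L ^ K with hE
  have hterm : ∀ q ∈ Icc 1 N, secondMoment x q - x ^ 2 / (q.totient : ℝ) ≤
      E * (1 / q) + ∑ d ∈ q.divisors, (if D < d then primitivePart x d else 0) / q := by
    intro q hq
    have hq1 := (Finset.mem_Icc.mp hq).1
    have hq0 : (0 : ℝ) < q := by exact_mod_cast hq1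
    have e1 : secondMoment x q = ∑ d ∈ q.divisors, primitivePart x d / q := by
      rw [← Finset.sum_div, ← mul_secondMoment_eq_sum_divisors x hq1]
      field_simp
    have e2 : x ^ 2 / (q.totient : ℝ) = ∑ d ∈ q.divisors, x ^ 2 * sqfreeInvTotient d / q := by
      rw [← mul_one_div, one_div_totient_eq hq1, Finset.mul_sum]
      exact Finset.sum_congr rfl fun d _ => by ring
    have hcard : ∑ d ∈ q.divisors, (if d ≤ D then C₁ * (D : ℝ) ^ 5 * x ^ 2 / L ^ K / q else 0) ≤
        E * (1 / q) := by
      rw [← Finset.sum_filter, Finset.sum_const, nsmul_eq_mul]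
      have hc : (q.divisors.filter (fun d => d ≤ D)).card ≤ D := by
        refine (Finset.card_le_card (t := Icc 1 D) fun d hd => ?_).trans (by simp)
        rw [Finset.mem_filter] at hd
        exact Finset.mem_Icc.mpr ⟨Nat.pos_of_mem_divisors hd.1, hd.2⟩
      calc _ ≤ (D : ℝ) * (C₁ * (D : ℝ) ^ 5 * x ^ 2 / L ^ K / q) := by gcongr
        _ = _ := by rw [hE]; ring
    refine le_trans ?_ (add_le_add_left hcard _)
    rw [e1, e2, ← Finset.sum_sub_distrib, ← Finset.sum_add_distrib]
    refine Finset.sum_le_sum fun d hd => ?_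
    have hd1 : 1 ≤ d := Nat.pos_of_mem_divisors hd
    rcases le_or_gt d D with hdD | hdD
    · rw [if_pos hdD, if_neg (by omega), zero_div, add_zero, ← sub_div]
      gcongr ?_ / _
      refine (le_abs_self _).trans ((h₁ d x hd1 hx).trans ?_)
      gcongr
    · rw [if_neg (by omega), if_pos hdD, zero_add]
      have : 0 ≤ x ^ 2 * sqfreeInvTotient d / q := by
        have := sqfreeInvTotient_nonneg d
        positivity
      linarith
  have hlarge : ∑ q ∈ Icc 1 N, ∑ d ∈ q.divisors, (if D < d then primitivePart x d else 0) / (q : ℝ) ≤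
      (1 + Real.log N) * ∑ d ∈ Ioc D N, primitivePart x d / d := by
    rw [sum_Icc_sum_divisors N fun d q => (if D < d then primitivePart x d else 0) / (q : ℝ)]
    calc _ ≤ ∑ d ∈ Icc 1 N, (if D < d then primitivePart x d / d else 0) * (1 + Real.log N) := by
          refine Finset.sum_le_sum fun d _ => ?_
          have hnn : 0 ≤ (if D < d then primitivePart x d / d else 0) := by
            have := primitivePart_nonneg x d
            split_ifs <;> positivity
          refine le_trans (le_of_eq ?_) (mul_le_mul_of_nonneg_left
            (sum_one_div_le_one_add_log (Nat.div_le_self N d)) hnn)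
          rw [Finset.mul_sum]
          refine Finset.sum_congr rfl fun m _ => ?_
          split_ifs
          · push_cast
            rw [div_mul_div_comm, mul_one]
          · simp
      _ = (1 + Real.log N) * ∑ d ∈ Icc 1 N, (if D < d then primitivePart x d / d else 0) := by
          rw [← Finset.sum_mul, mul_comm]
      _ = _ := by
          rw [← Finset.sum_filter]
          congr 2
          ext d
          simp only [Finset.mem_Ioc, Finset.mem_filter, Finset.mem_Icc]
          omega
  calc _ ≤ ∑ q ∈ Icc 1 N, (E * (1 / (q : ℝ)) +
          ∑ d ∈ q.divisors, (if D < d then primitivePart x d else 0) / (q : ℝ)) :=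
        Finset.sum_le_sum hterm
    _ ≤ E * (1 + Real.log N) + (1 + Real.log N) * ∑ d ∈ Ioc D N, primitivePart x d / d := by
        rw [Finset.sum_add_distrib, ← Finset.mul_sum]
        exact add_le_add (mul_le_mul_of_nonneg_left (sum_one_div_le_one_add_log le_rfl)
          (by positivity)) hlarge
    _ ≤ E * (1 + Real.log N) + (1 + Real.log N) * (C₂ * (x * L) *
          (2 * x / ((D : ℝ) + 1) + 6 * L * N)) := by
        gcongr
        exact h₂ D N x hN hx
    _ = (1 + Real.log N) * (C₁ * ((D : ℝ) ^ 6 * x ^ 2 / L ^ K) +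
          C₂ * ((x * L) * (2 * x / ((D : ℝ) + 1) + 6 * L * N))) := by rw [hE]; ring
    _ ≤ _ := by
        have h3 : 0 ≤ (D : ℝ) ^ 6 * x ^ 2 / L ^ K := by positivity
        have h4 : 0 ≤ (x * L) * (2 * x / ((D : ℝ) + 1) + 6 * L * N) := by positivity
        rw [mul_comm (C₁ + C₂), mul_assoc (1 + Real.log N) (C₁ + C₂)]
        refine mul_le_mul_of_nonneg_left ?_ (add_nonneg zero_le_one hlN)
        linarith [mul_nonneg hC₁.le h4, mul_nonneg hC₂.le h3]

/-- A form of the Barban–Davenport–Halberstam theorem. -/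
theorem sum_varianceTerm_le (B : ℕ) : ∃ C : ℝ, 0 < C ∧ ∀ (N : ℕ) (x : ℝ), N ≤ x → 256 ≤ x →
    ∑ q ∈ Icc 1 N, varianceTerm x q ≤ C * (x ^ 2 / Real.log x ^ B + N * x * Real.log x ^ 3) := by
  obtain ⟨C₁, hC₁, h₁⟩ := abs_sum_varianceTerm_sub_le B
  obtain ⟨C₂, hC₂, h₂⟩ := sum_secondMoment_sub_le (6 * (B + 2) + B + 1)
  refine ⟨C₁ + 12 * C₂, by positivity, fun N x hN hx => ?_⟩
  have hx0 : 0 < x := by linarith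
  have hL := one_le_log_of_le hx
  rcases Nat.eq_zero_or_pos N with rfl | hN1
  · simp only [Finset.Icc_eq_empty_of_lt zero_lt_one, Finset.sum_empty]
    positivity
  have ha := h₁ 0 N x hN hx
  have hb := h₂ ⌊Real.log x ^ (B + 2)⌋₊ N x hN1 hN hx
  have hlN : Real.log N ≤ Real.log x := Real.log_le_log (by exact_mod_cast hN1) hN
  have hlN0 : 0 ≤ Real.log N := Real.log_natCast_nonneg N
  set L := Real.log x
  set D := ⌊L ^ (B + 2)⌋₊ with hD
  have hD1 : (D : ℝ) ≤ L ^ (B + 2) := Nat.floor_le (by positivity)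
  have hD2 : L ^ (B + 2) ≤ (D : ℝ) + 1 := (Nat.lt_floor_add_one _).le
  have hc : C₂ * (1 + Real.log N) * ((D : ℝ) ^ 6 * x ^ 2 / L ^ (6 * (B + 2) + B + 1) +
      (x * L) * (2 * x / ((D : ℝ) + 1) + 6 * L * N)) ≤
      12 * C₂ * (x ^ 2 / L ^ B + N * x * L ^ 3) := by
    calc _ ≤ C₂ * (2 * L) * ((L ^ (B + 2)) ^ 6 * x ^ 2 / L ^ (6 * (B + 2) + B + 1) +
          (x * L) * (2 * x / L ^ (B + 2) + 6 * L * N)) := by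
          gcongr
          linarith
      _ = C₂ * (2 * (x ^ 2 / L ^ B) + 4 * (x ^ 2 / L ^ B) + 12 * (N * x * L ^ 3)) := by
          field_simp
          ring
      _ ≤ _ := by
          have : 0 ≤ x ^ 2 / L ^ B := by positivity
          nlinarith
  have hd : ∑ q ∈ Icc 1 N, varianceTerm x q ≤
      ∑ q ∈ Icc 1 N, (secondMoment x q - x ^ 2 / (q.totient : ℝ)) +
        C₁ * (x ^ 2 / L ^ B + N * x) := by
    have := (abs_le.mp ha).2
    rw [show Icc 1 N = Ioc 0 N from rfl]
    linarith
  have hNx : (N : ℝ) * x ≤ N * x * L ^ 3 := le_mul_of_one_le_right (by positivity)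
    (one_le_pow₀ hL)
  have : C₁ * (x ^ 2 / L ^ B + N * x) ≤ C₁ * (x ^ 2 / L ^ B + N * x * L ^ 3) := by gcongr
  linarith

end MontgomeryHooley

namespace MontgomeryHooley

open Complex MeasureTheory Filter Topology DirichletCharacter
open ArithmeticFunction (vonMangoldt)

lemma abs_sum_vonMangoldt_sub_one_le (K : ℕ) : ∃ C : ℝ, 0 < C ∧ ∀ (x : ℝ) (m : ℕ), 256 ≤ x →
    m ≤ x → |∑ n ∈ Icc 1 m, (vonMangoldt n - 1)| ≤ C * x / Real.log x ^ K := by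
  obtain ⟨C, hC, h⟩ := abs_sum_vonMangoldt_sub_le K
  refine ⟨C, hC, fun x m hx hm => ?_⟩
  have := h x m hx (Nat.cast_nonneg m) hm
  rw [Nat.floor_natCast] at this
  simpa [Finset.sum_sub_distrib] using this

lemma abs_sum_vonMangoldt_mul_sub_le (K : ℕ) : ∃ C : ℝ, 0 < C ∧ ∀ (x u : ℝ), 256 ≤ x → 0 ≤ u →
    u ≤ x → |∑ n ∈ Icc 1 ⌊u⌋₊, vonMangoldt n * (u - n) - u ^ 2 / 2| ≤
      C * x ^ 2 / Real.log x ^ K := by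
  obtain ⟨C₁, hC₁, h₁⟩ := abs_sum_vonMangoldt_sub_one_le K
  obtain ⟨C₂, hC₂, h₂⟩ := exists_log_pow_le K
  refine ⟨C₁ + C₂, by positivity, fun x u hx hu hux => ?_⟩
  have hx0 : 0 < x := by linarith
  have hL := one_le_log_of_le hx
  set L := Real.log x with hLdef
  set N := ⌊u⌋₊ with hN
  have hN1 : (N : ℝ) ≤ u := Nat.floor_le hu
  have hN2 : u < N + 1 := Nat.lt_floor_add_one u
  have hA := abs_sum_antitone_mul_le (w := fun n : ℕ => max 0 (u - n))
    (c := fun n => vonMangoldt n - 1) (s := 0) (N := N) (B := C₁ * x / L ^ K) (Nat.zero_le N)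
    (fun n _ => ⟨le_max_left _ _, by
      push_cast
      exact max_le_max le_rfl (by linarith)⟩)
    (fun m _ hm => h₁ x m hx (le_trans (by exact_mod_cast hm) (hN1.trans hux)))
  have e0 : max 0 (u - ((0 : ℕ) : ℝ)) = u := by simp [hu]
  have hE : ∑ n ∈ Ioc 0 N, max 0 (u - n) * (vonMangoldt n - 1) =
      ∑ n ∈ Icc 1 N, vonMangoldt n * (u - n) - (N * u - N * (N + 1) / 2) := by
    rw [show Ioc 0 N = Icc 1 N from rfl, ← sum_Icc_natCast N,
      show (N : ℝ) * u = ∑ n ∈ Icc 1 N, u by simp, ← Finset.sum_sub_distrib,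
      ← Finset.sum_sub_distrib]
    refine Finset.sum_congr rfl fun n hn => ?_
    have : (n : ℝ) ≤ N := by exact_mod_cast (Finset.mem_Icc.mp hn).2
    rw [max_eq_right (by linarith)]
    ring
  simp only [e0] at hA
  rw [hE] at hA
  have hB : |(N * u - N * (N + 1) / 2) - u ^ 2 / 2| ≤ x := by
    rw [abs_le]
    constructor <;> nlinarith [sq_nonneg (u - N)]
  have hC : x ≤ C₂ * x ^ 2 / L ^ K := by
    rw [le_div_iff₀ (by positivity)]
    nlinarith [h₂ x (by linarith)]
  have hD : C₁ * x / L ^ K * u ≤ C₁ * x ^ 2 / L ^ K := by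
    calc _ ≤ C₁ * x / L ^ K * x := by gcongr
      _ = _ := by ring
  calc _ ≤ _ := abs_sub_le _ (N * u - N * (N + 1) / 2) _
    _ ≤ C₁ * x ^ 2 / L ^ K + C₂ * x ^ 2 / L ^ K := by linarith
    _ = _ := by ring

lemma sum_one_div_sqrt_le (N : ℕ) : ∑ n ∈ Icc 1 N, 1 / √(n : ℝ) ≤ 2 * √(N : ℝ) := by
  induction N with
  | zero => simp
  | succ N ih =>
    rw [Finset.sum_Icc_succ_top (by omega)]
    have h1 : 0 < √((N + 1 : ℕ) : ℝ) := Real.sqrt_pos.mpr (by positivity)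
    have h2 : √(N : ℝ) ^ 2 = N := Real.sq_sqrt (Nat.cast_nonneg N)
    have h3 : √((N + 1 : ℕ) : ℝ) ^ 2 = N + 1 := by
      rw [Real.sq_sqrt (by positivity)]
      push_cast
      rfl
    have h4 : 1 / √((N + 1 : ℕ) : ℝ) ≤ 2 * √((N + 1 : ℕ) : ℝ) - 2 * √(N : ℝ) := by
      rw [div_le_iff₀ h1]
      nlinarith [sq_nonneg (√((N + 1 : ℕ) : ℝ) - √(N : ℝ))]
    linarith

lemma sum_log_sub_log_le {x : ℝ} (hx : 1 ≤ x) :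
    ∑ n ∈ Icc 1 ⌊x⌋₊, (Real.log x - Real.log n) ≤ 4 * x := by
  have hx0 : 0 < x := by linarith
  calc _ ≤ ∑ n ∈ Icc 1 ⌊x⌋₊, 2 * √x * (1 / √(n : ℝ)) := by
        refine Finset.sum_le_sum fun n hn => ?_
        have hn0 : (0 : ℝ) < n := by exact_mod_cast (Finset.mem_Icc.mp hn).1
        rw [← Real.log_div hx0.ne' hn0.ne']
        refine (log_le_two_mul_sqrt (by positivity)).trans (le_of_eq ?_)
        rw [Real.sqrt_div hx0.le]
        ring
    _ = 2 * √x * ∑ n ∈ Icc 1 ⌊x⌋₊, 1 / √(n : ℝ) := by rw [Finset.mul_sum]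
    _ ≤ 2 * √x * (2 * √(⌊x⌋₊ : ℝ)) := by gcongr; exact sum_one_div_sqrt_le _
    _ ≤ 2 * √x * (2 * √x) := by gcongr; exact Nat.floor_le hx0.le
    _ = 4 * x := by
      have := Real.mul_self_sqrt hx0.le
      linarith

lemma sum_vonMangoldt_mul_log_sub_log_le : ∃ C : ℝ, 0 < C ∧ ∀ x : ℝ, 256 ≤ x →
    ∑ n ∈ Icc 1 ⌊x⌋₊, vonMangoldt n * (Real.log x - Real.log n) ≤ C * x := by
  obtain ⟨C, hC, h⟩ := abs_sum_vonMangoldt_sub_one_le 1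
  refine ⟨2 * C + 5, by positivity, fun x hx => ?_⟩
  have hx0 : 0 < x := by linarith
  have hL := one_le_log_of_le hx
  set L := Real.log x with hLdef
  set N := ⌊x⌋₊ with hN
  have hN1 : 1 ≤ N := Nat.floor_pos.mpr (by linarith)
  have hNx : (N : ℝ) ≤ x := Nat.floor_le hx0.le
  have hw : ∀ n : ℕ, n ∈ Icc 1 N → max 0 (L - Real.log n) = L - Real.log n := fun n hn => by
    obtain ⟨hn1, hn2⟩ := Finset.mem_Icc.mp hn
    refine max_eq_right (sub_nonneg.mpr (Real.log_le_log (by exact_mod_cast hn1) ?_))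
    exact le_trans (by exact_mod_cast hn2) hNx
  have hA := (abs_le.mp (abs_sum_antitone_mul_le (w := fun n : ℕ => max 0 (L - Real.log n))
    (c := fun n => vonMangoldt n - 1) (s := 0 + 1) (N := N) (B := 2 * (C * x / L) + 1) hN1
    (fun n hn => ⟨le_max_left _ _, max_le_max le_rfl (sub_le_sub_left
      (Real.log_le_log (by exact_mod_cast hn) (by push_cast; linarith)) _)⟩)
    (fun m hm hmN => by
      have h1 := h x m hx (le_trans (by exact_mod_cast hmN) hNx)
      rw [pow_one, show Icc 1 m = Ioc 0 m from rfl,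
        ← Finset.sum_Ioc_consecutive _ (Nat.zero_le (0 + 1)) hm] at h1
      simp only [Finset.sum_Ioc_succ_top (le_refl 0), Finset.Ioc_self, Finset.sum_empty,
        zero_add, ArithmeticFunction.vonMangoldt_apply_one] at h1
      have h2 : 0 ≤ C * x / L := by positivity
      simp only [zero_add]
      rw [abs_le] at h1 ⊢
      constructor <;> linarith [h1.1, h1.2]))).2
  simp only [zero_add, Nat.cast_one, Real.log_one, sub_zero] at hA
  rw [max_eq_right (by linarith)] at hA
  have hB := sum_log_sub_log_le (x := x) (by linarith)
  rw [← hN, ← hLdef] at hB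
  have hS : ∑ n ∈ Icc 1 N, vonMangoldt n * (L - Real.log n) =
      ∑ n ∈ Icc 1 N, (L - Real.log n) + ∑ n ∈ Icc 1 N, max 0 (L - Real.log n) * (vonMangoldt n - 1) := by
    rw [← Finset.sum_add_distrib]
    refine Finset.sum_congr rfl fun n hn => ?_
    rw [hw n hn]
    ring
  have hT : ∑ n ∈ Icc 1 N, max 0 (L - Real.log n) * (vonMangoldt n - 1) ≤
      ∑ n ∈ Ioc 1 N, max 0 (L - Real.log n) * (vonMangoldt n - 1) := by
    rw [show Icc 1 N = Ioc 0 N from rfl, ← Finset.sum_Ioc_consecutive _ (Nat.zero_le 1) hN1]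
    have : ∑ n ∈ Ioc (0 : ℕ) 1, max 0 (L - Real.log n) * (vonMangoldt n - 1) = -max 0 L := by
      simp [show Ioc 0 1 = {1} from rfl]
    rw [this]
    linarith [le_max_left 0 L]
  have hLx : L ≤ x := Real.log_le_self hx0.le
  have : (2 * (C * x / L) + 1) * L = 2 * C * x + L := by
    field_simp
  linarith

theorem abs_sum_vonMangoldt_sq_sub_le : ∃ C : ℝ, 0 < C ∧ ∀ x : ℝ, 256 ≤ x →
    |∑ n ∈ Icc 1 ⌊x⌋₊, vonMangoldt n ^ 2 - x * Real.log x| ≤ C * x := by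
  obtain ⟨C₁, hC₁, h₁⟩ := abs_sum_vonMangoldt_sub_le 1
  obtain ⟨C₂, hC₂, h₂⟩ := sum_vonMangoldt_mul_log_sub_log_le
  obtain ⟨C₃, hC₃, h₃⟩ := exists_log_pow_le 2
  refine ⟨C₁ + C₂ + 8 * C₃, by positivity, fun x hx => ?_⟩
  have hx0 : 0 < x := by linarith
  have hL := one_le_log_of_le hx
  have hpsi := h₁ x x hx hx0.le le_rfl
  have hprime := Chebyshev.psi_sub_theta_le (x := x) (by linarith)
  rw [Chebyshev.psi_sub_theta_eq_sum_not_prime, show Ioc 0 ⌊x⌋₊ = Icc 1 ⌊x⌋₊ from rfl] at hprime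
  have hsq := h₃ (√x) (Real.one_le_sqrt.mpr (by linarith))
  rw [Real.log_sqrt hx0.le] at hsq
  have hlog := h₂ x hx
  set L := Real.log x with hLdef
  set N := ⌊x⌋₊ with hN
  have hd : ∀ n ∈ Icc 1 N, vonMangoldt n * (Real.log n - vonMangoldt n) ≤
      if ¬ n.Prime then vonMangoldt n * L else 0 := by
    intro n hn
    obtain ⟨hn1, hn2⟩ := Finset.mem_Icc.mp hn
    have h0 : 0 ≤ vonMangoldt n := ArithmeticFunction.vonMangoldt_nonneg
    by_cases hp : n.Prime
    swap
    · rw [if_pos hp]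
      refine mul_le_mul_of_nonneg_left ?_ h0
      have : Real.log n ≤ L := Real.log_le_log (by exact_mod_cast hn1)
        ((Nat.le_floor_iff hx0.le).mp hn2)
      linarith
    · rw [ArithmeticFunction.vonMangoldt_apply_prime hp]
      simp [hp]
  have hD := Finset.sum_le_sum hd
  rw [← Finset.sum_filter, ← Finset.sum_mul] at hD
  have hD' : ∑ n ∈ Icc 1 N, vonMangoldt n * (Real.log n - vonMangoldt n) ≤ 8 * C₃ * x := by
    refine hD.trans ((mul_le_mul_of_nonneg_right hprime (by linarith)).trans ?_)
    have hs := Real.mul_self_sqrt hx0.le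
    have hs0 := Real.sqrt_nonneg x
    calc 2 * √x * L * L = 8 * √x * (L / 2) ^ 2 := by ring
      _ ≤ 8 * √x * (C₃ * √x) := by gcongr
      _ = 8 * C₃ * (√x * √x) := by ring
      _ = _ := by rw [hs]
  have hnn : 0 ≤ ∑ n ∈ Icc 1 N, vonMangoldt n * (Real.log n - vonMangoldt n) :=
    Finset.sum_nonneg fun n _ => mul_nonneg ArithmeticFunction.vonMangoldt_nonneg
      (sub_nonneg.mpr ArithmeticFunction.vonMangoldt_le_log)
  have hnn' : 0 ≤ ∑ n ∈ Icc 1 N, vonMangoldt n * (L - Real.log n) :=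
    Finset.sum_nonneg fun n hn => mul_nonneg ArithmeticFunction.vonMangoldt_nonneg
      (sub_nonneg.mpr (Real.log_le_log (by exact_mod_cast (Finset.mem_Icc.mp hn).1)
        ((Nat.le_floor_iff hx0.le).mp (Finset.mem_Icc.mp hn).2)))
  have hS : ∑ n ∈ Icc 1 N, vonMangoldt n ^ 2 = L * ∑ n ∈ Icc 1 N, vonMangoldt n -
      ∑ n ∈ Icc 1 N, vonMangoldt n * (L - Real.log n) -
      ∑ n ∈ Icc 1 N, vonMangoldt n * (Real.log n - vonMangoldt n) := by
    rw [Finset.mul_sum, ← Finset.sum_sub_distrib, ← Finset.sum_sub_distrib]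
    exact Finset.sum_congr rfl fun n _ => by ring
  have hP : |L * ∑ n ∈ Icc 1 N, vonMangoldt n - x * L| ≤ C₁ * x := by
    rw [show L * ∑ n ∈ Icc 1 N, vonMangoldt n - x * L = L * (∑ n ∈ Icc 1 N, vonMangoldt n - x) by
      ring, abs_mul, abs_of_pos (by linarith : 0 < L)]
    calc _ ≤ L * (C₁ * x / L ^ 1) := by gcongr
      _ = _ := by field_simp
  have h8 : 0 ≤ C₁ * x := by positivity
  rw [abs_le] at hP ⊢
  constructor <;> linarith [hP.1, hP.2]

end MontgomeryHooley

namespace MontgomeryHooley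

open Complex MeasureTheory Filter Topology DirichletCharacter
open ArithmeticFunction (vonMangoldt)

/-- The contribution of the pairs `m < n` to `secondMoment x q`. -/
noncomputable def offDiagonal (x : ℝ) (q : ℕ) : ℝ :=
  ∑ m ∈ Icc 1 ⌊x⌋₊, ∑ n ∈ Icc 1 ⌊x⌋₊,
    if m < n ∧ m % q = n % q then vonMangoldt m * vonMangoldt n else 0

lemma secondMoment_eq_add_offDiagonal (x : ℝ) {q : ℕ} (hq : 1 ≤ q) :
    secondMoment x q = ∑ n ∈ Icc 1 ⌊x⌋₊, vonMangoldt n ^ 2 + 2 * offDiagonal x q := by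
  have h1 : ∑ n ∈ Icc 1 ⌊x⌋₊, vonMangoldt n ^ 2 = ∑ m ∈ Icc 1 ⌊x⌋₊, ∑ n ∈ Icc 1 ⌊x⌋₊,
      if m = n then vonMangoldt m * vonMangoldt n else 0 := by
    refine Finset.sum_congr rfl fun m hm => ?_
    rw [Finset.sum_ite_eq, if_pos hm, sq]
  have h2 : offDiagonal x q = ∑ m ∈ Icc 1 ⌊x⌋₊, ∑ n ∈ Icc 1 ⌊x⌋₊,
      if n < m ∧ m % q = n % q then vonMangoldt m * vonMangoldt n else 0 := by
    rw [offDiagonal, Finset.sum_comm]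
    refine Finset.sum_congr rfl fun m _ => Finset.sum_congr rfl fun n _ => ?_
    simp only [mul_comm (vonMangoldt n), eq_comm (a := n % q)]
  rw [two_mul]
  nth_rewrite 1 [h2]
  rw [offDiagonal, h1, secondMoment_eq_sum x hq, ← Finset.sum_add_distrib,
    ← Finset.sum_add_distrib]
  refine Finset.sum_congr rfl fun m _ => ?_
  rw [← Finset.sum_add_distrib, ← Finset.sum_add_distrib]
  refine Finset.sum_congr rfl fun n _ => ?_
  rcases lt_trichotomy m n with h | rfl | h
  · simp [h, h.ne, h.not_gt]
  · simp
  · simp [h, h.ne', h.not_gt]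

lemma card_filter_dvd_eq {y M k : ℕ} (hy : 1 ≤ y) (hk : 1 ≤ k) (hkM : k ≤ M) :
    ((Ioc y M).filter (fun q => q ∣ k)).card =
      ((Icc 1 (M / y)).filter (fun r => y * r < k ∧ r ∣ k)).card := by
  refine Finset.card_nbij' (fun q => k / q) (fun r => k / r) ?_ ?_ ?_ ?_
  · intro q hq
    simp only [Finset.coe_filter, Finset.mem_Ioc, Finset.mem_Icc, Set.mem_ofPred_eq] at hq ⊢
    obtain ⟨⟨h1, h2⟩, r, rfl⟩ := hq
    have hq0 : 0 < q := by omega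
    have hr0 : 0 < r := Nat.pos_of_mul_pos_left hk
    rw [Nat.mul_div_cancel_left _ hq0]
    have h3 : y * r < q * r := Nat.mul_lt_mul_of_pos_right h1 hr0
    refine ⟨⟨hr0, ?_⟩, h3, Dvd.intro_left q rfl⟩
    rw [Nat.le_div_iff_mul_le hy, mul_comm]
    omega
  · intro r hr
    simp only [Finset.coe_filter, Finset.mem_Ioc, Finset.mem_Icc, Set.mem_ofPred_eq] at hr ⊢
    obtain ⟨⟨h1, h2⟩, h3, q, rfl⟩ := hr
    rw [Nat.mul_div_cancel_left _ h1]
    refine ⟨⟨?_, ?_⟩, Dvd.intro_left r rfl⟩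
    · rw [mul_comm] at h3
      exact Nat.lt_of_mul_lt_mul_left h3
    · exact (Nat.le_mul_of_pos_left q h1).trans hkM
  · intro q hq
    simp only [Finset.coe_filter, Set.mem_ofPred_eq] at hq
    exact Nat.div_div_self hq.2 (by omega)
  · intro r hr
    simp only [Finset.coe_filter, Set.mem_ofPred_eq] at hr
    exact Nat.div_div_self hr.2.2 (by omega)

lemma psi_sub_psi_eq (x : ℝ) (r a k : ℕ) (hk : k ≤ ⌊x⌋₊) :
    psi x r a - psi (k : ℝ) r a = ∑ n ∈ Ioc k ⌊x⌋₊, if n % r = a % r then vonMangoldt n else 0 := by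
  rw [psi_eq_sum_ite, psi_eq_sum_ite, Nat.floor_natCast, show Icc 1 ⌊x⌋₊ = Ioc 0 ⌊x⌋₊ from rfl,
    show Icc 1 k = Ioc 0 k from rfl, ← Finset.sum_Ioc_consecutive _ (Nat.zero_le k) hk]
  ring

lemma sum_offDiagonal_eq (x : ℝ) {y : ℕ} (hy : 1 ≤ y) :
    ∑ q ∈ Ioc y ⌊x⌋₊, offDiagonal x q = ∑ r ∈ Icc 1 (⌊x⌋₊ / y), ∑ m ∈ Icc 1 (⌊x⌋₊ - y * r),
      vonMangoldt m * (psi x r m - psi ((m + y * r : ℕ) : ℝ) r m) := by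
  set M := ⌊x⌋₊ with hM
  have e1 : ∑ q ∈ Ioc y M, offDiagonal x q = ∑ m ∈ Icc 1 M, ∑ n ∈ Icc 1 M, ∑ q ∈ Ioc y M,
      if m < n ∧ m % q = n % q then vonMangoldt m * vonMangoldt n else 0 := by
    simp only [offDiagonal]
    rw [Finset.sum_comm]
    exact Finset.sum_congr rfl fun m _ => Finset.sum_comm
  have e2 : ∑ r ∈ Icc 1 (M / y), ∑ m ∈ Icc 1 (M - y * r),
      vonMangoldt m * (psi x r m - psi ((m + y * r : ℕ) : ℝ) r m) =
      ∑ m ∈ Icc 1 M, ∑ n ∈ Icc 1 M, ∑ r ∈ Icc 1 (M / y),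
        if m + y * r < n ∧ m % r = n % r then vonMangoldt m * vonMangoldt n else 0 := by
    have : ∀ r ∈ Icc 1 (M / y), ∑ m ∈ Icc 1 (M - y * r),
        vonMangoldt m * (psi x r m - psi ((m + y * r : ℕ) : ℝ) r m) =
        ∑ m ∈ Icc 1 M, ∑ n ∈ Icc 1 M,
          if m + y * r < n ∧ m % r = n % r then vonMangoldt m * vonMangoldt n else 0 := by
      intro r hr
      refine Finset.sum_subset_zero_on_sdiff (Finset.Icc_subset_Icc le_rfl (Nat.sub_le _ _)) ?_ ?_
      · intro m hm
        simp only [Finset.mem_sdiff, Finset.mem_Icc] at hm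
        refine Finset.sum_eq_zero fun n hn => if_neg ?_
        have := Finset.mem_Icc.mp hn
        omega
      · intro m hm
        have hm' := Finset.mem_Icc.mp hm
        rw [psi_sub_psi_eq x r m _ (by omega), Finset.mul_sum]
        refine Finset.sum_subset_zero_on_sdiff (fun n hn => ?_) ?_ ?_
        · have := Finset.mem_Ioc.mp hn
          exact Finset.mem_Icc.mpr (by omega)
        · intro n hn
          simp only [Finset.mem_sdiff, Finset.mem_Icc, Finset.mem_Ioc] at hn
          exact if_neg (by omega)
        · intro n hn
          have := (Finset.mem_Ioc.mp hn).1
          simp only [this, true_and, mul_ite, mul_zero, eq_comm (a := m % r)]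
    rw [Finset.sum_congr rfl this, Finset.sum_comm]
    exact Finset.sum_congr rfl fun m _ => Finset.sum_comm
  rw [e1, e2]
  refine Finset.sum_congr rfl fun m hm => Finset.sum_congr rfl fun n hn => ?_
  have hm' := Finset.mem_Icc.mp hm
  have hn' := Finset.mem_Icc.mp hn
  rcases Nat.lt_or_ge m n with h | h
  · have hmod : ∀ q : ℕ, m % q = n % q ↔ q ∣ n - m := fun q => Nat.modEq_iff_dvd' h.le
    have hlt : ∀ r : ℕ, m + y * r < n ↔ y * r < n - m := fun r => by omega
    simp only [h, true_and, hmod, hlt]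
    rw [← Finset.sum_filter, ← Finset.sum_filter, Finset.sum_const, Finset.sum_const,
      card_filter_dvd_eq hy (by omega) (by omega)]
  · rw [Finset.sum_eq_zero fun q _ => if_neg (by omega),
      Finset.sum_eq_zero fun q _ => if_neg (by omega)]

lemma psi_le_of_not_coprime {r a : ℕ} (hr : 1 ≤ r) (ha : ¬ a.Coprime r) {x : ℝ} (hrx : r ≤ x)
    (hx : 256 ≤ x) : psi x r a ≤ 6 * Real.log x ^ 3 := by
  refine le_trans ?_ (sum_vonMangoldt_not_coprime_le_log hr hrx hx)
  rw [psi]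
  refine Finset.sum_le_sum_of_subset_of_nonneg (fun n hn => ?_)
    fun _ _ _ => ArithmeticFunction.vonMangoldt_nonneg
  rw [Finset.mem_filter] at hn ⊢
  refine ⟨hn.1, fun h => ha ?_⟩
  exact (coprime_iff_of_mod_eq n a hn.2).mp h

lemma sum_vonMangoldt_le : ∃ C : ℝ, 0 < C ∧ ∀ x : ℝ, 256 ≤ x →
    ∑ n ∈ Icc 1 ⌊x⌋₊, vonMangoldt n ≤ C * x := by
  obtain ⟨C, hC, h⟩ := abs_sum_vonMangoldt_sub_le 0
  refine ⟨C + 1, by positivity, fun x hx => ?_⟩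
  have := (abs_le.mp (h x x hx (by linarith) le_rfl)).2
  rw [pow_zero, div_one] at this
  linarith

theorem abs_sum_vonMangoldt_mul_psi_sub_psi_sub_le (K : ℕ) : ∃ C : ℝ, 0 < C ∧
    ∀ (r k : ℕ) (x : ℝ), 1 ≤ r → r ≤ x → k ≤ x → 256 ≤ x →
      |∑ m ∈ Icc 1 (⌊x⌋₊ - k), vonMangoldt m * (psi x r m - psi ((m + k : ℕ) : ℝ) r m) -
        (x - k) ^ 2 / 2 / (r.totient : ℝ)| ≤ C * r * x ^ 2 / Real.log x ^ K := by
  obtain ⟨C₁, hC₁, h₁⟩ := abs_psi_sub_div_totient_le K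
  obtain ⟨C₂, hC₂, h₂⟩ := exists_log_pow_le 3
  obtain ⟨C₃, hC₃, h₃⟩ := sum_vonMangoldt_le
  obtain ⟨C₄, hC₄, h₄⟩ := abs_sum_vonMangoldt_mul_sub_le K
  obtain ⟨C₅, hC₅, h₅⟩ := exists_log_pow_le (K + 3)
  refine ⟨2 * C₁ * C₃ + (6 * C₂ + 1) * 6 * C₅ + C₄, by positivity,
    fun r k x hr hrx hkx hx => ?_⟩
  have hx0 : 0 < x := by linarith
  have hL := one_le_log_of_le hx
  have hM := h₃ x hx
  have hN := sum_vonMangoldt_not_coprime_le_log hr hrx hx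
  have hW := h₄ x (x - k) hx (by linarith) (by linarith [(Nat.cast_nonneg k : (0 : ℝ) ≤ k)])
  rw [Nat.floor_sub_natCast] at hW
  have h2x := h₂ x (by linarith)
  have h5x := h₅ x (by linarith)
  have hncop := fun (a : ℕ) (ha : ¬ a.Coprime r) => psi_le_of_not_coprime hr ha hrx hx
  set L := Real.log x with hLdef
  set φ : ℝ := (r.totient : ℝ) with hφ
  have hφ1 : 1 ≤ φ := Nat.one_le_cast.mpr (Nat.totient_pos.mpr hr)
  have hφ0 : 0 < φ := by linarith
  have hr1 : (1 : ℝ) ≤ r := by exact_mod_cast hr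
  set N := ⌊x⌋₊ - k with hNdef
  have hk0 : (0 : ℝ) ≤ k := Nat.cast_nonneg k
  have hNM : Icc 1 N ⊆ Icc 1 ⌊x⌋₊ := Finset.Icc_subset_Icc le_rfl (Nat.sub_le _ _)
  have hterm : ∀ m ∈ Icc 1 N, |vonMangoldt m * (psi x r m - psi ((m + k : ℕ) : ℝ) r m) -
      vonMangoldt m * (x - k - m) / φ| ≤ vonMangoldt m * (2 * C₁ * r * x / L ^ K) +
        if ¬ m.Coprime r then vonMangoldt m * ((6 * C₂ + 1) * x) else 0 := by
    intro m hm
    obtain ⟨hm1, hm2⟩ := Finset.mem_Icc.mp hm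
    have hmk : m + k ≤ ⌊x⌋₊ := by omega
    have hmkx : ((m + k : ℕ) : ℝ) ≤ x := (Nat.le_floor_iff hx0.le).mp hmk
    have h0 : 0 ≤ vonMangoldt m := ArithmeticFunction.vonMangoldt_nonneg
    rw [mul_div_assoc, ← mul_sub, abs_mul, abs_of_nonneg h0]
    by_cases hc : m.Coprime r
    · rw [if_neg (not_not.mpr hc), add_zero]
      refine mul_le_mul_of_nonneg_left ?_ h0
      have ha := h₁ r m x x hr hc hx hx0.le le_rfl
      have hb := h₁ r m x (m + k : ℕ) hr hc hx (Nat.cast_nonneg _) hmkx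
      have e : (x - k - m) / φ = x / φ - ((m + k : ℕ) : ℝ) / φ := by
        push_cast
        ring
      have e2 : 2 * C₁ * r * x / L ^ K = C₁ * r * x / L ^ K + C₁ * r * x / L ^ K := by ring
      rw [e, e2]
      rw [abs_le] at ha hb ⊢
      constructor <;> linarith [ha.1, ha.2, hb.1, hb.2]
    · rw [if_pos hc, ← mul_add]
      refine mul_le_mul_of_nonneg_left ?_ h0
      have ha := hncop m hc
      have hb : 0 ≤ psi x r m - psi ((m + k : ℕ) : ℝ) r m := by
        rw [psi_sub_psi_eq x r m _ hmk]
        refine Finset.sum_nonneg fun n _ => ?_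
        split_ifs
        exacts [ArithmeticFunction.vonMangoldt_nonneg, le_rfl]
      have hb' := psi_nonneg ((m + k : ℕ) : ℝ) r m
      push_cast at hmkx
      have hc1 : 0 ≤ (x - k - m) / φ := div_nonneg (by linarith) hφ0.le
      have hc2 : (x - k - m) / φ ≤ x :=
        (div_le_self (by linarith) hφ1).trans (by linarith [(Nat.cast_nonneg m : (0 : ℝ) ≤ m)])
      have hd : 0 ≤ 2 * C₁ * r * x / L ^ K := by positivity
      rw [abs_le]
      constructor <;> linarith
  have hmain : |∑ m ∈ Icc 1 N, vonMangoldt m * (psi x r m - psi ((m + k : ℕ) : ℝ) r m) -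
      ∑ m ∈ Icc 1 N, vonMangoldt m * (x - k - m) / φ| ≤
      C₃ * x * (2 * C₁ * r * x / L ^ K) + 6 * L ^ 3 * ((6 * C₂ + 1) * x) := by
    rw [← Finset.sum_sub_distrib]
    refine (Finset.abs_sum_le_sum_abs _ _).trans ((Finset.sum_le_sum hterm).trans ?_)
    rw [Finset.sum_add_distrib, ← Finset.sum_mul, ← Finset.sum_filter, ← Finset.sum_mul]
    refine add_le_add (mul_le_mul_of_nonneg_right (le_trans ?_ hM) (by positivity))
      (mul_le_mul_of_nonneg_right (le_trans ?_ hN) (by positivity))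
    · exact Finset.sum_le_sum_of_subset_of_nonneg hNM
        fun _ _ _ => ArithmeticFunction.vonMangoldt_nonneg
    · exact Finset.sum_le_sum_of_subset_of_nonneg (Finset.filter_subset_filter _ hNM)
        fun _ _ _ => ArithmeticFunction.vonMangoldt_nonneg
  have hW' : |∑ m ∈ Icc 1 N, vonMangoldt m * (x - k - m) / φ - (x - k) ^ 2 / 2 / φ| ≤
      C₄ * r * x ^ 2 / L ^ K := by
    rw [← Finset.sum_div, ← sub_div, abs_div, abs_of_pos hφ0]
    refine (div_le_self (abs_nonneg _) hφ1).trans (hW.trans ?_)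
    gcongr
    exact le_mul_of_one_le_right hC₄.le hr1
  have hsmall : 6 * L ^ 3 * ((6 * C₂ + 1) * x) ≤ (6 * C₂ + 1) * 6 * C₅ * r * x ^ 2 / L ^ K := by
    rw [le_div_iff₀ (by positivity)]
    calc _ = (6 * C₂ + 1) * 6 * x * L ^ (K + 3) := by ring
      _ ≤ (6 * C₂ + 1) * 6 * x * (C₅ * x) := by gcongr
      _ = (6 * C₂ + 1) * 6 * C₅ * 1 * x ^ 2 := by ring
      _ ≤ _ := by gcongr
  refine (abs_sub_le _ _ _).trans ((add_le_add (hmain.trans (add_le_add_right hsmall _)) hW').trans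
    (le_of_eq ?_))
  ring

end MontgomeryHooley

namespace MontgomeryHooley

open Complex MeasureTheory Filter Topology DirichletCharacter
open ArithmeticFunction (vonMangoldt)

theorem abs_sum_offDiagonal_sub_le (A B : ℕ) : ∃ c C : ℝ, 0 < C ∧ ∀ (y : ℕ) (x : ℝ), 1 ≤ y →
    y ≤ x → 256 ≤ x → x / y ≤ 2 * Real.log x ^ A →
      |∑ q ∈ Ioc y ⌊x⌋₊, offDiagonal x q - x ^ 2 / 2 * (totientConst * Real.log (x / y) + c)| ≤
        C * (x ^ 2 / Real.log x ^ B + y * x * (1 + Real.log (x / y))) := by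
  obtain ⟨C₁, hC₁, h₁⟩ := abs_sum_vonMangoldt_mul_psi_sub_psi_sub_le (2 * A + B)
  obtain ⟨c, C₂, hC₂, h₂⟩ := abs_sum_one_sub_sq_div_totient_sub_le
  refine ⟨c, 4 * C₁ + C₂, by positivity, fun y x hy hyx hx hA => ?_⟩
  have hx0 : 0 < x := by linarith
  have hL := one_le_log_of_le hx
  have hy0 : (0 : ℝ) < y := by exact_mod_cast hy
  have hz : 1 ≤ x / y := by rwa [le_div_iff₀ hy0, one_mul]
  have hlz : 0 ≤ Real.log (x / y) := Real.log_nonneg hz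
  have h2 := h₂ (x / y) hz
  rw [sum_offDiagonal_eq x hy, ← Nat.floor_div_natCast]
  set L := Real.log x with hLdef
  set R := ⌊x / y⌋₊ with hR
  have hRz : (R : ℝ) ≤ x / y := Nat.floor_le (by positivity)
  have hr : ∀ r ∈ Icc 1 R, 1 ≤ r ∧ (r : ℝ) ≤ x / y := fun r hr =>
    ⟨(Finset.mem_Icc.mp hr).1, le_trans (by exact_mod_cast (Finset.mem_Icc.mp hr).2) hRz⟩
  have hy1 : (1 : ℝ) ≤ y := by exact_mod_cast hy
  have hA1 : |∑ r ∈ Icc 1 R, ∑ m ∈ Icc 1 (⌊x⌋₊ - y * r),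
      vonMangoldt m * (psi x r m - psi ((m + y * r : ℕ) : ℝ) r m) -
      ∑ r ∈ Icc 1 R, (x - (y * r : ℕ)) ^ 2 / 2 / (r.totient : ℝ)| ≤ 4 * C₁ * (x ^ 2 / L ^ B) := by
    rw [← Finset.sum_sub_distrib]
    calc _ ≤ ∑ r ∈ Icc 1 R, C₁ * (2 * L ^ A) * x ^ 2 / L ^ (2 * A + B) := by
          refine (Finset.abs_sum_le_sum_abs _ _).trans (Finset.sum_le_sum fun r hr' => ?_)
          obtain ⟨hr1, hr2⟩ := hr r hr'
          have hk : ((y * r : ℕ) : ℝ) ≤ x := by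
            rw [le_div_iff₀ hy0] at hr2
            push_cast
            linarith
          refine (h₁ r (y * r) x hr1 (hr2.trans (div_le_self hx0.le hy1)) hk hx).trans ?_
          gcongr
          exact hr2.trans hA
      _ = R * (C₁ * (2 * L ^ A) * x ^ 2 / L ^ (2 * A + B)) := by simp
      _ ≤ (2 * L ^ A) * (C₁ * (2 * L ^ A) * x ^ 2 / L ^ (2 * A + B)) := by
          gcongr
          exact hRz.trans hA
      _ = _ := by
          field_simp
          ring
  have hA2 : ∑ r ∈ Icc 1 R, (x - (y * r : ℕ)) ^ 2 / 2 / (r.totient : ℝ) =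
      x ^ 2 / 2 * ∑ r ∈ Icc 1 R, (1 - r / (x / y)) ^ 2 / (r.totient : ℝ) := by
    rw [Finset.mul_sum]
    refine Finset.sum_congr rfl fun r _ => ?_
    have : (x - (y * r : ℕ)) = x * (1 - r / (x / y)) := by
      push_cast
      field_simp
    rw [this]
    ring
  have hA3 : |x ^ 2 / 2 * ∑ r ∈ Icc 1 R, (1 - r / (x / y)) ^ 2 / (r.totient : ℝ) -
      x ^ 2 / 2 * (totientConst * Real.log (x / y) + c)| ≤
      C₂ * (y * x * (1 + Real.log (x / y))) := by
    rw [← mul_sub, abs_mul, abs_of_nonneg (by positivity)]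
    calc _ ≤ x ^ 2 / 2 * (C₂ * (1 + Real.log (x / y)) / (x / y)) := by gcongr
      _ = C₂ * (y * x * (1 + Real.log (x / y))) / 2 := by field_simp
      _ ≤ _ := half_le_self (by positivity)
  rw [hA2] at hA1
  have h3 : 0 ≤ C₂ * (x ^ 2 / L ^ B) := by positivity
  have h4 : 0 ≤ 4 * C₁ * (y * x * (1 + Real.log (x / y))) := by positivity
  refine (abs_sub_le _ _ _).trans ((add_le_add hA1 hA3).trans ?_)
  linarith

lemma mul_one_add_log_div_le {x a b : ℝ} (ha : 0 < a) (hab : a ≤ b) (hbx : b ≤ x) :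
    a * (1 + Real.log (x / a)) ≤ b * (1 + Real.log (x / b)) := by
  have hb : 0 < b := by linarith
  have hx : 0 < x := by linarith
  have h1 : Real.log (x / a) = Real.log (x / b) + Real.log (b / a) := by
    rw [← Real.log_mul (by positivity) (by positivity)]
    congr 1
    field_simp
  have h2 := Real.log_le_sub_one_of_pos (show 0 < b / a by positivity)
  have h3 : a * Real.log (b / a) ≤ b - a := by
    calc _ ≤ a * (b / a - 1) := by gcongr
      _ = _ := by field_simp
  have h4 : 0 ≤ Real.log (x / b) := Real.log_nonneg (by rwa [le_div_iff₀ hb, one_mul])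
  rw [h1]
  nlinarith

theorem abs_sum_Ioc_varianceTerm_sub_le (A B : ℕ) : ∃ C : ℝ, 0 < C ∧ ∀ (M N : ℕ) (x : ℝ),
    1 ≤ M → M ≤ N → N ≤ x → 256 ≤ x → x / M ≤ 2 * Real.log x ^ A →
      |∑ q ∈ Ioc M N, varianceTerm x q - (N - M) * (x * Real.log x)| ≤
        C * (x ^ 2 / Real.log x ^ B + N * x * (1 + Real.log (x / N))) := by
  obtain ⟨c, C₁, hC₁, h₁⟩ := abs_sum_offDiagonal_sub_le A B
  obtain ⟨c', C₂, hC₂, h₂⟩ := abs_sum_one_div_totient_sub_le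
  obtain ⟨C₃, hC₃, h₃⟩ := abs_sum_vonMangoldt_sq_sub_le
  obtain ⟨C₄, hC₄, h₄⟩ := abs_sum_varianceTerm_sub_le B
  obtain ⟨C₅, hC₅, h₅⟩ := exists_log_pow_le (A + 1 + B)
  refine ⟨4 * C₁ + 8 * C₂ * C₅ + C₃ + C₄, by positivity, fun M N x hM hMN hNx hx hA => ?_⟩
  have hx0 : 0 < x := by linarith
  have hL := one_le_log_of_le hx
  have hM0 : (0 : ℝ) < M := by exact_mod_cast hM
  have hMN' : (M : ℝ) ≤ N := by exact_mod_cast hMN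
  have hM1 : (1 : ℝ) ≤ M := by exact_mod_cast hM
  have hN0 : (0 : ℝ) < N := by linarith
  have hxM : x / N ≤ x / M := by gcongr
  have hoM := h₁ M x hM (by linarith) hx hA
  have hoN := h₁ N x (hM.trans hMN) hNx hx (hxM.trans hA)
  have htM := h₂ M hM1
  have htN := h₂ N (hM1.trans hMN')
  have hS := h₃ x hx
  have hv := h₄ M N x hNx hx
  have hl := h₅ x (by linarith)
  have hmono := mul_one_add_log_div_le hM0 hMN' hNx
  have hNfl : N ≤ ⌊x⌋₊ := Nat.le_floor hNx
  rw [Nat.floor_natCast] at htM htN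
  set L := Real.log x with hLdef
  set S := ∑ n ∈ Icc 1 ⌊x⌋₊, vonMangoldt n ^ 2 with hSdef
  set E := N * x * (1 + Real.log (x / N)) with hE
  have hlN : 0 ≤ Real.log (x / N) := Real.log_nonneg (by rwa [le_div_iff₀ hN0, one_mul])
  have hNE : N * x ≤ E := le_mul_of_one_le_right (by positivity) (by linarith)
  have hEM : M * x * (1 + Real.log (x / M)) ≤ E := by nlinarith
  have hE0 : 0 ≤ E := by positivity
  set F := x ^ 2 / L ^ B with hF
  have hF0 : 0 ≤ F := by positivity
  have hsm : ∑ q ∈ Ioc M N, secondMoment x q = (N - M) * S +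
      2 * (∑ q ∈ Ioc M ⌊x⌋₊, offDiagonal x q - ∑ q ∈ Ioc N ⌊x⌋₊, offDiagonal x q) := by
    rw [← Finset.sum_Ioc_consecutive _ hMN hNfl, add_sub_cancel_right,
      ← Nat.cast_sub hMN]
    calc _ = ∑ q ∈ Ioc M N, (S + 2 * offDiagonal x q) :=
          Finset.sum_congr rfl fun q hq => secondMoment_eq_add_offDiagonal x
            (by have := Finset.mem_Ioc.mp hq; omega)
      _ = _ := by
        rw [Finset.sum_add_distrib, Finset.sum_const, Nat.card_Ioc, nsmul_eq_mul, ← Finset.mul_sum]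
  have hphi : ∑ q ∈ Ioc M N, x ^ 2 / (q.totient : ℝ) =
      x ^ 2 * (∑ q ∈ Icc 1 N, 1 / (q.totient : ℝ) - ∑ q ∈ Icc 1 M, 1 / (q.totient : ℝ)) := by
    rw [show Icc 1 N = Ioc 0 N from rfl, show Icc 1 M = Ioc 0 M from rfl,
      ← Finset.sum_Ioc_consecutive _ (Nat.zero_le M) hMN, add_sub_cancel_left, Finset.mul_sum]
    exact Finset.sum_congr rfl fun q _ => by ring
  have hlog : Real.log (x / M) - Real.log (x / N) = Real.log N - Real.log M := by
    rw [Real.log_div hx0.ne' hM0.ne', Real.log_div hx0.ne' hN0.ne']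
    ring
  have hphi_err : ∀ y : ℝ, M ≤ y → y ≤ x →
      x ^ 2 * (C₂ * (1 + Real.log y) / y) ≤ 4 * C₂ * C₅ * F := by
    intro y hMy hyx
    have hy0 : 0 < y := by linarith
    have h6 : Real.log y ≤ L := Real.log_le_log hy0 hyx
    have h7 : x / y ≤ 2 * L ^ A := le_trans (by gcongr) hA
    calc _ ≤ x ^ 2 * (C₂ * (2 * L) / y) := by
          gcongr
          linarith
      _ = 2 * C₂ * x * L * (x / y) := by ring
      _ ≤ 2 * C₂ * x * L * (2 * L ^ A) := by gcongr
      _ = 4 * C₂ * x * L ^ (A + 1 + B) / L ^ B := by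
          field_simp
          ring
      _ ≤ 4 * C₂ * x * (C₅ * x) / L ^ B := by gcongr
      _ = _ := by rw [hF]; ring
  have heM := hphi_err M le_rfl (by linarith)
  have heN := hphi_err N hMN' hNx
  have hx2 : 0 ≤ x ^ 2 := by positivity
  have htM' : |x ^ 2 * ∑ q ∈ Icc 1 M, 1 / (q.totient : ℝ) -
      x ^ 2 * (totientConst * Real.log M + c')| ≤ 4 * C₂ * C₅ * F := by
    rw [← mul_sub, abs_mul, abs_of_nonneg hx2]
    exact (mul_le_mul_of_nonneg_left htM hx2).trans heM
  have htN' : |x ^ 2 * ∑ q ∈ Icc 1 N, 1 / (q.totient : ℝ) -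
      x ^ 2 * (totientConst * Real.log N + c')| ≤ 4 * C₂ * C₅ * F := by
    rw [← mul_sub, abs_mul, abs_of_nonneg hx2]
    exact (mul_le_mul_of_nonneg_left htN hx2).trans heN
  have hS' : |(N - M) * S - (N - M) * (x * L)| ≤ C₃ * E := by
    rw [← mul_sub, abs_mul, abs_of_nonneg (by linarith)]
    calc _ ≤ (N : ℝ) * (C₃ * x) := by
          gcongr
          linarith
      _ = C₃ * (N * x) := by ring
      _ ≤ _ := by gcongr
  have hoM' : C₁ * (F + M * x * (1 + Real.log (x / M))) ≤ C₁ * (F + E) := by gcongr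
  have hv' : C₄ * (F + N * x) ≤ C₄ * (F + E) := by gcongr
  have hcancel : x ^ 2 / 2 * (totientConst * Real.log (x / M) + c) -
      x ^ 2 / 2 * (totientConst * Real.log (x / N) + c) =
      (x ^ 2 * (totientConst * Real.log N + c') - x ^ 2 * (totientConst * Real.log M + c')) / 2 := by
    linear_combination (x ^ 2 / 2 * totientConst) * hlog
  rw [Finset.sum_sub_distrib, hsm, hphi] at hv
  have p1 : 0 ≤ C₂ * C₅ * E := by positivity
  have p2 : 0 ≤ C₃ * F := by positivity
  rw [abs_le] at hoM hoN htM' htN' hS' hv ⊢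
  obtain ⟨a1, a2⟩ := hoM
  obtain ⟨b1, b2⟩ := hoN
  obtain ⟨c1, c2⟩ := htM'
  obtain ⟨d1, d2⟩ := htN'
  obtain ⟨e1, e2⟩ := hS'
  obtain ⟨f1, f2⟩ := hv
  clear_value S E F
  constructor <;> linarith

end MontgomeryHooley

namespace MontgomeryHooley

open Complex MeasureTheory Filter Topology DirichletCharacter
open ArithmeticFunction (vonMangoldt)

lemma exists_log_pow_le_self (m : ℕ) : ∃ x₀ : ℝ, 256 ≤ x₀ ∧ ∀ x ≥ x₀, Real.log x ^ m ≤ x := by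
  obtain ⟨C, hC, h⟩ := exists_log_pow_le (m + 1)
  refine ⟨max 256 (Real.exp C), le_max_left _ _, fun x hx => ?_⟩
  have hx1 : 256 ≤ x := (le_max_left _ _).trans hx
  have hCL : C ≤ Real.log x :=
    (Real.le_log_iff_exp_le (by linarith)).mpr ((le_max_right _ _).trans hx)
  have hL := one_le_log_of_le hx1
  refine le_of_mul_le_mul_left ?_ hC
  calc C * Real.log x ^ m ≤ Real.log x * Real.log x ^ m := by gcongr
    _ = Real.log x ^ (m + 1) := by ring
    _ ≤ C * x := h x (by linarith)

theorem abs_V_sub_le (B : ℕ) : ∃ x₀ C : ℝ, 256 ≤ x₀ ∧ 0 < C ∧ ∀ x Q : ℝ, x₀ ≤ x → 1 ≤ Q → Q ≤ x →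
    |V x Q - Q * x * Real.log x| ≤
      C * (Q * x * Real.log (2 * x / Q) + x ^ 2 / Real.log x ^ B) := by
  obtain ⟨x₀, hx₀, h₀⟩ := exists_log_pow_le_self (B + 3)
  obtain ⟨C₁, hC₁, h₁⟩ := sum_varianceTerm_le B
  obtain ⟨C₂, hC₂, h₂⟩ := abs_sum_Ioc_varianceTerm_sub_le (B + 3) B
  refine ⟨x₀, 2 * C₁ + 2 * C₂ + 2, hx₀, by positivity, fun x Q hx hQ hQx => ?_⟩
  have hx256 : 256 ≤ x := hx₀.trans hx
  have hx0 : 0 < x := by linarith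
  have hL := one_le_log_of_le hx256
  have hLx := h₀ x hx
  rw [V_eq_sum_varianceTerm]
  set N := ⌊Q⌋₊ with hN
  have hN1 : 1 ≤ N := Nat.floor_pos.mpr hQ
  have hNQ : (N : ℝ) ≤ Q := Nat.floor_le (by linarith)
  have hQN : Q < N + 1 := Nat.lt_floor_add_one Q
  set M := ⌊x / Real.log x ^ (B + 3)⌋₊ with hM
  have ht : 1 ≤ x / Real.log x ^ (B + 3) := by rwa [le_div_iff₀ (by positivity), one_mul]
  have hM1 : 1 ≤ M := Nat.floor_pos.mpr ht
  have hMt : (M : ℝ) ≤ x / Real.log x ^ (B + 3) := Nat.floor_le (by positivity)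
  have htM : x / Real.log x ^ (B + 3) < M + 1 := Nat.lt_floor_add_one _
  have hM1' : (1 : ℝ) ≤ M := by exact_mod_cast hM1
  have hN1' : (1 : ℝ) ≤ N := by exact_mod_cast hN1
  have hMx : (M : ℝ) ≤ x := hMt.trans (div_le_self hx0.le (one_le_pow₀ hL))
  have hl1 := h₁ (min M N) x (le_trans (by exact_mod_cast min_le_left M N) hMx) hx256
  have hl2 : M ≤ N → _ := fun h => h₂ M N x hM1 h (hNQ.trans hQx) hx256 (by
    rw [div_le_iff₀ (by linarith)]
    rw [div_lt_iff₀ (by positivity)] at htM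
    nlinarith [pow_pos (by linarith : 0 < Real.log x) (B + 3)])
  have hl3 := mul_one_add_log_div_le (by linarith) hNQ hQx
  have h2xQ : Real.log (2 * x / Q) = Real.log 2 + Real.log (x / Q) := by
    rw [mul_div_assoc, Real.log_mul two_ne_zero (by positivity)]
  have hxQ : 0 ≤ Real.log (x / Q) :=
    Real.log_nonneg (by rwa [le_div_iff₀ (by linarith), one_mul])
  set L := Real.log x with hLdef
  set F := x ^ 2 / L ^ B with hF
  set E := Q * x * Real.log (2 * x / Q) with hE
  have hF0 : 0 ≤ F := by positivity
  have hE0 : 0 ≤ E := by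
    rw [hE, h2xQ]
    have := Real.log_nonneg one_le_two
    positivity
  have hMF : M * x * L ^ 3 ≤ F := by
    calc _ ≤ x / L ^ (B + 3) * x * L ^ 3 := by gcongr
      _ = F := by
        rw [hF]
        field_simp
        ring
  have hLL : L ≤ L ^ 3 := le_self_pow₀ hL (by norm_num)
  have hMF' : M * x * L ≤ F := le_trans (by gcongr) hMF
  have hmin : (min M N : ℕ) * x * L ^ 3 ≤ F := le_trans (by
    gcongr
    exact min_le_left M N) hMF
  have hl1' : C₁ * (F + (min M N : ℕ) * x * L ^ 3) ≤ 2 * C₁ * F := by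
    nlinarith
  have hl1'' : 0 ≤ ∑ q ∈ Icc 1 (min M N), varianceTerm x q :=
    Finset.sum_nonneg fun q _ => Finset.sum_nonneg fun a _ => sq_nonneg _
  have hEN : N * x * (1 + Real.log (x / N)) ≤ 2 * E := by
    have := Real.log_two_gt_d9
    calc _ = x * (N * (1 + Real.log (x / N))) := by ring
      _ ≤ x * (Q * (1 + Real.log (x / Q))) := by gcongr
      _ = Q * x * (1 + Real.log (x / Q)) := by ring
      _ ≤ Q * x * (2 * (Real.log 2 + Real.log (x / Q))) := by
          gcongr
          linarith
      _ = 2 * E := by rw [hE, h2xQ]; ring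
  have hxL : 0 < x * L := by positivity
  have q1 : 0 ≤ C₁ * E := by positivity
  have q2 : 0 ≤ C₂ * F := by positivity
  have q3 : 0 ≤ C₂ * E := by positivity
  have q4 : 0 ≤ C₁ * F := by positivity
  rcases Nat.lt_or_ge M N with hMN | hMN
  · rw [min_eq_left hMN.le] at hl1 hl1' hl1''
    have hs : ∑ q ∈ Icc 1 N, varianceTerm x q =
        ∑ q ∈ Icc 1 M, varianceTerm x q + ∑ q ∈ Ioc M N, varianceTerm x q := by
      rw [show Icc 1 N = Ioc 0 N from rfl, show Icc 1 M = Ioc 0 M from rfl,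
        Finset.sum_Ioc_consecutive _ (Nat.zero_le M) hMN.le]
    have h3 := hl2 hMN.le
    have h4 : C₂ * (F + N * x * (1 + Real.log (x / N))) ≤ C₂ * (F + 2 * E) := by gcongr
    have h5 : (Q - (N - M)) * (x * L) ≤ 2 * F := by nlinarith
    have h6 : 0 ≤ (Q - (N - M)) * (x * L) := mul_nonneg (by linarith) hxL.le
    rw [hs]
    rw [abs_le] at h3 ⊢
    constructor <;> linarith [h3.1, h3.2]
  · rw [min_eq_right hMN] at hl1 hl1' hl1''
    have hNM' : (N : ℝ) ≤ M := by exact_mod_cast hMN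
    have h5 : Q * x * L ≤ 2 * F := by nlinarith
    have h6 : 0 ≤ Q * x * L := by positivity
    rw [abs_le]
    constructor <;> linarith

end MontgomeryHooley

/-- Montgomery's theorem: for every A > 0 there exist x₀ and C such that for
x > x₀ and 1 ≤ Q ≤ x, |V(x,Q) − Qx log x| ≤ C(Qx log(2x/Q) + x²(log x)^{-A}). -/
theorem montgomery_formula (A : ℝ) (hA : 0 < A) :
    ∃ x₀ C : ℝ, 0 < C ∧ ∀ x Q : ℝ, x₀ < x → 1 ≤ Q → Q ≤ x →
      |V x Q - Q * x * Real.log x| ≤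
        C * (Q * x * Real.log (2 * x / Q) + x ^ 2 * Real.log x ^ (-A)) := by
  obtain ⟨x₀, C, hx₀, hC, h⟩ := MontgomeryHooley.abs_V_sub_le ⌈A⌉₊
  refine ⟨x₀, C, hC, fun x Q hx hQ hQx => (h x Q hx.le hQ hQx).trans ?_⟩
  have hL : 1 ≤ Real.log x := MontgomeryHooley.one_le_log_of_le (hx₀.trans hx.le)
  have key : x ^ 2 / Real.log x ^ ⌈A⌉₊ ≤ x ^ 2 * Real.log x ^ (-A) := by
    rw [div_eq_mul_inv, ← Real.rpow_natCast (Real.log x), ← Real.rpow_neg (by linarith)]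
    gcongr
    exact Nat.le_ceil A
  gcongr
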